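/- arXiv:math/0603655 — 2 statements merged into one kernel-verified Lean document; each statement's English description precedes it below -/
import Mathlib

section
/- There exists an absolute constant κ > 0 with the following property. Let W=(w_{ij}) be a nonnegative real m×n matrix, let R_1,…,R_p be positive integer m-vectors and C_1,…,C_p be positive integer n-vectors with |R_1|=…=|R_p|=|C_1|=…=|C_p|=N, and let α_1,…,α_p ≥ 0 satisfy α_1+…+α_p=1. Suppose R = Σ_{k=1}^p α_k R_k and C = Σ_{k=1}^p α_k C_k are again positive integer vectors, and set a = min{m,n}, s = N/a. Then (κ s)^{(a-1)/2} · T(R,C;W) ≥ ∏_{k=1}^p T(R_k,C_k;W)^{α_k}. -/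
open scoped BigOperators

/-- The total weight `T(R,C;W)` of contingency tables with row sums `R`,
column sums `C`, and weight `∏ W i j ^ D i j` (with the convention `0 ^ 0 = 1`). -/
noncomputable def tableWeight {m n : ℕ} (R : Fin m → ℕ) (C : Fin n → ℕ)
    (W : Fin m → Fin n → ℝ) : ℝ :=
  ∑' D : {D : Fin m → Fin n → ℕ //
      (∀ i, ∑ j, D i j = R i) ∧ (∀ j, ∑ i, D i j = C j)},
    ∏ i, ∏ j, W i j ^ D.1 i j

/-- The quadratic form of `A` is nonpositive on some hyperplane. -/
def NonposOnHyperplane {I : Type*} [Fintype I] (A : Matrix I I ℝ) : Prop :=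
  ∃ l : I → ℝ, ∀ y : I → ℝ, l ⬝ᵥ y = 0 → y ⬝ᵥ A.mulVec y ≤ 0

section LinearAlgebra

open Matrix

variable {I : Type*} [Fintype I] [DecidableEq I]

omit [DecidableEq I] in
lemma dotProduct_mulVec_symm {A : Matrix I I ℝ} (hA : A.IsSymm) (y z : I → ℝ) :
    y ⬝ᵥ A *ᵥ z = z ⬝ᵥ A *ᵥ y := by
  rw [dotProduct_mulVec, ← mulVec_transpose, hA.eq, dotProduct_comm]

lemma single_dotProduct_mulVec (A : Matrix I I ℝ) (u v : I) :
    Pi.single u 1 ⬝ᵥ A *ᵥ Pi.single v 1 = A u v := by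
  simp

lemma NonposOnHyperplane.nonpos_of_mulVec_eq_zero {A : Matrix I I ℝ} (hL : NonposOnHyperplane A)
    (hA : A.IsSymm) {i : I} (hi : 0 < A i i) {y : I → ℝ} (hy : (A *ᵥ y) i = 0) :
    y ⬝ᵥ A *ᵥ y ≤ 0 := by
  obtain ⟨l, hl⟩ := hL
  have hli : l i ≠ 0 := by
    intro h
    have := hl (Pi.single i 1) (by simpa using h)
    rw [single_dotProduct_mulVec] at this
    linarith
  have key := hl (y - (l ⬝ᵥ y / l i) • Pi.single i 1) (by
    simp only [dotProduct_sub, dotProduct_smul, dotProduct_single, smul_eq_mul]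
    field_simp
    ring)
  set τ := l ⬝ᵥ y / l i
  have h1 : Pi.single i 1 ⬝ᵥ A *ᵥ y = 0 := by simpa using hy
  have h2 := dotProduct_mulVec_symm hA (Pi.single i 1) y
  simp only [mulVec_sub, mulVec_smul, sub_dotProduct, dotProduct_sub, smul_dotProduct,
    dotProduct_smul, smul_eq_mul, h1, ← h2, single_dotProduct_mulVec] at key
  nlinarith [mul_nonneg (mul_self_nonneg τ) hi.le]

lemma NonposOnHyperplane.mul_diag_le {A : Matrix I I ℝ} (hL : NonposOnHyperplane A)
    (hA : A.IsSymm) (hn : ∀ u v, 0 ≤ A u v) (u v : I) : A u u * A v v ≤ A u v ^ 2 := by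
  rcases (hn u u).eq_or_lt with h | h
  · rw [← h]; simp; positivity
  have key := hL.nonpos_of_mulVec_eq_zero hA h
    (y := A u u • Pi.single v 1 - A u v • Pi.single u 1) (by
      simp [mulVec_sub, mulVec_smul]; ring)
  have hs : A v u = A u v := hA.apply u v
  simp only [mulVec_sub, mulVec_smul, sub_dotProduct, dotProduct_sub, smul_dotProduct,
    dotProduct_smul, smul_eq_mul, single_dotProduct_mulVec, hs] at key
  have : A u u * (A u u * A v v - A u v ^ 2) ≤ 0 := by nlinarith
  nlinarith [nonpos_of_mul_nonpos_right this h]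

lemma nonposOnHyperplane_of_two {A : Matrix I I ℝ} (hA : A.IsSymm) (hn : ∀ u v, 0 ≤ A u v)
    {i j : I} (hdet : A i i * A j j < A i j ^ 2)
    (h : ∀ y : I → ℝ, (A *ᵥ y) i = 0 → (A *ᵥ y) j = 0 → y ⬝ᵥ A *ᵥ y ≤ 0) :
    NonposOnHyperplane A := by
  refine ⟨fun u => A i u + A j u, fun y hy => ?_⟩
  have hy' : (A *ᵥ y) i + (A *ᵥ y) j = 0 := by
    rw [← hy]; simp [mulVec, dotProduct, add_mul, Finset.sum_add_distrib]
  set a := A i i with ha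
  set b := A i j with hb
  set c := A j j with hc
  have hs : A j i = b := hA.apply i j
  set q : I → ℝ := (b + c) • Pi.single i 1 - (a + b) • Pi.single j 1 with hq
  have hd : a * c - b ^ 2 ≠ 0 := by linarith
  set τ := (A *ᵥ y) i / (a * c - b ^ 2) with hτ
  have hτ' : τ * (a * c - b ^ 2) = (A *ᵥ y) i := by rw [hτ]; field_simp
  have hqi : (A *ᵥ q) i = a * c - b ^ 2 := by
    simp [hq, mulVec_sub, mulVec_smul, ← ha, ← hb]; ring
  have hqj : (A *ᵥ q) j = b ^ 2 - a * c := by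
    simp [hq, mulVec_sub, mulVec_smul, ← hc, hs]; ring
  have hzi : (A *ᵥ (y - τ • q)) i = 0 := by
    simp [mulVec_sub, mulVec_smul, hqi]; linarith
  have hzj : (A *ᵥ (y - τ • q)) j = 0 := by
    simp [mulVec_sub, mulVec_smul, hqj]; linarith
  have hz := h _ hzi hzj
  have hqz : q ⬝ᵥ A *ᵥ (y - τ • q) = 0 := by
    rw [hq]; simp only [sub_dotProduct, smul_dotProduct, single_dotProduct, hq] at *
    rw [hzi, hzj]; simp
  have hqq : q ⬝ᵥ A *ᵥ q = (a + 2 * b + c) * (a * c - b ^ 2) := by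
    conv_lhs => rw [hq]
    simp only [sub_dotProduct, smul_dotProduct, single_dotProduct, smul_eq_mul, one_mul]
    rw [← hq, hqi, hqj]; ring
  have e1 : y ⬝ᵥ A *ᵥ y = (y - τ • q) ⬝ᵥ A *ᵥ (y - τ • q) + 2 * τ * (q ⬝ᵥ A *ᵥ (y - τ • q))
      + τ ^ 2 * (q ⬝ᵥ A *ᵥ q) := by
    have := dotProduct_mulVec_symm hA y q
    simp only [mulVec_sub, mulVec_smul, sub_dotProduct, dotProduct_sub, smul_dotProduct,
      dotProduct_smul, smul_eq_mul, this]
    ring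
  rw [e1, hqz, hqq]
  have : 0 ≤ τ ^ 2 * ((a + 2 * b + c) * (b ^ 2 - a * c)) := by
    have := hn i i; have := hn i j; have := hn j j
    apply mul_nonneg (by positivity) (mul_nonneg (by positivity) (by linarith))
  nlinarith

end LinearAlgebra

section Lorentzian

open Matrix

variable {I : Type*} [DecidableEq I]

/-- The matrix of second shifts of a function on the integer lattice. -/
def shiftForm (f : (I → ℤ) → ℝ) (x : I → ℤ) : Matrix I I ℝ :=
  Matrix.of fun u v => f (x + Pi.single u 1 + Pi.single v 1)

lemma shiftForm_isSymm (f : (I → ℤ) → ℝ) (x : I → ℤ) : (shiftForm f x).IsSymm := by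
  ext u v
  simp [shiftForm, add_right_comm]

variable [Fintype I]

/-- Nonnegative functions on the lattice with product support `∏ S u` all of whose second shift
forms have at most one positive direction. -/
structure IsDiscreteLorentzian (S : I → Set ℤ) (f : (I → ℤ) → ℝ) : Prop where
  nonneg : ∀ x, 0 ≤ f x
  pos_iff : ∀ x, 0 < f x ↔ ∀ u, x u ∈ S u
  form : ∀ x, NonposOnHyperplane (shiftForm f x)

lemma nonposOnHyperplane_shiftForm_of_notMem {S : I → Set ℤ} {f : (I → ℤ) → ℝ}
    (hf : ∀ x, 0 ≤ f x) (hS : ∀ x, 0 < f x ↔ ∀ u, x u ∈ S u) {x : I → ℤ} {u : I} (hu : x u ∉ S u) :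
    NonposOnHyperplane (shiftForm f x) := by
  refine ⟨Pi.single u 1, fun y hy => ?_⟩
  have hyu : y u = 0 := by simpa using hy
  apply le_of_eq
  simp only [dotProduct, mulVec, shiftForm, of_apply, Finset.mul_sum]
  refine Finset.sum_eq_zero fun v _ => Finset.sum_eq_zero fun w _ => ?_
  by_cases hv : v = u
  · subst hv; simp [hyu]
  by_cases hw : w = u
  · subst hw; simp [hyu]
  have : f (x + Pi.single v 1 + Pi.single w 1) = 0 := by
    refine le_antisymm (not_lt.1 fun h => hu ?_) (hf _)
    have := (hS _).1 h u
    simpa [Ne.symm hv, Ne.symm hw] using this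
  simp [this]

lemma IsDiscreteLorentzian.eq_zero {S : I → Set ℤ} {f : (I → ℤ) → ℝ}
    (hf : IsDiscreteLorentzian S f) {x : I → ℤ} {u : I} (hu : x u ∉ S u) : f x = 0 :=
  le_antisymm (not_lt.1 fun h => hu ((hf.pos_iff x).1 h u)) (hf.nonneg x)

lemma IsDiscreteLorentzian.mul_le_sq {S : I → Set ℤ} {f : (I → ℤ) → ℝ}
    (hf : IsDiscreteLorentzian S f) (x : I → ℤ) (u v : I) :
    f (x + Pi.single u 1 + Pi.single u 1) * f (x + Pi.single v 1 + Pi.single v 1) ≤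
      f (x + Pi.single u 1 + Pi.single v 1) ^ 2 :=
  (hf.form x).mul_diag_le (shiftForm_isSymm f x) (fun _ _ => hf.nonneg _) u v

/-- Products of one-variable log-concave functions. -/
lemma isDiscreteLorentzian_prod (S : I → Set ℤ) (ρ : I → ℤ → ℝ) (h0 : ∀ u t, 0 ≤ ρ u t)
    (hS : ∀ u t, 0 < ρ u t ↔ t ∈ S u)
    (hlc : ∀ u t, ρ u t * ρ u (t + 1 + 1) ≤ ρ u (t + 1) ^ 2) :
    IsDiscreteLorentzian S fun x => ∏ u, ρ u (x u) := by
  have hn : ∀ x : I → ℤ, 0 ≤ ∏ u, ρ u (x u) := fun x => Finset.prod_nonneg fun u _ => h0 u _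
  have hp : ∀ x : I → ℤ, 0 < ∏ u, ρ u (x u) ↔ ∀ u, x u ∈ S u := by
    intro x
    rw [(hn x).lt_iff_ne', Finset.prod_ne_zero_iff]
    simp [← hS, (h0 _ _).lt_iff_ne']
  refine ⟨hn, hp, fun x => ?_⟩
  by_cases hx : ∀ u, x u ∈ S u
  swap
  · push Not at hx
    obtain ⟨u, hu⟩ := hx
    exact nonposOnHyperplane_shiftForm_of_notMem hn hp hu
  have hpos : ∀ u, 0 < ρ u (x u) := fun u => (hS u _).2 (hx u)
  set G := ∏ u, ρ u (x u) with hG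
  set lam : I → ℝ := fun u => ρ u (x u + 1) / ρ u (x u) with hlam
  set mu : I → ℝ := fun u => ρ u (x u + 1 + 1) / ρ u (x u) with hmu
  have hml : ∀ u, mu u ≤ lam u ^ 2 := by
    intro u
    have := hlc u (x u)
    have hu := hpos u
    simp only [hmu, hlam, div_pow]
    rw [div_le_div_iff₀ hu (by positivity)]
    nlinarith
  have hQ : ∀ u v, shiftForm (fun x => ∏ u, ρ u (x u)) x u v
      = G * (lam u * lam v - if u = v then lam u ^ 2 - mu u else 0) := by
    intro u v
    simp only [shiftForm, of_apply]
    by_cases huv : u = v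
    · subst huv
      rw [if_pos rfl, show lam u * lam u - (lam u ^ 2 - mu u) = mu u by ring, hG]
      have : mu u = ∏ w, if w = u then mu w else 1 := by simp
      rw [this, ← Finset.prod_mul_distrib]
      refine Finset.prod_congr rfl fun w _ => ?_
      by_cases hw : w = u
      · subst hw; have := hpos w; simp [hmu]; field_simp
      · simp [hw]
    · rw [if_neg huv, sub_zero, hG]
      have h1 : lam u = ∏ w, if w = u then lam w else 1 := by simp
      have h2 : lam v = ∏ w, if w = v then lam w else 1 := by simp
      rw [h1, h2, ← Finset.prod_mul_distrib, ← Finset.prod_mul_distrib]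
      refine Finset.prod_congr rfl fun w _ => ?_
      by_cases hw : w = u
      · subst hw; have := hpos w; simp [hlam, huv]; field_simp
      · by_cases hw' : w = v
        · subst hw'; have := hpos w; simp [hlam, hw]; field_simp
        · simp [hw, hw']
  refine ⟨lam, fun y hy => ?_⟩
  have : y ⬝ᵥ (shiftForm (fun x => ∏ u, ρ u (x u)) x) *ᵥ y
      = G * ((lam ⬝ᵥ y) ^ 2 - ∑ u, (lam u ^ 2 - mu u) * y u ^ 2) := by
    simp only [dotProduct, mulVec, hQ]
    rw [sq, Finset.sum_mul_sum, mul_sub, Finset.mul_sum, Finset.mul_sum, ← Finset.sum_sub_distrib]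
    refine Finset.sum_congr rfl fun u _ => ?_
    simp only [mul_sub, sub_mul, Finset.sum_sub_distrib, Finset.mul_sum]
    congr 1
    · exact Finset.sum_congr rfl fun v _ => by ring
    · rw [Finset.sum_eq_single u]
      · simp; ring
      · intro v _ hv; simp [Ne.symm hv]
      · simp
  rw [this, hy]
  have h1 : 0 ≤ ∑ u, (lam u ^ 2 - mu u) * y u ^ 2 :=
    Finset.sum_nonneg fun u _ => mul_nonneg (by linarith [hml u]) (sq_nonneg _)
  nlinarith [mul_nonneg (hn x) h1]

/-- Adding an edge from `i` to `j` preserves the class. -/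
lemma IsDiscreteLorentzian.edge {S : I → Set ℤ} {f g : (I → ℤ) → ℝ}
    (hf : IsDiscreteLorentzian S f) {i j : I} (hij : i ≠ j) (hSj : S j = Set.Iic 0)
    (hSi : ∀ t ∈ S i, t + 1 ∈ S i) {w : ℝ} (hw : 0 < w)
    (hg0 : ∀ x, 0 ≤ g x) (hgp : ∀ x, 0 < g x ↔ ∀ u, x u ∈ S u)
    (hrec : ∀ x, g x = f x + w * g (x + Pi.single j 1 - Pi.single i 1)) :
    IsDiscreteLorentzian S g := by
  have hgz : ∀ {x : I → ℤ} {u : I}, x u ∉ S u → g x = 0 := fun {x u} hu =>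
    le_antisymm (not_lt.1 fun h => hu ((hgp x).1 h u)) (hg0 x)
  have hji := hij.symm
  -- strict determinant inequality, for points in the support
  have hdet : ∀ n : ℕ, ∀ x : I → ℤ, (∀ u, x u ∈ S u) → (-x j).toNat = n →
      f (x + Pi.single i 1 - Pi.single j 1) * g (x + Pi.single j 1 - Pi.single i 1) < f x * g x := by
    intro n
    induction n with
    | zero =>
      intro x hx hn
      have hxj : x j ≤ 0 := by simpa [hSj] using hx j
      have hxj0 : x j = 0 := by omega
      rw [hgz (x := x + Pi.single j 1 - Pi.single i 1) (u := j) (by simp [hji, hSj, hxj0]), mul_zero]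
      exact mul_pos ((hf.pos_iff x).2 hx) ((hgp x).2 hx)
    | succ n ih =>
      intro x hx hn
      have hfx := (hf.pos_iff x).2 hx
      have hgx := (hgp x).2 hx
      set x' := x + Pi.single j 1 - Pi.single i 1 with hx'
      by_cases hd : ∀ u, x' u ∈ S u
      swap
      · push Not at hd
        obtain ⟨u, hu⟩ := hd
        rw [hgz hu, mul_zero]
        exact mul_pos hfx hgx
      have hgx' := (hgp x').2 hd
      have hfx' := (hf.pos_iff x').2 hd
      have hI := ih x' hd (by simp [hx', hji]; omega)
      have e1 : x' + Pi.single i 1 - Pi.single j 1 = x := by rw [hx']; abel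
      rw [e1] at hI
      have hlc : f (x + Pi.single i 1 - Pi.single j 1) * f x' ≤ f x ^ 2 := by
        have := hf.mul_le_sq (x - Pi.single i 1 - Pi.single j 1) i j
        convert this using 3
        · abel_nf
        · rw [hx']; abel_nf
        · abel_nf
      set φ0 := f (x + Pi.single i 1 - Pi.single j 1) with hφ0
      have hφ0' : 0 ≤ φ0 := hf.nonneg _
      have hr1 : g x = f x + w * g x' := hrec x
      have hr2 := hrec x'
      set G3 := g (x' + Pi.single j 1 - Pi.single i 1)
      have hG3 : 0 ≤ G3 := hg0 _
      have key : φ0 * G3 < f x * g x' := by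
        rcases hφ0'.eq_or_lt with h | h
        · rw [← h, zero_mul]; exact mul_pos hfx hgx'
        · have h1 : f x * (φ0 * G3) < f x * (f x * g x') := by
            calc f x * (φ0 * G3) = φ0 * (f x * G3) := by ring
              _ < φ0 * (f x' * g x') := mul_lt_mul_of_pos_left hI h
              _ = (φ0 * f x') * g x' := by ring
              _ ≤ f x ^ 2 * g x' := mul_le_mul_of_nonneg_right hlc hgx'.le
              _ = _ := by ring
          exact lt_of_mul_lt_mul_left h1 hfx.le
      have e2 : φ0 * g x' = φ0 * f x' + w * (φ0 * G3) := by rw [hr2]; ring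
      have e3 : f x * g x = f x ^ 2 + w * (f x * g x') := by rw [hr1]; ring
      linarith [mul_lt_mul_of_pos_left key hw]
  have hform : ∀ n : ℕ, ∀ x : I → ℤ, (-x j).toNat = n → NonposOnHyperplane (shiftForm g x) := by
    intro n
    induction n with
    | zero =>
      intro x hn
      have : shiftForm g x = shiftForm f x - w • (0 : Matrix I I ℝ) +
          w • (shiftForm g (x + Pi.single j 1 - Pi.single i 1)) := by
        ext u v
        simp only [shiftForm, of_apply, Matrix.add_apply, Matrix.sub_apply, Matrix.smul_apply,
          smul_eq_mul]
        rw [hrec]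
        simp
        left
        congr 1; abel
      have h2 : shiftForm g (x + Pi.single j 1 - Pi.single i 1) = 0 := by
        ext u v
        refine hgz (u := j) ?_
        have h1 : (0:ℤ) ≤ (Pi.single u 1 : I → ℤ) j := by
          rw [Pi.single_apply]; split_ifs <;> simp
        have h2 : (0:ℤ) ≤ (Pi.single v 1 : I → ℤ) j := by
          rw [Pi.single_apply]; split_ifs <;> simp
        simp [hSj, hji]
        omega
      rw [this, h2]
      simpa using hf.form x
    | succ n ih =>
      intro x hn
      by_cases hx : ∀ u, x u ∈ S u
      swap
      · push Not at hx
        obtain ⟨u, hu⟩ := hx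
        exact nonposOnHyperplane_shiftForm_of_notMem hg0 hgp hu
      have hxj : x j ≤ 0 := by simpa [hSj] using hx j
      set x' := x + Pi.single j 1 - Pi.single i 1 with hx'
      have hx1 : ∀ u, (x + Pi.single i 1 + Pi.single j 1 : I → ℤ) u ∈ S u := by
        intro u
        by_cases hui : u = i
        · subst hui; simpa [hij] using hSi _ (hx u)
        by_cases huj : u = j
        · subst huj; simp [hji, hSj]; omega
        · simpa [hui, huj] using hx u
      have hx2 : ∀ u, (x + Pi.single i 1 + Pi.single i 1 : I → ℤ) u ∈ S u := by
        intro u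
        by_cases hui : u = i
        · subst hui; simpa using hSi _ (hSi _ (hx u))
        · simpa [hui] using hx u
      have hB := ih x' (by simp [hx', hji]; omega)
      have hA := hf.form x
      set A := shiftForm f x with hAdef
      set B := shiftForm g x' with hBdef
      set M := shiftForm g x with hMdef
      have hM : M = A + w • B := by
        ext u v
        simp only [hMdef, hAdef, hBdef, shiftForm, of_apply, Matrix.add_apply, Matrix.smul_apply,
          smul_eq_mul]
        rw [hrec]
        congr 3; rw [hx']; abel
      have hAs : A.IsSymm := shiftForm_isSymm f x
      have hBs : B.IsSymm := shiftForm_isSymm g x'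
      have hMs : M.IsSymm := shiftForm_isSymm g x
      have hBi : ∀ y, (B *ᵥ y) i = (M *ᵥ y) j := by
        intro y
        simp only [mulVec, dotProduct]
        refine Finset.sum_congr rfl fun v _ => ?_
        congr 1
        simp only [hMdef, hBdef, shiftForm, of_apply]
        congr 1; rw [hx']; abel
      have hAi : ∀ y, (A *ᵥ y) i = (M *ᵥ y) i - w * (M *ᵥ y) j := by
        intro y
        rw [← hBi, hM, add_mulVec, smul_mulVec]
        simp
      have hAii : 0 < A i i := (hf.pos_iff _).2 hx2
      have hBii : 0 < B i i := by
        have : B i i = g (x + Pi.single i 1 + Pi.single j 1) := by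
          simp only [hBdef, shiftForm, of_apply]
          congr 1; rw [hx']; abel
        rw [this]
        exact (hgp _).2 hx1
      refine nonposOnHyperplane_of_two hMs (fun _ _ => hg0 _) (i := i) (j := j) ?_ ?_
      · have hk := hdet _ _ hx1 rfl
        have e1 : x + Pi.single i 1 + Pi.single j 1 + Pi.single i 1 - Pi.single j 1
          = x + Pi.single i 1 + Pi.single i 1 := by abel
        have e2 : x + Pi.single i 1 + Pi.single j 1 + Pi.single j 1 - Pi.single i 1
          = x + Pi.single j 1 + Pi.single j 1 := by abel
        have e3 : x + Pi.single i 1 + Pi.single i 1 + Pi.single j 1 - Pi.single i 1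
          = x + Pi.single i 1 + Pi.single j 1 := by abel
        rw [e1, e2] at hk
        have h1 := hrec (x + Pi.single i 1 + Pi.single j 1)
        have h2 := hrec (x + Pi.single i 1 + Pi.single i 1)
        rw [e2] at h1
        rw [e3] at h2
        simp only [hMdef, shiftForm, of_apply]
        rw [h2, sq]
        have h3 := congrArg (fun t => g (x + Pi.single i 1 + Pi.single j 1) * t) h1
        rw [h3]
        linarith
      · intro y hyi hyj
        have h1 := hA.nonpos_of_mulVec_eq_zero hAs hAii (y := y) (by rw [hAi, hyi, hyj]; simp)
        have h2 := hB.nonpos_of_mulVec_eq_zero hBs hBii (y := y) (by rw [hBi, hyj])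
        rw [hM, add_mulVec, smul_mulVec, dotProduct_add, dotProduct_smul, smul_eq_mul]
        nlinarith
  exact ⟨hg0, hgp, fun x => hform _ x rfl⟩

end Lorentzian

section Tables

variable {ι κ : Type*} [Fintype ι] [Fintype κ] [DecidableEq ι] [DecidableEq κ]

/-- The monomial of a table. -/
def tableMonomial (W : ι → κ → ℝ) (D : ι → κ → ℕ) : ℝ := ∏ i, ∏ j, W i j ^ D i j

/-- The boundary of a table, viewed as a flow from rows to columns. -/
def tableBoundary (D : ι → κ → ℕ) : ι ⊕ κ → ℤ :=
  Sum.elim (fun i => -∑ j, (D i j : ℤ)) (fun j => ∑ i, (D i j : ℤ))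

/-- The sum of the values of `g` at all points reached by tables, weighted by monomials. -/
noncomputable def tableTransform (W : ι → κ → ℝ) (g : (ι ⊕ κ → ℤ) → ℝ) (x : ι ⊕ κ → ℤ) : ℝ :=
  ∑ᶠ D : ι → κ → ℕ, tableMonomial W D * g (x + tableBoundary D)

/-- The table with a single unit entry. -/
def unitTable (i : ι) (j : κ) : ι → κ → ℕ := Pi.single i (Pi.single j 1)

omit [Fintype ι] [Fintype κ] in
lemma unitTable_apply (i i' : ι) (j j' : κ) :
    unitTable i j i' j' = if i' = i ∧ j' = j then 1 else 0 := by
  unfold unitTable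
  by_cases hi : i' = i
  · subst hi; simp [Pi.single_apply]
  · simp [hi]

omit [DecidableEq ι] [DecidableEq κ] in
lemma tableMonomial_add (W : ι → κ → ℝ) (D E : ι → κ → ℕ) :
    tableMonomial W (D + E) = tableMonomial W D * tableMonomial W E := by
  simp [tableMonomial, pow_add, Finset.prod_mul_distrib]

lemma tableMonomial_unitTable (W : ι → κ → ℝ) (i : ι) (j : κ) :
    tableMonomial W (unitTable i j) = W i j := by
  unfold tableMonomial
  rw [Finset.prod_eq_single i, Finset.prod_eq_single j]
  · simp [unitTable_apply]
  · intro b _ hb; simp [unitTable_apply, hb]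
  · simp
  · intro b _ hb; simp [unitTable_apply, hb]
  · simp

omit [DecidableEq ι] [DecidableEq κ] in
lemma tableMonomial_nonneg {W : ι → κ → ℝ} (hW : ∀ i j, 0 ≤ W i j) (D : ι → κ → ℕ) :
    0 ≤ tableMonomial W D :=
  Finset.prod_nonneg fun i _ => Finset.prod_nonneg fun j _ => pow_nonneg (hW i j) _

omit [DecidableEq ι] [DecidableEq κ] in
lemma tableBoundary_add (D E : ι → κ → ℕ) :
    tableBoundary (D + E) = tableBoundary D + tableBoundary E := by
  ext u
  cases u <;> simp [tableBoundary, Finset.sum_add_distrib]; ring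

lemma tableBoundary_unitTable (i : ι) (j : κ) :
    tableBoundary (unitTable i j) = Pi.single (Sum.inr j) 1 - Pi.single (Sum.inl i) 1 := by
  ext u
  cases u with
  | inl i' =>
    by_cases h : i' = i <;> simp [tableBoundary, unitTable_apply, h, Finset.filter_eq']
  | inr j' =>
    by_cases h : j' = j <;> simp [tableBoundary, unitTable_apply, h, Finset.filter_eq']

omit [DecidableEq ι] [DecidableEq κ] in
lemma tableBoundary_zero : tableBoundary (0 : ι → κ → ℕ) = 0 := by
  ext u
  cases u <;> simp [tableBoundary]

variable {S : ι ⊕ κ → Set ℤ} {g : (ι ⊕ κ → ℤ) → ℝ}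

omit [DecidableEq ι] [DecidableEq κ] in
lemma le_of_vanishing (hg : ∀ x j, 0 < x (Sum.inr j) → g x = 0) (W : ι → κ → ℝ)
    (x : ι ⊕ κ → ℤ) {D : ι → κ → ℕ} (hD : tableMonomial W D * g (x + tableBoundary D) ≠ 0)
    (i : ι) (j : κ) : D i j ≤ (-x (Sum.inr j)).toNat := by
  by_contra! h
  refine hD ?_
  rw [hg _ j, mul_zero]
  have h1 : (D i j : ℤ) ≤ ∑ i, (D i j : ℤ) :=
    Finset.single_le_sum (f := fun i => (D i j : ℤ)) (fun _ _ => by positivity) (Finset.mem_univ i)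
  simp [tableBoundary]
  omega

omit [DecidableEq ι] [DecidableEq κ] in
lemma tableTransform_support_finite (hg : ∀ x j, 0 < x (Sum.inr j) → g x = 0) (W : ι → κ → ℝ)
    (x : ι ⊕ κ → ℤ) :
    (Function.support fun D => tableMonomial W D * g (x + tableBoundary D)).Finite := by
  classical
  refine (Set.finite_Iic (fun _ j => (-x (Sum.inr j)).toNat : ι → κ → ℕ)).subset ?_
  intro D hD i j
  exact le_of_vanishing hg W x hD i j

lemma tableTransform_rec (hg : ∀ x j, 0 < x (Sum.inr j) → g x = 0) (W : ι → κ → ℝ)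
    (x : ι ⊕ κ → ℤ) (i : ι) (j : κ) :
    tableTransform W g x =
      tableTransform (fun i' j' => if i' = i ∧ j' = j then 0 else W i' j') g x +
      W i j * tableTransform W g (x + Pi.single (Sum.inr j) 1 - Pi.single (Sum.inl i) 1) := by
  unfold tableTransform
  set F : (ι → κ → ℕ) → ℝ := fun D => tableMonomial W D * g (x + tableBoundary D) with hF
  have hinj : Function.Injective (fun D : ι → κ → ℕ => D + unitTable i j) :=
    add_left_injective _
  have hfin := tableTransform_support_finite hg W x
  have hsplit := finsum_mem_add_sdiff' (f := F) (s := Set.range fun D => D + unitTable i j)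
    (t := Set.univ) (Set.subset_univ _) (hfin.subset Set.inter_subset_right)
  rw [finsum_mem_univ, finsum_mem_range hinj] at hsplit
  rw [← hsplit, add_comm]
  congr 1
  · rw [← Set.compl_eq_univ_sdiff, finsum_mem_def]
    refine finsum_congr fun D => ?_
    by_cases hD : D i j = 0
    · rw [Set.indicator_of_mem]
      · simp only [hF]
        congr 1
        unfold tableMonomial
        refine Finset.prod_congr rfl fun i' _ => Finset.prod_congr rfl fun j' _ => ?_
        by_cases h : i' = i ∧ j' = j
        · obtain ⟨rfl, rfl⟩ := h; simp [hD]
        · simp [h]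
      · rintro ⟨E, rfl⟩
        simp [unitTable_apply] at hD
    · rw [Set.indicator_of_notMem]
      · have : tableMonomial (fun i' j' => if i' = i ∧ j' = j then 0 else W i' j') D = 0 := by
          refine Finset.prod_eq_zero (Finset.mem_univ i) (Finset.prod_eq_zero (Finset.mem_univ j) ?_)
          simp [hD]
        rw [this, zero_mul]
      · rw [Set.mem_compl_iff, not_not]
        refine ⟨D - unitTable i j, ?_⟩
        ext i' j'
        simp only [Pi.add_apply, Pi.sub_apply, unitTable_apply]
        split_ifs with h
        · obtain ⟨rfl, rfl⟩ := h; omega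
        · rfl
  · rw [mul_finsum]
    · refine finsum_congr fun D => ?_
      simp only [hF]
      rw [tableMonomial_add, tableMonomial_unitTable, tableBoundary_add, tableBoundary_unitTable]
      have : x + (tableBoundary D + (Pi.single (Sum.inr j) 1 - Pi.single (Sum.inl i) 1))
        = x + Pi.single (Sum.inr j) 1 - Pi.single (Sum.inl i) 1 + tableBoundary D := by abel
      rw [this]; ring

omit [DecidableEq ι] [DecidableEq κ] in
lemma tableTransform_zero (g : (ι ⊕ κ → ℤ) → ℝ) (x : ι ⊕ κ → ℤ) :
    tableTransform (fun (_ : ι) (_ : κ) => 0) g x = g x := by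
  unfold tableTransform
  rw [finsum_eq_single _ 0]
  · simp [tableBoundary_zero, tableMonomial]
  · intro D hD
    have : ∃ i j, D i j ≠ 0 := by
      by_contra! h
      exact hD (by ext i j; simp [h])
    obtain ⟨i, j, h⟩ := this
    have : tableMonomial (fun (_ : ι) (_ : κ) => (0 : ℝ)) D = 0 :=
      Finset.prod_eq_zero (Finset.mem_univ i) (Finset.prod_eq_zero (Finset.mem_univ j) (by simp [h]))
    rw [this, zero_mul]

/-- The table transform preserves discrete Lorentzian functions. -/
lemma IsDiscreteLorentzian.tableTransform (hg : IsDiscreteLorentzian S g)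
    (hSc : ∀ j, S (Sum.inr j) = Set.Iic 0) (hSr : ∀ i, ∀ t ∈ S (Sum.inl i), t + 1 ∈ S (Sum.inl i))
    {W : ι → κ → ℝ} (hW : ∀ i j, 0 ≤ W i j) :
    IsDiscreteLorentzian S (tableTransform W g) := by
  have hv : ∀ x j, 0 < x (Sum.inr j) → g x = 0 := fun x j hx =>
    hg.eq_zero (u := Sum.inr j) (by simpa [hSc] using hx)
  have main : ∀ E : Finset (ι × κ), IsDiscreteLorentzian S
      (_root_.tableTransform (fun i j => if (i, j) ∈ E then W i j else 0) g) := by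
    intro E
    induction E using Finset.induction_on with
    | empty =>
      have : _root_.tableTransform (fun (i : ι) (j : κ) =>
          if (i, j) ∈ (∅ : Finset (ι × κ)) then W i j else 0) g = g := by
        funext x
        simpa using tableTransform_zero g x
      rw [this]; exact hg
    | insert e E he ih =>
      obtain ⟨i, j⟩ := e
      set V := fun (i' : ι) (j' : κ) => if (i', j') ∈ insert (i, j) E then W i' j' else 0 with hV
      have hVij : V i j = W i j := by simp [hV]
      have hrec := fun x => tableTransform_rec hv V x i j
      have hV0 : (fun i' j' => if i' = i ∧ j' = j then 0 else V i' j')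
          = fun i' j' => if (i', j') ∈ E then W i' j' else 0 := by
        funext i' j'
        by_cases h : i' = i ∧ j' = j
        · obtain ⟨rfl, rfl⟩ := h; simp [he]
        · simp [hV, h]
      rw [hV0, hVij] at hrec
      have hVn : ∀ i j, 0 ≤ V i j := fun i j => by
        simp only [hV]; split_ifs
        · exact hW i j
        · exact le_rfl
      have hn : ∀ x, 0 ≤ _root_.tableTransform V g x := fun x =>
        finsum_nonneg fun D => mul_nonneg (tableMonomial_nonneg hVn D) (hg.nonneg _)
      rcases (hW i j).eq_or_lt with h0 | h0
      · have : _root_.tableTransform V g = _root_.tableTransform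
            (fun i' j' => if (i', j') ∈ E then W i' j' else 0) g := by
          funext x; rw [hrec x, ← h0]; simp
        rw [this]; exact ih
      refine ih.edge (i := Sum.inl i) (j := Sum.inr j) (by simp) (hSc j) (hSr i) h0 hn ?_ hrec
      intro x
      constructor
      · intro hx
        by_contra! h
        obtain ⟨u, hu⟩ := h
        refine hx.ne' ?_
        refine finsum_eq_zero_of_forall_eq_zero fun D => ?_
        rw [hg.eq_zero (u := u), mul_zero]
        intro h
        apply hu
        cases u with
        | inl i' =>
          have h1 : ∀ n : ℕ, ∀ t ∈ S (Sum.inl i'), t + n ∈ S (Sum.inl i') := by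
            intro n
            induction n with
            | zero => simp
            | succ n ihn =>
              intro t ht
              have := hSr i' _ (ihn t ht)
              push_cast
              rwa [← add_assoc]
          have h2 := h1 (∑ j, D i' j) _ h
          simpa [tableBoundary] using h2
        | inr j' =>
          rw [hSc] at h ⊢
          simp only [tableBoundary, Pi.add_apply, Sum.elim_inr, Set.mem_Iic] at h ⊢
          have : (0 : ℤ) ≤ ∑ i, (D i j' : ℤ) := Finset.sum_nonneg fun _ _ => by positivity
          omega
      · intro hx
        have := (ih.pos_iff x).2 hx
        rw [hrec x]
        have := mul_nonneg h0.le (hn (x + Pi.single (Sum.inr j) 1 - Pi.single (Sum.inl i) 1))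
        linarith
  simpa using main Finset.univ

end Tables

section Slices

open Filter Topology

variable {ι κ : Type*} [Fintype ι] [Fintype κ] [DecidableEq ι] [DecidableEq κ]

/-- The tables with prescribed column sums. -/
def columnTables (ι : Type*) [Fintype ι] [DecidableEq ι] (C : κ → ℕ) : Finset (ι → κ → ℕ) :=
  (Finset.Iic fun _ j => C j).filter fun D => ∀ j, ∑ i, D i j = C j

lemma mem_columnTables {C : κ → ℕ} {D : ι → κ → ℕ} :
    D ∈ columnTables ι C ↔ ∀ j, ∑ i, D i j = C j := by
  simp only [columnTables, Finset.mem_filter, Finset.mem_Iic, and_iff_right_iff_imp]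
  intro h i j
  change D i j ≤ C j
  rw [← h j]
  exact Finset.single_le_sum (f := fun i => D i j) (fun _ _ => Nat.zero_le _) (Finset.mem_univ i)

/-- The weighted sum over tables with column sums `C`, exact row sums on `A`, and `i`-th row
sum `k`, the remaining rows being weighted by `v`. -/
noncomputable def rowSlice (W : ι → κ → ℝ) (C : κ → ℕ) (A : Finset ι) (r : ι → ℕ)
    (v : ι → ℤ → ℝ) (i : ι) (k : ℕ) : ℝ :=
  ∑ D ∈ columnTables ι C with (∀ a ∈ A, ∑ j, D a j = r a) ∧ ∑ j, D i j = k,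
    tableMonomial W D * ∏ u ∈ (insert i A)ᶜ, v u (-∑ j, (D u j : ℤ))

/-- The weights interpolating between exact (`ε = 0`) and free marginal constraints. -/
noncomputable def marginWeight (A : Finset ι) (v : ι → ℤ → ℝ) (ε : ℝ) : ι ⊕ κ → ℤ → ℝ :=
  Sum.elim (fun u t => if u ∈ A then (if 0 ≤ t then ε ^ t.toNat else 0) else v u t)
    (fun _ t => if t ≤ 0 then ε ^ (-t).toNat else 0)

/-- The marginal support sets. -/
def marginSupport (κ : Type*) (A : Finset ι) : ι ⊕ κ → Set ℤ :=
  Sum.elim (fun u => if u ∈ A then Set.Ici 0 else Set.univ) (fun _ => Set.Iic 0)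

lemma isDiscreteLorentzian_marginWeight (A : Finset ι) {v : ι → ℤ → ℝ} (hv : ∀ u t, 0 < v u t)
    (hlc : ∀ u t, v u t * v u (t + 1 + 1) ≤ v u (t + 1) ^ 2) {ε : ℝ} (hε : 0 < ε) :
    IsDiscreteLorentzian (marginSupport κ A)
      fun x : ι ⊕ κ → ℤ => ∏ u, marginWeight A v ε u (x u) := by
  refine isDiscreteLorentzian_prod _ _ ?_ ?_ ?_
  · rintro (u | j) t
    · simp only [marginWeight, Sum.elim_inl]
      split_ifs
      · positivity
      · exact le_rfl
      · exact (hv u t).le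
    · simp only [marginWeight, Sum.elim_inr]
      split_ifs
      · positivity
      · exact le_rfl
  · rintro (u | j) t
    · simp only [marginWeight, marginSupport, Sum.elim_inl]
      split_ifs with h1 h2
      · simpa [h2] using pow_pos hε _
      · simpa using h2
      · simpa using hv u t
    · simp only [marginWeight, marginSupport, Sum.elim_inr]
      split_ifs with h2
      · simpa [h2] using pow_pos hε _
      · simpa using h2
  · rintro (u | j) t
    · simp only [marginWeight, Sum.elim_inl]
      by_cases hu : u ∈ A
      · simp only [if_pos hu]
        split_ifs with h1 h2 h3
        · rw [← pow_add, ← pow_mul]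
          exact le_of_eq (congrArg _ (by omega))
        all_goals first | omega | simp
        all_goals positivity
      · simpa only [if_neg hu] using hlc u t
    · simp only [marginWeight, Sum.elim_inr]
      split_ifs with h1 h2 h3 h4 h5
      · rw [← pow_add, ← pow_mul]
        exact le_of_eq (congrArg _ (by omega))
      all_goals first | omega | simp
      all_goals positivity

/-- The lattice point encoding the margins. -/
def marginPoint (C : κ → ℕ) (A : Finset ι) (r : ι → ℕ) (i i0 : ι) (a b : ℤ) : ι ⊕ κ → ℤ :=
  Sum.elim (fun u => if u = i then a else if u = i0 then b else if u ∈ A then r u else 0)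
    (fun j => -C j)

lemma tendsto_tableTransform_marginWeight (W : ι → κ → ℝ) (C : κ → ℕ) {A : Finset ι} (r : ι → ℕ)
    {v : ι → ℤ → ℝ} {i i0 : ι} (hi : i ∉ A) (hi0 : i0 ∉ A) (hv0 : ∀ t, v i0 t = 1)
    (k : ℕ) (b : ℤ) :
    Tendsto (fun ε => tableTransform W (fun x : ι ⊕ κ → ℤ => ∏ u, marginWeight (insert i A) v ε u (x u))
      (marginPoint C A r i i0 k b)) (𝓝[>] 0) (𝓝 (rowSlice W C A r v i k)) := by
  have hsum : ∀ ε, tableTransform W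
      (fun x : ι ⊕ κ → ℤ => ∏ u, marginWeight (insert i A) v ε u (x u))
      (marginPoint C A r i i0 k b) = ∑ D ∈ Finset.Iic (fun (_ : ι) j => C j), tableMonomial W D *
        ∏ u, marginWeight (insert i A) v ε u ((marginPoint C A r i i0 k b + tableBoundary D) u) := by
    intro ε
    refine finsum_eq_sum_of_support_subset _ ?_
    intro D hD
    simp only [Finset.coe_Iic, Set.mem_Iic]
    intro i' j
    have := le_of_vanishing (g := fun x : ι ⊕ κ → ℤ => ∏ u, marginWeight (insert i A) v ε u (x u))
      ?_ W _ hD i' j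
    · simpa [marginPoint] using this
    · intro x j hx
      refine Finset.prod_eq_zero (Finset.mem_univ (Sum.inr j)) ?_
      simp [marginWeight, not_le.2 hx]
  simp only [hsum]
  have hlim : rowSlice W C A r v i k = ∑ D ∈ Finset.Iic (fun (_ : ι) j => C j), tableMonomial W D *
        ∏ u, marginWeight (insert i A) v 0 u ((marginPoint C A r i i0 k b + tableBoundary D) u) := by
    rw [rowSlice, columnTables, Finset.filter_filter, Finset.sum_filter]
    refine Finset.sum_congr rfl fun D _ => ?_
    rw [Fintype.prod_sum_type]
    have hcol : ∀ j, marginWeight (insert i A) v 0 (Sum.inr j)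
        ((marginPoint C A r i i0 k b + tableBoundary D) (Sum.inr j))
        = if ∑ i, D i j = C j then 1 else 0 := by
      intro j
      simp only [marginWeight, marginPoint, tableBoundary, Pi.add_apply, Sum.elim_inr]
      have hz : ((∑ i, D i j : ℕ) : ℤ) = ∑ i, (D i j : ℤ) := by push_cast; rfl
      rw [← hz]
      by_cases h : ∑ i, D i j = C j
      · simp [h]
      · rw [if_neg h]
        split_ifs with h1
        · exact zero_pow (by omega)
        · rfl
    have hrow : ∀ u ∈ insert i A, marginWeight (κ := κ) (insert i A) v 0 (Sum.inl u)
        ((marginPoint C A r i i0 k b + tableBoundary D) (Sum.inl u))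
        = if ∑ j, D u j = (if u = i then k else r u) then 1 else 0 := by
      intro u hu
      have hz : ((∑ j, D u j : ℕ) : ℤ) = ∑ j, (D u j : ℤ) := by push_cast; rfl
      have e : (marginPoint C A r i i0 k b + tableBoundary D) (Sum.inl u)
          = ((if u = i then k else r u : ℕ) : ℤ) - (∑ j, D u j : ℕ) := by
        simp only [marginPoint, tableBoundary, Pi.add_apply, Sum.elim_inl, hz]
        by_cases h : u = i
        · simp [h]; ring
        · have huA : u ∈ A := by simpa [h] using hu
          have : u ≠ i0 := fun h => hi0 (h ▸ huA)
          simp [h, this, huA]; ring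
      rw [e]
      simp only [marginWeight, Sum.elim_inl, if_pos hu]
      generalize (if u = i then k else r u) = t
      by_cases h : ∑ j, D u j = t
      · simp [h]
      · rw [if_neg h]
        split_ifs with h1
        · exact zero_pow (by omega)
        · rfl
    have hfree : ∀ u ∈ (insert i A)ᶜ, marginWeight (κ := κ) (insert i A) v 0 (Sum.inl u)
        ((marginPoint C A r i i0 k b + tableBoundary D) (Sum.inl u))
        = v u (-∑ j, (D u j : ℤ)) := by
      intro u hu
      rw [Finset.mem_compl] at hu
      have h1 : u ≠ i := fun h => hu (by simp [h])
      have h2 : u ∉ A := fun h => hu (by simp [h])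
      simp only [marginWeight, Sum.elim_inl, if_neg hu]
      by_cases h : u = i0
      · simp [h, hv0]
      · simp [marginPoint, tableBoundary, h, h1, h2]
    rw [← Finset.prod_mul_prod_compl (insert i A), Finset.prod_congr rfl hrow,
      Finset.prod_congr rfl hfree, Finset.prod_congr rfl fun j _ => hcol j,
      Finset.prod_ite_zero, Finset.prod_ite_zero]
    have hiff : (∀ u ∈ insert i A, ∑ j, D u j = (if u = i then k else r u)) ↔
        (∀ a ∈ A, ∑ j, D a j = r a) ∧ ∑ j, D i j = k := by
      rw [Finset.forall_mem_insert, and_comm]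
      refine and_congr ?_ (by simp)
      refine forall₂_congr fun u hu => ?_
      rw [if_neg fun h : u = i => hi (h ▸ hu)]
    simp only [hiff, Finset.mem_univ, true_implies]
    by_cases h1 : ∀ j, ∑ i, D i j = C j <;>
      by_cases h2 : (∀ a ∈ A, ∑ j, D a j = r a) ∧ ∑ j, D i j = k <;> simp [h1, h2]
  rw [hlim]
  refine Tendsto.mono_left ?_ nhdsWithin_le_nhds
  refine Continuous.tendsto ?_ 0
  refine continuous_finsetSum _ fun D _ => continuous_const.mul ?_
  refine continuous_finsetProd _ fun u _ => ?_
  cases u with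
  | inl u =>
    simp only [marginWeight, Sum.elim_inl]
    split_ifs <;> fun_prop
  | inr j =>
    simp only [marginWeight, Sum.elim_inr]
    split_ifs <;> fun_prop

lemma rowSlice_mul_le_sq {W : ι → κ → ℝ} (hW : ∀ i j, 0 ≤ W i j) (C : κ → ℕ) {A : Finset ι}
    (r : ι → ℕ) {v : ι → ℤ → ℝ} {i i0 : ι} (hi : i ∉ A) (hi0 : i0 ∉ A) (hne : i ≠ i0)
    (hv : ∀ u t, 0 < v u t) (hlc : ∀ u t, v u t * v u (t + 1 + 1) ≤ v u (t + 1) ^ 2)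
    (hv0 : ∀ t, v i0 t = 1) (k : ℕ) :
    rowSlice W C A r v i (k + 2) * rowSlice W C A r v i k ≤ rowSlice W C A r v i (k + 1) ^ 2 := by
  refine le_of_tendsto_of_tendsto
    ((tendsto_tableTransform_marginWeight W C r hi hi0 hv0 (k + 2) 0).mul
      (tendsto_tableTransform_marginWeight W C r hi hi0 hv0 k 2))
    ((tendsto_tableTransform_marginWeight W C r hi hi0 hv0 (k + 1) 1).pow 2) ?_
  filter_upwards [self_mem_nhdsWithin] with ε hε
  have hL := (isDiscreteLorentzian_marginWeight (κ := κ) (insert i A) hv hlc hε).tableTransform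
    (W := W) (fun j => by simp [marginSupport]) (fun u t => by
      simp only [marginSupport, Sum.elim_inl]
      split_ifs
      · simp only [Set.mem_Ici]; omega
      · simp) hW
  have := hL.mul_le_sq (marginPoint C A r i i0 k 0) (Sum.inl i) (Sum.inl i0)
  have e : ∀ a b c d : ℤ, marginPoint C A r i i0 a b + Pi.single (Sum.inl i) c
      + Pi.single (Sum.inl i0) d = marginPoint C A r i i0 (a + c) (b + d) := by
    intro a b c d
    ext u
    rcases u with u | j
    · by_cases h : u = i
      · subst h; simp [marginPoint, hne]
      · by_cases h' : u = i0
        · subst h'; simp [marginPoint, h]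
        · simp [marginPoint, h, h']
    · simp [marginPoint]
  have e1 := e k 0 2 0
  have e2 := e k 0 0 2
  have e3 := e k 0 1 1
  simp only [Pi.single_zero, add_zero, zero_add] at e1 e2 e3
  rw [add_assoc _ (Pi.single (Sum.inl i) 1) (Pi.single (Sum.inl i) 1),
    add_assoc _ (Pi.single (Sum.inl i0) 1) (Pi.single (Sum.inl i0) 1), ← Pi.single_add,
    ← Pi.single_add, show (1 : ℤ) + 1 = 2 from rfl, e1, e2, e3] at this
  push_cast
  exact this

end Slices

section Extraction

variable {ι κ : Type*} [Fintype ι] [Fintype κ] [DecidableEq ι] [DecidableEq κ]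

lemma exists_table (R : ι → ℕ) (C : κ → ℕ) (h : ∑ i, R i = ∑ j, C j) :
    ∃ D : ι → κ → ℕ, (∀ i, ∑ j, D i j = R i) ∧ ∀ j, ∑ i, D i j = C j := by
  induction hN : ∑ i, R i generalizing R C with
  | zero =>
    rw [hN] at h
    have h1 := Finset.sum_eq_zero_iff.1 hN
    have h2 := Finset.sum_eq_zero_iff.1 h.symm
    exact ⟨0, fun i => by simpa using (h1 i (Finset.mem_univ i)).symm,
      fun j => by simpa using (h2 j (Finset.mem_univ j)).symm⟩
  | succ N ih =>
    obtain ⟨i, -, hi⟩ : ∃ i ∈ Finset.univ, R i ≠ 0 := Finset.exists_ne_zero_of_sum_ne_zero (by omega)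
    obtain ⟨j, -, hj⟩ : ∃ j ∈ Finset.univ, C j ≠ 0 := Finset.exists_ne_zero_of_sum_ne_zero (by omega)
    have hR : R - Pi.single i 1 + Pi.single i 1 = R := by
      ext u
      by_cases h : u = i
      · subst h; simp; omega
      · simp [h]
    have hC : C - Pi.single j 1 + Pi.single j 1 = C := by
      ext u
      by_cases h : u = j
      · subst h; simp; omega
      · simp [h]
    have hRs : ∑ u, (R - Pi.single i 1 : ι → ℕ) u + 1 = ∑ u, R u := by
      conv_rhs => rw [← hR]
      simp [Finset.sum_add_distrib]
    have hCs : ∑ u, (C - Pi.single j 1 : κ → ℕ) u + 1 = ∑ u, C u := by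
      conv_rhs => rw [← hC]
      simp [Finset.sum_add_distrib]
    obtain ⟨D, hD1, hD2⟩ := ih (R - Pi.single i 1) (C - Pi.single j 1) (by omega) (by omega)
    refine ⟨D + unitTable i j, fun u => ?_, fun u => ?_⟩
    · conv_rhs => rw [← hR]
      simp only [Pi.add_apply, Finset.sum_add_distrib, hD1]
      by_cases h : u = i <;> simp [unitTable_apply, h]
    · conv_rhs => rw [← hC]
      simp only [Pi.add_apply, Finset.sum_add_distrib, hD2]
      by_cases h : u = j <;> simp [unitTable_apply, h]

/-- A log-concave sequence supported on an initial segment lies below a geometric sequence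
touching it at a given interior point. -/
lemma exists_geometric_majorant {b : ℕ → ℝ} (hb : ∀ k, 0 ≤ b k) {M : ℕ}
    (hM : ∀ k, 0 < b k ↔ k ≤ M) (hlc : ∀ k, b (k + 2) * b k ≤ b (k + 1) ^ 2) {r : ℕ} (hr : 0 < r)
    (hrM : r ≤ M) : ∃ μ : ℝ, 0 < μ ∧ ∀ k, b k * μ ^ r ≤ b r * μ ^ k := by
  obtain ⟨s, rfl⟩ : ∃ s, r = s + 1 := ⟨r - 1, by omega⟩
  have hs : 0 < b s := (hM s).2 (by omega)
  have hs1 : 0 < b (s + 1) := (hM _).2 hrM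
  set μ := b (s + 1) / b s with hμ
  have hμ0 : 0 < μ := by positivity
  have hup : ∀ n, b (s + n + 1) ≤ μ * b (s + n) := by
    intro n
    induction n with
    | zero => exact le_of_eq (by simp only [hμ, add_zero]; field_simp)
    | succ n ih =>
      rcases (hb (s + (n + 1) + 1)).eq_or_lt with h | h
      · rw [← h]; exact mul_nonneg hμ0.le (hb _)
      · have h1 : 0 < b (s + n) := (hM _).2 (by have := (hM _).1 h; omega)
        have h2 : 0 < b (s + n + 1) := (hM _).2 (by have := (hM _).1 h; omega)
        have := hlc (s + n)
        refine le_of_mul_le_mul_right ?_ h1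
        calc b (s + n + 2) * b (s + n) ≤ b (s + n + 1) * b (s + n + 1) := by linarith
          _ ≤ b (s + n + 1) * (μ * b (s + n)) := mul_le_mul_of_nonneg_left ih h2.le
          _ = _ := by rw [← add_assoc s n 1]; ring
  have hdown : ∀ n k, k + n = s → μ * b k ≤ b (k + 1) := by
    intro n
    induction n with
    | zero => rintro k rfl; exact (div_mul_cancel₀ (b (k + 1)) hs.ne').le
    | succ n ih =>
      intro k hk
      have h := ih (k + 1) (by omega)
      have h1 : 0 < b (k + 1) := (hM _).2 (by omega)
      have := hlc k
      refine le_of_mul_le_mul_right ?_ h1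
      calc μ * b k * b (k + 1) = μ * b (k + 1) * b k := by ring
        _ ≤ b (k + 2) * b k := mul_le_mul_of_nonneg_right h (hb k)
        _ ≤ _ := by linarith
  refine ⟨μ, hμ0, fun k => ?_⟩
  rcases le_total (s + 1) k with h | h
  · obtain ⟨n, rfl⟩ := Nat.exists_eq_add_of_le h
    have : b (s + 1 + n) ≤ b (s + 1) * μ ^ n := by
      clear h
      induction n with
      | zero => simp
      | succ n ih =>
        have := hup (n + 1)
        rw [show s + (n + 1) + 1 = s + 1 + (n + 1) by ring, show s + (n + 1) = s + 1 + n by ring]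
          at this
        calc _ ≤ _ := this
          _ ≤ μ * (b (s + 1) * μ ^ n) := mul_le_mul_of_nonneg_left ih hμ0.le
          _ = _ := by ring
    calc _ ≤ b (s + 1) * μ ^ n * μ ^ (s + 1) := mul_le_mul_of_nonneg_right this (by positivity)
      _ = _ := by ring
  · obtain ⟨n, hn⟩ := Nat.exists_eq_add_of_le h
    have : ∀ n k, k + n = s + 1 → b k * μ ^ n ≤ b (s + 1) := by
      intro n
      induction n with
      | zero => rintro k rfl; simp
      | succ n ih =>
        intro k hk
        calc b k * μ ^ (n + 1) = μ * b k * μ ^ n := by ring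
          _ ≤ b (k + 1) * μ ^ n :=
            mul_le_mul_of_nonneg_right (hdown n k (by omega)) (by positivity)
          _ ≤ _ := ih _ (by omega)
    calc b k * μ ^ (s + 1) = b k * μ ^ n * μ ^ k := by rw [hn, pow_add]; ring
      _ ≤ _ := mul_le_mul_of_nonneg_right (this n k hn.symm) (by positivity)

/-- The row weight `r! / t!` at `-t`, except for a distinguished free row. -/
noncomputable def factorialWeight (R : ι → ℕ) (i0 u : ι) (t : ℤ) : ℝ :=
  if u = i0 then 1 else (R u).factorial / ((-t).toNat.factorial : ℝ)

omit [Fintype ι] in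
lemma factorialWeight_pos (R : ι → ℕ) (i0 u : ι) (t : ℤ) : 0 < factorialWeight R i0 u t := by
  unfold factorialWeight
  split_ifs
  · exact one_pos
  · positivity

omit [Fintype ι] in
lemma factorialWeight_logConcave (R : ι → ℕ) (i0 u : ι) (t : ℤ) :
    factorialWeight R i0 u t * factorialWeight R i0 u (t + 1 + 1) ≤
      factorialWeight R i0 u (t + 1) ^ 2 := by
  unfold factorialWeight
  split_ifs
  · norm_num
  rw [div_mul_div_comm, div_pow, ← sq]
  refine div_le_div_of_nonneg_left (by positivity) (by positivity) ?_
  norm_cast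
  rcases le_or_gt 0 t with h | h
  · rw [show (-t).toNat = 0 by omega, show (-(t + 1)).toNat = 0 by omega,
      show (-(t + 1 + 1)).toNat = 0 by omega]
    simp
  · obtain ⟨n, hn⟩ : ∃ n, (-(t + 1)).toNat = n := ⟨_, rfl⟩
    rw [hn, show (-t).toNat = n + 1 by omega]
    rcases Nat.eq_zero_or_pos n with h0 | h0
    · subst h0
      rw [show (-(t + 1 + 1)).toNat = 0 by omega]
      simp
    · obtain ⟨m, rfl⟩ : ∃ m, n = m + 1 := ⟨n - 1, by omega⟩
      rw [show (-(t + 1 + 1)).toNat = m by omega]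
      simp only [Nat.factorial_succ]
      have : 0 < m.factorial := Nat.factorial_pos m
      nlinarith [mul_pos this this]

/-- Sum over tables with fixed columns, exact rows on `A` and factorial weights elsewhere. -/
noncomputable def partialTableSum (W : ι → κ → ℝ) (R : ι → ℕ) (C : κ → ℕ) (i0 : ι)
    (A : Finset ι) : ℝ :=
  ∑ D ∈ columnTables ι C with ∀ a ∈ A, ∑ j, D a j = R a,
    tableMonomial W D * ∏ u ∈ Aᶜ, factorialWeight R i0 u (-∑ j, (D u j : ℤ))

omit [DecidableEq ι] [DecidableEq κ] in
lemma tableMonomial_rowScale (W : ι → κ → ℝ) (l : ι → ℝ) (D : ι → κ → ℕ) :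
    tableMonomial (fun i j => l i * W i j) D = (∏ i, l i ^ ∑ j, D i j) * tableMonomial W D := by
  unfold tableMonomial
  simp only [mul_pow, Finset.prod_mul_distrib, Finset.prod_pow_eq_pow_sum]

omit [DecidableEq ι] [DecidableEq κ] in
lemma tableMonomial_pos {W : ι → κ → ℝ} (hW : ∀ i j, 0 < W i j) (D : ι → κ → ℕ) :
    0 < tableMonomial W D :=
  Finset.prod_pos fun i _ => Finset.prod_pos fun j _ => pow_pos (hW i j) _

lemma sum_rows_of_mem_columnTables {C : κ → ℕ} {D : ι → κ → ℕ} (hD : D ∈ columnTables ι C) :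
    ∑ i, ∑ j, D i j = ∑ j, C j := by
  rw [Finset.sum_comm]
  exact Finset.sum_congr rfl fun j _ => mem_columnTables.1 hD j

lemma rowSlice_pos_iff {W : ι → κ → ℝ} (hW : ∀ i j, 0 < W i j) (C : κ → ℕ) {A : Finset ι}
    (R : ι → ℕ) {v : ι → ℤ → ℝ} {i i0 : ι} (hi : i ∉ A) (hi0 : i0 ∉ A) (hne : i ≠ i0)
    (hv : ∀ u t, 0 < v u t) (k : ℕ) :
    0 < rowSlice W C A R v i k ↔ k + ∑ a ∈ A, R a ≤ ∑ j, C j := by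
  have hterm : ∀ D : ι → κ → ℕ,
      0 < tableMonomial W D * ∏ u ∈ (insert i A)ᶜ, v u (-∑ j, (D u j : ℤ)) := fun D =>
    mul_pos (tableMonomial_pos hW D) (Finset.prod_pos fun u _ => hv u _)
  constructor
  · intro h
    obtain ⟨D, hD, -⟩ := Finset.exists_ne_zero_of_sum_ne_zero h.ne'
    obtain ⟨hD1, hD2, hD3⟩ := Finset.mem_filter.1 hD
    rw [← sum_rows_of_mem_columnTables hD1, ← hD3, ← Finset.sum_congr rfl hD2,
      ← Finset.sum_insert (f := fun i => ∑ j, D i j) hi]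
    exact Finset.sum_le_sum_of_subset (Finset.subset_univ _)
  · intro h
    obtain ⟨D, hD1, hD2⟩ := exists_table (fun u => if u = i then k else if u ∈ A then R u else
      if u = i0 then ∑ j, C j - (k + ∑ a ∈ A, R a) else 0) C (by
        rw [← Finset.sum_subset (Finset.subset_univ (insert i (insert i0 A)))]
        · rw [Finset.sum_insert (by simp [hne, hi]), Finset.sum_insert hi0]
          have : ∑ x ∈ A, (if x = i then k else if x ∈ A then R x else
              if x = i0 then ∑ j, C j - (k + ∑ a ∈ A, R a) else 0) = ∑ a ∈ A, R a :=
            Finset.sum_congr rfl fun x hx => by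
              rw [if_neg fun h : x = i => hi (h ▸ hx), if_pos hx]
          rw [this]
          simp only [if_true, hi0, hne.symm, if_false]
          omega
        · intro u _ hu
          simp only [Finset.mem_insert, not_or] at hu
          simp [hu])
    refine Finset.sum_pos (fun D _ => hterm D) ⟨D, Finset.mem_filter.2 ⟨mem_columnTables.2 hD2, ?_, ?_⟩⟩
    · intro a ha
      rw [hD1, if_neg fun h : a = i => hi (h ▸ ha), if_pos ha]
    · rw [hD1, if_pos rfl]

lemma partialTableSum_scale (W : ι → κ → ℝ) (R : ι → ℕ) (C : κ → ℕ) {A : Finset ι} {i i0 : ι}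
    (hi : i ∉ A) (hne : i ≠ i0) (l : ℝ) :
    partialTableSum (fun u j => (if u = i then l else 1) * W u j) R C i0 A =
      ∑ k ∈ Finset.range (∑ j, C j + 1), rowSlice W C A R (factorialWeight R i0) i k *
        (l ^ k * ((R i).factorial / k.factorial)) := by
  unfold partialTableSum
  rw [← Finset.sum_fiberwise_of_maps_to (g := fun D => ∑ j, D i j)
    (t := Finset.range (∑ j, C j + 1))]
  · refine Finset.sum_congr rfl fun k _ => ?_
    rw [rowSlice, Finset.sum_mul, Finset.filter_filter]
    refine Finset.sum_congr rfl fun D hD => ?_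
    obtain ⟨-, -, hD3⟩ := Finset.mem_filter.1 hD
    have hD3' : ∑ j, (D i j : ℤ) = k := by rw [← hD3]; push_cast; rfl
    rw [tableMonomial_rowScale]
    have h1 : ∏ u, (if u = i then l else 1) ^ ∑ j, D u j = l ^ k := by
      rw [Finset.prod_eq_single i]
      · simp [hD3]
      · intro u _ hu; simp [hu]
      · simp
    have h2 : Aᶜ = insert i (insert i A)ᶜ := by
      ext u
      by_cases h : u = i
      · subst h; simp [hi]
      · simp [h]
    rw [h1, h2, Finset.prod_insert (by simp), hD3']
    have h3 : factorialWeight R i0 i (-(k : ℤ)) = (R i).factorial / k.factorial := by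
      simp [factorialWeight, hne]
    rw [h3]; ring
  · intro D hD
    rw [Finset.mem_range, Nat.lt_succ_iff,
      ← sum_rows_of_mem_columnTables (Finset.mem_filter.1 hD).1]
    exact Finset.single_le_sum (f := fun i => ∑ j, D i j) (fun _ _ => Nat.zero_le _)
      (Finset.mem_univ i)

lemma exists_scale_partialTableSum_le {W : ι → κ → ℝ} (hW : ∀ i j, 0 < W i j) {R : ι → ℕ}
    {C : κ → ℕ} (hRC : ∑ i, R i = ∑ j, C j) {A : Finset ι} {i i0 : ι} (hi : i ∉ A) (hi0 : i0 ∉ A)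
    (hne : i ≠ i0) (hR : 0 < R i) :
    ∃ l : ℝ, 0 < l ∧
      partialTableSum (fun u j => (if u = i then l else 1) * W u j) R C i0 A ≤
        l ^ R i * ((R i).factorial * Real.exp (R i) / (R i : ℝ) ^ R i) *
          partialTableSum W R C i0 (insert i A) := by
  set b := rowSlice W C A R (factorialWeight R i0) i with hb
  have hbn : ∀ k, 0 ≤ b k := fun k => Finset.sum_nonneg fun D _ =>
    mul_nonneg (tableMonomial_pos hW D).le (Finset.prod_nonneg fun u _ => (factorialWeight_pos ..).le)
  have hsub : R i + ∑ a ∈ A, R a ≤ ∑ j, C j := by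
    rw [← hRC, ← Finset.sum_insert hi]
    exact Finset.sum_le_sum_of_subset (Finset.subset_univ _)
  obtain ⟨μ, hμ, hbμ⟩ := exists_geometric_majorant (b := b) hbn
    (M := ∑ j, C j - ∑ a ∈ A, R a) (fun k => by
      rw [hb, rowSlice_pos_iff hW C R hi hi0 hne (factorialWeight_pos R i0)]
      omega)
    (rowSlice_mul_le_sq (fun i j => (hW i j).le) C R hi hi0 hne (factorialWeight_pos R i0)
      (factorialWeight_logConcave R i0) (fun t => by simp [factorialWeight])) hR (by omega)
  have hbR : b (R i) = partialTableSum W R C i0 (insert i A) := by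
    rw [hb, rowSlice, partialTableSum]
    refine Finset.sum_congr ?_ fun _ _ => rfl
    ext D
    simp only [Finset.mem_filter, Finset.forall_mem_insert]
    tauto
  have hRr : (0 : ℝ) < R i := by exact_mod_cast hR
  refine ⟨R i / μ, by positivity, ?_⟩
  rw [partialTableSum_scale W R C hi hne, ← hb, ← hbR]
  have hterm : ∀ k, b k * ((R i / μ) ^ k * ((R i).factorial / k.factorial)) ≤
      (R i / μ) ^ R i * ((R i).factorial / (R i : ℝ) ^ R i) * b (R i) *
        ((R i : ℝ) ^ k / k.factorial) := by
    intro k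
    have h := hbμ k
    rw [div_pow, div_pow]
    have hk : (0 : ℝ) < k.factorial := by positivity
    have e1 : b k * ((R i : ℝ) ^ k / μ ^ k * ((R i).factorial / k.factorial)) =
        (b k * μ ^ R i) * ((R i : ℝ) ^ k * (R i).factorial / (k.factorial * μ ^ k * μ ^ R i)) := by
      field_simp
    have e2 : (R i : ℝ) ^ R i / μ ^ R i * ((R i).factorial / (R i : ℝ) ^ R i) * b (R i) *
        ((R i : ℝ) ^ k / k.factorial) =
        (b (R i) * μ ^ k) * ((R i : ℝ) ^ k * (R i).factorial / (k.factorial * μ ^ k * μ ^ R i)) := by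
      field_simp
    rw [e1, e2]
    exact mul_le_mul_of_nonneg_right h (by positivity)
  refine (Finset.sum_le_sum fun k _ => hterm k).trans ?_
  rw [← Finset.mul_sum]
  have hexp := Real.sum_le_exp_of_nonneg hRr.le (∑ j, C j + 1)
  calc _ ≤ (R i / μ) ^ R i * ((R i).factorial / (R i : ℝ) ^ R i) * b (R i) * Real.exp (R i) :=
        mul_le_mul_of_nonneg_left hexp (mul_nonneg (by positivity) (hbn _))
    _ = _ := by ring

/-- A functional that scales with the row margins and is dominated by the sum with fixed columns
and factorial row weights is dominated by the sum with exact rows, up to the Poisson factors. -/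
lemma le_partialTableSum_of_rowScale {R : ι → ℕ} (hR : ∀ i, 0 < R i) {C : κ → ℕ}
    (hRC : ∑ i, R i = ∑ j, C j) (i0 : ι) {G : (ι → κ → ℝ) → ℝ}
    (hG : ∀ W : ι → κ → ℝ, (∀ i j, 0 < W i j) → ∀ l : ι → ℝ, (∀ i, 0 < l i) →
      G (fun i j => l i * W i j) = (∏ i, l i ^ R i) * G W) {c : ℝ} (hc : 0 ≤ c)
    (hle : ∀ W : ι → κ → ℝ, (∀ i j, 0 < W i j) → G W ≤ c * partialTableSum W R C i0 ∅)
    {A : Finset ι} (hA : i0 ∉ A) {W : ι → κ → ℝ} (hW : ∀ i j, 0 < W i j) :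
    G W ≤ c * (∏ i ∈ A, ((R i).factorial * Real.exp (R i) / (R i : ℝ) ^ R i)) *
      partialTableSum W R C i0 A := by
  induction A using Finset.induction_on generalizing W with
  | empty => simpa using hle W hW
  | insert i A hi ih =>
    have hi0 : i0 ∉ A := fun h => hA (Finset.mem_insert_of_mem h)
    have hne : i ≠ i0 := fun h => hA (h ▸ Finset.mem_insert_self i A)
    obtain ⟨l, hl, h⟩ := exists_scale_partialTableSum_le hW hRC hi hi0 hne (hR i)
    have hl' : ∀ u, 0 < (if u = i then l else 1) := fun u => by split_ifs <;> simp [hl]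
    have h1 := ih hi0 (W := fun u j => (if u = i then l else 1) * W u j)
      (fun u j => mul_pos (hl' u) (hW u j))
    rw [hG W hW _ hl'] at h1
    have h2 : ∏ u, (if u = i then l else 1) ^ R u = l ^ R i := by
      rw [Finset.prod_eq_single i]
      · simp
      · intro u _ hu; simp [hu]
      · simp
    rw [h2] at h1
    rw [Finset.prod_insert hi]
    refine le_of_mul_le_mul_left (h1.trans ?_) (pow_pos hl (R i))
    calc _ ≤ _ := mul_le_mul_of_nonneg_left h
          (mul_nonneg hc (Finset.prod_nonneg fun u _ => by positivity))
      _ = _ := by ring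

end Extraction

section Factorials

lemma factorial_mul_exp_div_pow_monotone :
    Monotone fun k : ℕ => (k.factorial : ℝ) * Real.exp k / (k : ℝ) ^ k := by
  refine monotone_nat_of_le_succ fun k => ?_
  rcases Nat.eq_zero_or_pos k with rfl | hk
  · simp
  have hk' : (0 : ℝ) < k := by exact_mod_cast hk
  rw [div_le_div_iff₀ (by positivity) (by positivity)]
  have h1 : ((k : ℝ) + 1) ^ k ≤ (k : ℝ) ^ k * Real.exp 1 := by
    have h2 : (k : ℝ) + 1 ≤ k * Real.exp (1 / k) := by
      calc (k : ℝ) + 1 = k * (1 / k + 1) := by field_simp; ring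
        _ ≤ _ := mul_le_mul_of_nonneg_left (Real.add_one_le_exp _) hk'.le
    calc ((k : ℝ) + 1) ^ k ≤ (k * Real.exp (1 / k)) ^ k := by gcongr
      _ = _ := by
        rw [mul_pow, ← Real.exp_nat_mul]
        congr 2; field_simp
  rw [Nat.factorial_succ]
  push_cast
  rw [Real.exp_add]
  calc (k.factorial : ℝ) * Real.exp k * ((k : ℝ) + 1) ^ (k + 1)
      = (k.factorial * Real.exp k * (k + 1)) * ((k : ℝ) + 1) ^ k := by ring
    _ ≤ (k.factorial * Real.exp k * (k + 1)) * ((k : ℝ) ^ k * Real.exp 1) :=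
      mul_le_mul_of_nonneg_left h1 (by positivity)
    _ = _ := by ring

lemma pow_mul_exp_neg_sq_le {r : ℕ} (hr : 0 < r) (k : ℕ) :
    (r : ℝ) ^ r * Real.exp (-((k : ℝ) - r) ^ 2 / r) ≤ (r : ℝ) ^ k * (r.factorial / k.factorial) := by
  have hr' : (0 : ℝ) < r := by exact_mod_cast hr
  rcases le_total r k with h | h
  · obtain ⟨n, rfl⟩ := Nat.exists_eq_add_of_le h
    clear h
    have key : ((r + n).factorial : ℝ) ≤ r.factorial * r ^ n * Real.exp ((n : ℝ) ^ 2 / r) := by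
      induction n with
      | zero => simp
      | succ n ih =>
        rw [← add_assoc, Nat.factorial_succ]
        push_cast
        have h1 : (r : ℝ) + n + 1 ≤ r * Real.exp ((2 * n + 1) / r) := by
          calc (r : ℝ) + n + 1 ≤ r * ((2 * n + 1) / r + 1) := by
                field_simp
                have : (0 : ℝ) ≤ n := by positivity
                linarith
            _ ≤ _ := mul_le_mul_of_nonneg_left (Real.add_one_le_exp _) hr'.le
        calc ((r : ℝ) + n + 1) * (r + n).factorial
            ≤ (r * Real.exp ((2 * n + 1) / r)) * (r.factorial * r ^ n * Real.exp ((n : ℝ) ^ 2 / r)) := by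
              gcongr
          _ = r.factorial * r ^ (n + 1) * (Real.exp ((n : ℝ) ^ 2 / r) * Real.exp ((2 * n + 1) / r)) := by
              ring
          _ = _ := by rw [← Real.exp_add]; congr 2; ring
    have e1 : -(((r + n : ℕ) : ℝ) - r) ^ 2 / r = -((n : ℝ) ^ 2 / r) := by push_cast; ring
    rw [e1, Real.exp_neg, mul_div_assoc', le_div_iff₀ (by positivity), mul_assoc,
      inv_mul_eq_div, mul_div_assoc', div_le_iff₀ (Real.exp_pos _), pow_add]
    calc _ ≤ (r : ℝ) ^ r * (r.factorial * r ^ n * Real.exp ((n : ℝ) ^ 2 / r)) := by gcongr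
      _ = _ := by ring
  · have hm := factorial_mul_exp_div_pow_monotone h
    simp only at hm
    have h1 : (k : ℝ) ^ k ≤ r ^ k * Real.exp (k * ((k : ℝ) / r - 1)) := by
      have : (k : ℝ) ≤ r * Real.exp ((k : ℝ) / r - 1) := by
        calc (k : ℝ) = r * (((k : ℝ) / r - 1) + 1) := by field_simp; ring
          _ ≤ _ := mul_le_mul_of_nonneg_left (Real.add_one_le_exp _) hr'.le
      calc (k : ℝ) ^ k ≤ (r * Real.exp ((k : ℝ) / r - 1)) ^ k := by gcongr
        _ = _ := by rw [mul_pow, ← Real.exp_nat_mul]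
    have hkk : (0 : ℝ) < (k : ℝ) ^ k := by
      rcases Nat.eq_zero_or_pos k with rfl | hk
      · simp
      · positivity
    rw [div_le_div_iff₀ hkk (by positivity)] at hm
    rw [mul_div_assoc', le_div_iff₀ (by positivity)]
    have e1 : Real.exp (-((k : ℝ) - r) ^ 2 / r)
        = Real.exp k * Real.exp (-(k * ((k : ℝ) / r - 1))) * (Real.exp r)⁻¹ := by
      rw [← Real.exp_add, ← Real.exp_neg, ← Real.exp_add]
      congr 1; field_simp; ring
    rw [e1]
    have h2 : (r.factorial : ℝ) * Real.exp r * (k : ℝ) ^ k ≤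
        r.factorial * Real.exp r * (r ^ k * Real.exp (k * ((k : ℝ) / r - 1))) := by gcongr
    rw [Real.exp_neg]
    have hE := Real.exp_pos (k * ((k : ℝ) / r - 1))
    have hEr := Real.exp_pos (r : ℝ)
    rw [show (r : ℝ) ^ r * (Real.exp k * (Real.exp (k * ((k : ℝ) / r - 1)))⁻¹ * (Real.exp r)⁻¹)
      * k.factorial = (k.factorial * Real.exp k * r ^ r) /
        (Real.exp (k * ((k : ℝ) / r - 1)) * Real.exp r) by field_simp]
    rw [div_le_iff₀ (by positivity)]
    linarith

lemma factorial_mul_exp_div_pow_le {r : ℕ} (hr : 0 < r) :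
    (r.factorial : ℝ) * Real.exp r / (r : ℝ) ^ r ≤ Real.exp 1 * √r := by
  obtain ⟨n, rfl⟩ : ∃ n, r = n + 1 := ⟨r - 1, by omega⟩
  have h := Stirling.stirlingSeq'_antitone (Nat.zero_le n)
  simp only [Function.comp, Nat.succ_eq_add_one, zero_add, Stirling.stirlingSeq_one] at h
  rw [Stirling.stirlingSeq, Real.sqrt_mul (by norm_num), div_pow, Real.exp_one_pow,
    div_le_div_iff₀ (by positivity) (by positivity)] at h
  have h2 : (0 : ℝ) < √2 := by positivity
  have hE := Real.exp_pos ((n + 1 : ℕ) : ℝ)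
  have hp : (0 : ℝ) < ((n + 1 : ℕ) : ℝ) ^ (n + 1) := by positivity
  rw [div_le_iff₀ hp]
  have h3 : ((n + 1).factorial : ℝ) ≤
      Real.exp 1 * (√((n + 1 : ℕ) : ℝ) * (((n + 1 : ℕ) : ℝ) ^ (n + 1) / Real.exp ((n + 1 : ℕ) : ℝ))) := by
    refine le_of_mul_le_mul_right (h.trans_eq ?_) h2
    ring
  calc _ ≤ _ := mul_le_mul_of_nonneg_right h3 hE.le
    _ = _ := by field_simp

lemma prod_sqrt_le {ι : Type*} [Fintype ι] [DecidableEq ι] {R : ι → ℕ} {i0 : ι}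
    (hmax : ∀ i, R i ≤ R i0) {s : ℝ} (hs : 0 < s) (hsum : ∑ i, (R i : ℝ) = Fintype.card ι * s) :
    ∏ i ∈ {i0}ᶜ, √(R i : ℝ) ≤ √s ^ (Fintype.card ι - 1) := by
  have hc : ({i0}ᶜ : Finset ι).card = Fintype.card ι - 1 := by
    rw [Finset.card_compl, Finset.card_singleton]
  have hpos : 0 < Fintype.card ι := Fintype.card_pos_iff.2 ⟨i0⟩
  have hm : s ≤ R i0 := by
    have : ∑ i, (R i : ℝ) ≤ ∑ _i : ι, (R i0 : ℝ) :=
      Finset.sum_le_sum fun i _ => by exact_mod_cast hmax i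
    rw [hsum, Finset.sum_const, Finset.card_univ, nsmul_eq_mul] at this
    exact le_of_mul_le_mul_left this (by exact_mod_cast hpos)
  have hterm : ∀ i, √(R i : ℝ) ≤ √s * Real.exp ((R i / s - 1) / 2) := by
    intro i
    have h1 : (R i : ℝ) ≤ s * Real.exp (R i / s - 1) := by
      calc (R i : ℝ) = s * ((R i / s - 1) + 1) := by field_simp; ring
        _ ≤ _ := mul_le_mul_of_nonneg_left (Real.add_one_le_exp _) hs.le
    calc √(R i : ℝ) ≤ √(s * Real.exp (R i / s - 1)) := Real.sqrt_le_sqrt h1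
      _ = _ := by rw [Real.sqrt_mul hs.le, Real.exp_half]
  calc ∏ i ∈ {i0}ᶜ, √(R i : ℝ) ≤ ∏ i ∈ {i0}ᶜ, (√s * Real.exp ((R i / s - 1) / 2)) :=
        Finset.prod_le_prod (fun _ _ => Real.sqrt_nonneg _) fun i _ => hterm i
    _ = √s ^ (Fintype.card ι - 1) * Real.exp (∑ i ∈ {i0}ᶜ, (R i / s - 1) / 2) := by
        rw [Finset.prod_mul_distrib, Finset.prod_const, hc, Real.exp_sum]
    _ ≤ √s ^ (Fintype.card ι - 1) * 1 := by
        refine mul_le_mul_of_nonneg_left ?_ (by positivity)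
        rw [Real.exp_le_one_iff, ← Finset.sum_div]
        refine div_nonpos_of_nonpos_of_nonneg ?_ (by norm_num)
        rw [Finset.sum_sub_distrib, ← Finset.sum_div, Finset.sum_const, hc, nsmul_eq_mul,
          mul_one, Nat.cast_sub (by omega), sub_nonpos, div_le_iff₀ hs]
        have := Finset.sum_add_sum_compl {i0} fun i => (R i : ℝ)
        rw [hsum, Finset.sum_singleton] at this
        push_cast
        linarith
    _ = _ := mul_one _

end Factorials

section GaussianToExact

variable {ι κ : Type*} [Fintype ι] [Fintype κ] [DecidableEq ι] [DecidableEq κ]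

/-- A functional that scales with the row margins and is dominated by the sum with fixed columns
and Gaussian row weights is dominated by the sum with exact margins. -/
lemma le_sum_exact_of_le_gaussian {R : ι → ℕ} (hR : ∀ i, 0 < R i) {C : κ → ℕ}
    (hRC : ∑ i, R i = ∑ j, C j) {i0 : ι} (hmax : ∀ i, R i ≤ R i0) {G : (ι → κ → ℝ) → ℝ}
    (hG : ∀ W : ι → κ → ℝ, (∀ i j, 0 < W i j) → ∀ l : ι → ℝ, (∀ i, 0 < l i) →
      G (fun i j => l i * W i j) = (∏ i, l i ^ R i) * G W) {c : ℝ} (hc : 0 ≤ c)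
    (hle : ∀ W : ι → κ → ℝ, (∀ i j, 0 < W i j) → G W ≤ c * ∑ D ∈ columnTables ι C,
      tableMonomial W D * ∏ i ∈ {i0}ᶜ, Real.exp (-(((∑ j, D i j : ℕ) : ℝ) - R i) ^ 2 / R i))
    {W : ι → κ → ℝ} (hW : ∀ i j, 0 < W i j) {s : ℝ} (hs : 0 < s)
    (hsum : ∑ i, (R i : ℝ) = Fintype.card ι * s) :
    G W ≤ c * (Real.exp 1 * √s) ^ (Fintype.card ι - 1) *
      ∑ D ∈ columnTables ι C with ∀ i, ∑ j, D i j = R i, tableMonomial W D := by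
  have hRr : ∀ i, (0 : ℝ) < R i := fun i => by exact_mod_cast hR i
  have hbase : ∀ W : ι → κ → ℝ, (∀ i j, 0 < W i j) → G W ≤ c * partialTableSum W R C i0 ∅ := by
    intro W hW
    set l : ι → ℝ := fun i => if i = i0 then 1 else (R i : ℝ)⁻¹ with hl
    have hl0 : ∀ i, 0 < l i := fun i => by
      simp only [hl]; split_ifs
      · exact one_pos
      · exact inv_pos.2 (hRr i)
    have h := hle (fun i j => l i * W i j) fun i j => mul_pos (hl0 i) (hW i j)
    rw [hG W hW l hl0] at h
    have hP : 0 < ∏ i, l i ^ R i := Finset.prod_pos fun i _ => pow_pos (hl0 i) _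
    refine le_of_mul_le_mul_left (h.trans ?_) hP
    rw [mul_left_comm, partialTableSum]
    refine mul_le_mul_of_nonneg_left ?_ hc
    rw [Finset.mul_sum]
    simp only [Finset.notMem_empty, false_implies, implies_true, Finset.filter_true]
    refine Finset.sum_le_sum fun D _ => ?_
    rw [tableMonomial_rowScale, mul_left_comm, mul_comm _ (tableMonomial W D), mul_assoc]
    refine mul_le_mul_of_nonneg_left ?_ (tableMonomial_pos hW D).le
    rw [Finset.compl_empty, ← Finset.prod_mul_distrib,
      ← Finset.mul_prod_erase _ _ (Finset.mem_univ i0),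
      ← Finset.mul_prod_erase Finset.univ (fun i => l i ^ R i * _) (Finset.mem_univ i0),
      ← Finset.compl_singleton, mul_assoc (l i0 ^ _), ← Finset.prod_mul_distrib]
    refine mul_le_mul ?_ ?_ ?_ ?_
    · simp [hl, factorialWeight]
    · refine Finset.prod_le_prod (fun i _ => by have := hl0 i; positivity) fun i hi => ?_
      have hi' : i ≠ i0 := by simpa using hi
      have key := pow_mul_exp_neg_sq_le (hR i) (∑ j, D i j)
      have hf : factorialWeight R i0 i (-∑ j, (D i j : ℤ))
          = (R i).factorial / (∑ j, D i j).factorial := by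
        have : ∑ j, (D i j : ℤ) = ((∑ j, D i j : ℕ) : ℤ) := by push_cast; rfl
        rw [this, factorialWeight, if_neg hi', neg_neg, Int.toNat_natCast]
      rw [hf]
      simp only [hl, if_neg hi', inv_pow]
      have h1 := pow_pos (hRr i) (R i)
      have h2 := pow_pos (hRr i) (∑ j, D i j)
      rw [inv_mul_eq_div, inv_mul_eq_div, div_le_div_iff₀ h2 h1]
      linarith
    · exact Finset.prod_nonneg fun i _ => by have := hl0 i; positivity
    · exact mul_nonneg (pow_nonneg (hl0 _).le _) (factorialWeight_pos ..).le
  have h := le_partialTableSum_of_rowScale hR hRC i0 hG hc hbase (A := {i0}ᶜ) (by simp) hW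
  have hT : partialTableSum W R C i0 {i0}ᶜ =
      ∑ D ∈ columnTables ι C with ∀ i, ∑ j, D i j = R i, tableMonomial W D := by
    rw [partialTableSum]
    simp only [compl_compl, Finset.prod_singleton, factorialWeight, if_true, mul_one]
    refine Finset.sum_congr (Finset.filter_congr fun D hD => ?_) fun _ _ => rfl
    refine ⟨fun h i => ?_, fun h i _ => h i⟩
    by_cases hi : i = i0
    · subst hi
      have h1 := sum_rows_of_mem_columnTables hD
      rw [← hRC, ← Finset.add_sum_erase _ _ (Finset.mem_univ i),
        ← Finset.add_sum_erase _ R (Finset.mem_univ i), ← Finset.compl_singleton,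
        Finset.sum_congr rfl h] at h1
      exact Nat.add_right_cancel h1
    · exact h i (by simpa using hi)
  rw [hT] at h
  refine h.trans (mul_le_mul_of_nonneg_right (mul_le_mul_of_nonneg_left ?_ hc)
    (Finset.sum_nonneg fun D _ => (tableMonomial_pos hW D).le))
  calc _ ≤ ∏ i ∈ {i0}ᶜ, (Real.exp 1 * √(R i : ℝ)) :=
        Finset.prod_le_prod (fun i _ => by positivity) fun i _ => factorial_mul_exp_div_pow_le (hR i)
    _ = Real.exp 1 ^ (Fintype.card ι - 1) * ∏ i ∈ {i0}ᶜ, √(R i : ℝ) := by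
        rw [Finset.prod_mul_distrib, Finset.prod_const, Finset.card_compl, Finset.card_singleton]
    _ ≤ _ := by
        rw [mul_pow]
        exact mul_le_mul_of_nonneg_left (prod_sqrt_le hmax hs hsum) (by positivity)

end GaussianToExact

section DiscretePrekopaLeindler

/-- The number of occurrences of the value `X t` among `X 0, …, X t`. -/
def occurrenceRank (X : ℕ → ℕ) (t : ℕ) : ℕ := ((Finset.range (t + 1)).filter (X · = X t)).card

lemma occurrenceRank_pos (X : ℕ → ℕ) (t : ℕ) : 0 < occurrenceRank X t :=
  Finset.card_pos.2 ⟨t, by simp⟩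

lemma prod_occurrenceRank {B : ℕ} (X : ℕ → ℕ) (M : ℕ) (hX : ∀ t < M, X t < B) :
    ∏ t ∈ Finset.range M, occurrenceRank X t =
      ∏ x ∈ Finset.range B, (((Finset.range M).filter (X · = x)).card).factorial := by
  induction M with
  | zero => simp
  | succ M ih =>
    rw [Finset.prod_range_succ, ih fun t ht => hX t (by omega)]
    have hM : X M ∈ Finset.range B := Finset.mem_range.2 (hX M (by omega))
    rw [← Finset.mul_prod_erase _ _ hM, ← Finset.mul_prod_erase (Finset.range B) _ hM,
      mul_right_comm]
    congr 1
    · have : (Finset.range (M + 1)).filter (X · = X M)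
          = insert M ((Finset.range M).filter (X · = X M)) := by
        rw [Finset.range_add_one, Finset.filter_insert, if_pos rfl]
      rw [occurrenceRank, this, Finset.card_insert_of_notMem (by simp), Nat.factorial_succ, mul_comm]
    · refine Finset.prod_congr rfl fun x hx => ?_
      rw [Finset.range_add_one, Finset.filter_insert, if_neg (Finset.ne_of_mem_erase hx).symm]

lemma lt_occurrenceRank_iff {X : ℕ → ℕ} (hX : Monotone X) {t c : ℕ} :
    c < occurrenceRank X t ↔ c ≤ t ∧ X (t - c) = X t := by
  constructor
  · intro h
    have hct : c ≤ t := by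
      have := Finset.card_filter_le (Finset.range (t + 1)) (X · = X t)
      rw [Finset.card_range] at this
      unfold occurrenceRank at h
      omega
    refine ⟨hct, ?_⟩
    by_contra hne
    have hlt : X (t - c) < X t := lt_of_le_of_ne (hX (by omega)) hne
    have hsub : (Finset.range (t + 1)).filter (X · = X t) ⊆ Finset.Ioc (t - c) t := by
      intro u hu
      rw [Finset.mem_filter, Finset.mem_range] at hu
      rw [Finset.mem_Ioc]
      refine ⟨?_, by omega⟩
      by_contra hle
      have := hX (not_lt.1 hle)
      omega
    have := Finset.card_le_card hsub
    rw [Nat.card_Ioc] at this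
    unfold occurrenceRank at h
    omega
  · rintro ⟨hct, he⟩
    have hsub : Finset.Icc (t - c) t ⊆ (Finset.range (t + 1)).filter (X · = X t) := by
      intro u hu
      rw [Finset.mem_Icc] at hu
      rw [Finset.mem_filter, Finset.mem_range]
      refine ⟨by omega, le_antisymm (hX hu.2) (he ▸ hX hu.1)⟩
    have := Finset.card_le_card hsub
    rw [Nat.card_Icc] at this
    unfold occurrenceRank
    omega

lemma sum_add_div {q : ℕ} (hq : 0 < q) (a : ℕ) : ∑ l : Fin q, (a + l) / q = a := by
  rw [Fin.sum_univ_eq_sum_range fun l => (a + l) / q]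
  induction a with
  | zero =>
    refine Finset.sum_eq_zero fun l hl => ?_
    rw [Finset.mem_range] at hl
    rw [zero_add, Nat.div_eq_of_lt hl]
  | succ a ih =>
    have h1 := Finset.sum_range_succ (fun l => (a + l) / q) q
    have h2 := Finset.sum_range_succ' (fun l => (a + l) / q) q
    rw [h1, ih, Nat.add_div_right _ hq] at h2
    simp only [add_zero] at h2
    have : ∀ l, a + 1 + l = a + (l + 1) := fun l => by ring
    simp only [this]
    omega

lemma card_lt_le_card_add_div_lt {q : ℕ} (hq : 0 < q) {x y : Fin q → ℕ} (hxy : x ≤ y) :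
    (Finset.univ.filter fun k => x k < y k).card ≤
      (Finset.univ.filter fun l : Fin q => (∑ k, x k + l) / q < (∑ k, y k + l) / q).card := by
  set K := (Finset.univ.filter fun k => x k < y k).card with hK
  have hKq : K ≤ q := (Finset.card_filter_le _ _).trans (by simp)
  have hsum : ∑ k, x k + K ≤ ∑ k, y k := by
    rw [hK, Finset.card_filter, ← Finset.sum_add_distrib]
    refine Finset.sum_le_sum fun k _ => ?_
    split_ifs with h
    · exact h
    · exact hxy k
  have h1 := sum_add_div hq (∑ k, x k)
  have h2 := sum_add_div hq (∑ k, x k + K)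
  have h3 : ∑ l : Fin q, (∑ k, x k + K + l) / q ≤
      ∑ l : Fin q, ((∑ k, x k + l) / q +
        if (∑ k, x k + l) / q < (∑ k, y k + l) / q then 1 else 0) := by
    refine Finset.sum_le_sum fun l _ => ?_
    have hle : (∑ k, x k + K + l) / q ≤ (∑ k, y k + l) / q := Nat.div_le_div_right (by omega)
    have hle' : (∑ k, x k + K + l) / q ≤ (∑ k, x k + l) / q + 1 := by
      rw [← Nat.add_div_right _ hq]
      exact Nat.div_le_div_right (by omega)
    split_ifs <;> omega
  rw [Finset.sum_add_distrib, h1, h2, ← Finset.card_filter] at h3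
  omega

lemma natCast_eq_prod_ratio {a M : ℕ} (ha : 0 < a) (haM : a ≤ M) :
    (a : ℝ) = ∏ c ∈ Finset.Ico 1 M, if c < a then ((c : ℝ) + 1) / c else 1 := by
  rw [← Finset.prod_filter]
  have : (Finset.Ico 1 M).filter (· < a) = Finset.Ico 1 a := by
    ext c; simp only [Finset.mem_filter, Finset.mem_Ico]; omega
  rw [this]
  clear this haM
  induction a, ha using Nat.le_induction with
  | base => simp
  | succ a ha ih =>
    rw [Finset.prod_Ico_succ_top ha, ← ih]
    have : (0 : ℝ) < a := by exact_mod_cast ha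
    push_cast
    field_simp

lemma prod_le_prod_of_card_lt_le {κ : Type*} [Fintype κ] {a b : κ → ℕ} (ha : ∀ k, 0 < a k)
    (hb : ∀ k, 0 < b k)
    (h : ∀ c, 1 ≤ c → (Finset.univ.filter fun k => c < b k).card ≤
      (Finset.univ.filter fun k => c < a k).card) :
    ∏ k, (b k : ℝ) ≤ ∏ k, (a k : ℝ) := by
  set M := ∑ k, (a k + b k) with hM
  have haM : ∀ k, a k + b k ≤ M := fun k =>
    Finset.single_le_sum (f := fun k => a k + b k) (fun _ _ => Nat.zero_le _) (Finset.mem_univ k)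
  have key : ∀ u : κ → ℕ, (∀ k, 0 < u k) → (∀ k, u k ≤ M) → ∏ k, (u k : ℝ) =
      ∏ c ∈ Finset.Ico 1 M, (((c : ℝ) + 1) / c) ^ (Finset.univ.filter fun k => c < u k).card := by
    intro u hu huM
    rw [Finset.prod_congr rfl fun k _ => natCast_eq_prod_ratio (hu k) (huM k), Finset.prod_comm]
    refine Finset.prod_congr rfl fun c _ => ?_
    rw [← Finset.prod_filter, Finset.prod_const]
  rw [key a ha fun k => by have := haM k; omega, key b hb fun k => by have := haM k; omega]
  refine Finset.prod_le_prod (fun c _ => by positivity) fun c hc => ?_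
  have hc1 := (Finset.mem_Ico.1 hc).1
  refine pow_le_pow_right₀ ?_ (h c hc1)
  have : (0 : ℝ) < c := by exact_mod_cast hc1
  rw [le_div_iff₀ this]
  linarith

lemma prod_occurrenceRank_add_div_le {q : ℕ} (hq : 0 < q) {X : Fin q → ℕ → ℕ}
    (hX : ∀ k, Monotone (X k)) (t : ℕ) :
    ∏ l : Fin q, (occurrenceRank (fun u => (∑ k, X k u + l) / q) t : ℝ) ≤
      ∏ k, (occurrenceRank (X k) t : ℝ) := by
  refine prod_le_prod_of_card_lt_le (fun _ => occurrenceRank_pos _ _)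
    (fun _ => occurrenceRank_pos _ _) fun c _ => ?_
  have hY : ∀ l : Fin q, Monotone fun u => (∑ k, X k u + l) / q := fun l u v huv =>
    Nat.div_le_div_right (Nat.add_le_add_right (Finset.sum_le_sum fun k _ => hX k huv) _)
  simp only [lt_occurrenceRank_iff (hX _), lt_occurrenceRank_iff (hY _)]
  by_cases hct : c ≤ t
  swap
  · simp [hct]
  simp only [hct, true_and]
  have h := card_lt_le_card_add_div_lt hq (x := fun k => X k (t - c)) (y := fun k => X k t)
    fun k => hX k (by omega)
  have e1 := Finset.card_filter_add_card_filter_not (s := Finset.univ)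
    (fun k => X k (t - c) = X k t)
  have e2 := Finset.card_filter_add_card_filter_not (s := Finset.univ)
    (fun l : Fin q => (∑ k, X k (t - c) + l) / q = (∑ k, X k t + l) / q)
  have f1 : (Finset.univ.filter fun k => X k (t - c) < X k t) =
      Finset.univ.filter fun k => ¬ X k (t - c) = X k t :=
    Finset.filter_congr fun k _ => ⟨fun h => h.ne, fun h => lt_of_le_of_ne (hX k (by omega)) h⟩
  have f2 : (Finset.univ.filter fun l : Fin q =>
      (∑ k, X k (t - c) + l) / q < (∑ k, X k t + l) / q) =
      Finset.univ.filter fun l : Fin q =>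
        ¬ (∑ k, X k (t - c) + l) / q = (∑ k, X k t + l) / q :=
    Finset.filter_congr fun l _ =>
      ⟨fun h => h.ne, fun h => lt_of_le_of_ne (hY l (by omega : t - c ≤ t)) h⟩
  rw [f1, f2] at h
  omega

lemma exists_monotone_with_counts (n : ℕ → ℕ) (B : ℕ) :
    ∃ X : ℕ → ℕ, Monotone X ∧ (∀ t < ∑ x ∈ Finset.range B, n x, X t < B) ∧
      (∀ t, ∑ x ∈ Finset.range B, n x ≤ t → X t = B) ∧
      ∀ x < B, ((Finset.range (∑ x ∈ Finset.range B, n x)).filter (X · = x)).card = n x := by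
  induction B with
  | zero => exact ⟨fun _ => 0, monotone_const, by simp, by simp, by simp⟩
  | succ B ih =>
    obtain ⟨X, hm, h1, h2, h3⟩ := ih
    rw [Finset.sum_range_succ]
    set M := ∑ x ∈ Finset.range B, n x
    have hle : ∀ t, X t ≤ B := fun t => by
      rcases lt_or_ge t M with h | h
      · exact (h1 t h).le
      · exact (h2 t h).le
    refine ⟨fun t => if t < M + n B then X t else B + 1, fun u v huv => ?_, fun t ht => ?_,
      fun t ht => ?_, fun x hx => ?_⟩
    · have := hm huv
      have := hle u
      dsimp only
      split_ifs <;> omega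
    · simp only [ht, if_true]; have := hle t; omega
    · simp only [not_lt.2 ht, if_false]
    · rcases Nat.lt_succ_iff_lt_or_eq.1 hx with hx | rfl
      · rw [← h3 x hx]
        congr 1
        ext t
        simp only [Finset.mem_filter, Finset.mem_range]
        constructor
        · rintro ⟨ht, h⟩
          rw [if_pos ht] at h
          refine ⟨?_, h⟩
          by_contra hM
          have := h2 t (not_lt.1 hM)
          omega
        · rintro ⟨ht, h⟩
          exact ⟨by omega, by rw [if_pos (by omega)]; exact h⟩
      · have : (Finset.range (M + n x)).filter
            (fun t => (if t < M + n x then X t else x + 1) = x) = Finset.Ico M (M + n x) := by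
          ext t
          simp only [Finset.mem_filter, Finset.mem_range, Finset.mem_Ico]
          constructor
          · rintro ⟨ht, h⟩
            rw [if_pos ht] at h
            refine ⟨?_, ht⟩
            by_contra hM
            have := h1 t (not_le.1 hM)
            omega
          · rintro ⟨h, ht⟩
            exact ⟨ht, by rw [if_pos ht]; exact h2 t h⟩
        rw [this, Nat.card_Ico]
        omega

lemma prod_comp_eq_prod_pow_card {B M : ℕ} {X : ℕ → ℕ} (hX : ∀ t < M, X t < B) (f : ℕ → ℝ) :
    ∏ t ∈ Finset.range M, f (X t) =
      ∏ x ∈ Finset.range B, f x ^ ((Finset.range M).filter (X · = x)).card := by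
  rw [← Finset.prod_fiberwise_of_maps_to (t := Finset.range B) (g := X)
    fun t ht => Finset.mem_range.2 (hX t (Finset.mem_range.1 ht))]
  refine Finset.prod_congr rfl fun x _ => ?_
  rw [Finset.prod_congr rfl fun t ht => by rw [(Finset.mem_filter.1 ht).2], Finset.prod_const]

lemma sum_counts {B M : ℕ} {X : ℕ → ℕ} (hX : ∀ t < M, X t < B) :
    ∑ x ∈ Finset.range B, ((Finset.range M).filter (X · = x)).card = M := by
  rw [← Finset.card_eq_sum_card_fiberwise (fun t ht => by simpa using hX t (by simpa using ht)),
    Finset.card_range]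

lemma multinomial_counts {B M : ℕ} {X : ℕ → ℕ} (hX : ∀ t < M, X t < B) :
    (Nat.multinomial (Finset.range B) (fun x => ((Finset.range M).filter (X · = x)).card) : ℝ) =
      M.factorial / ∏ t ∈ Finset.range M, (occurrenceRank X t : ℝ) := by
  have h := Nat.multinomial_spec (Finset.range B)
    (fun x => ((Finset.range M).filter (X · = x)).card)
  rw [sum_counts hX, ← prod_occurrenceRank X M hX] at h
  rw [eq_div_iff (Finset.prod_ne_zero_iff.2 fun t _ => by
    exact_mod_cast (occurrenceRank_pos X t).ne'), mul_comm]
  exact_mod_cast h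

lemma factorial_div_mul_prod_le {B M : ℕ} {X : ℕ → ℕ} (hX : ∀ t < M, X t < B) {f : ℕ → ℝ}
    (hf : ∀ x, 0 ≤ f x) :
    M.factorial / (∏ t ∈ Finset.range M, (occurrenceRank X t : ℝ)) *
      ∏ t ∈ Finset.range M, f (X t) ≤ (∑ x ∈ Finset.range B, f x) ^ M := by
  rw [Finset.sum_pow_eq_sum_piAntidiag]
  set n : ℕ → ℕ := fun x => if x < B then ((Finset.range M).filter (X · = x)).card else 0 with hn
  have hnB : ∀ x ∈ Finset.range B, ((Finset.range M).filter (X · = x)).card = n x := fun x hx => by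
    simp [hn, Finset.mem_range.1 hx]
  have hmem : n ∈ Finset.piAntidiag (Finset.range B) M := by
    rw [Finset.mem_piAntidiag, ← Finset.sum_congr rfl hnB, sum_counts hX]
    refine ⟨rfl, fun x => not_imp_comm.1 fun h => ?_⟩
    simp [hn, Finset.mem_range.not.1 h]
  refine le_trans (le_of_eq ?_) (Finset.single_le_sum (f := fun k : ℕ → ℕ =>
    (Nat.multinomial (Finset.range B) k : ℝ) * ∏ i ∈ Finset.range B, f i ^ k i)
    (fun k _ => mul_nonneg (Nat.cast_nonneg _) (Finset.prod_nonneg fun i _ => pow_nonneg (hf i) _))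
    hmem)
  rw [← multinomial_counts hX, prod_comp_eq_prod_pow_card hX, Nat.multinomial_congr hnB]
  congr 1
  exact Finset.prod_congr rfl fun x hx => by rw [hnB x hx]

lemma card_piAntidiag_range_le (B M : ℕ) :
    (Finset.piAntidiag (Finset.range B) M).card ≤ (M + 1) ^ B := by
  have h : (Finset.piAntidiag (Finset.range B) M).card ≤
      (Fintype.piFinset fun _ : Fin B => Finset.range (M + 1)).card := by
    refine Finset.card_le_card_of_injOn (fun n i => n i) (fun n hn => ?_) fun n hn n' hn' he => ?_
    · rw [Finset.mem_coe, Finset.mem_piAntidiag] at hn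
      simp only [Finset.mem_coe, Fintype.mem_piFinset, Finset.mem_range]
      intro i
      have h1 := Finset.single_le_sum (f := n) (fun _ _ => Nat.zero_le _) (Finset.mem_range.2 i.2)
      have h2 : ∑ x ∈ Finset.range B, n x = M := hn.1
      omega
    · rw [Finset.mem_coe, Finset.mem_piAntidiag] at hn hn'
      funext x
      by_cases hx : x < B
      · exact congrFun he ⟨x, hx⟩
      · have h1 : n x = 0 := by by_contra h; exact hx (Finset.mem_range.1 (hn.2 x h))
        have h2 : n' x = 0 := by by_contra h; exact hx (Finset.mem_range.1 (hn'.2 x h))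
        rw [h1, h2]
  simpa using h

lemma le_of_forall_pow_le_poly_mul_pow {x y : ℝ} (hy : 0 ≤ y) (d : ℕ)
    (h : ∀ M : ℕ, x ^ M ≤ ((M : ℝ) + 1) ^ d * y ^ M) : x ≤ y := by
  rcases hy.eq_or_lt with rfl | hy
  · simpa using h 1
  by_contra! hlt
  have hr : 1 < x / y := by rwa [one_lt_div hy]
  have ht := (tendsto_pow_const_div_const_pow_of_one_lt d hr).comp (Filter.tendsto_add_atTop_nat 1)
  have hev := (ht.eventually (gt_mem_nhds (show (0 : ℝ) < (x / y)⁻¹ by positivity))).exists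
  obtain ⟨M, hM⟩ := hev
  simp only [Function.comp] at hM
  have h1 := h M
  rw [← div_le_iff₀ (by positivity), ← div_pow] at h1
  have hp : 0 < (x / y) ^ M := by positivity
  rw [pow_succ, div_lt_iff₀ (by positivity)] at hM
  push_cast at hM
  have : (x / y)⁻¹ * ((x / y) ^ M * (x / y)) = (x / y) ^ M := by
    rw [mul_comm, mul_assoc, mul_inv_cancel₀ (by positivity), mul_one]
  linarith

/-- A discrete Prékopa–Leindler inequality for averages with all possible roundings. -/
theorem prod_sum_pow_le_prod_sum {q : ℕ} (hq : 0 < q) {Λ : Type*} [Fintype Λ] {P : ℕ}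
    (lab : Λ → Fin q) (hlab : ∀ l, (Finset.univ.filter fun z => lab z = l).card = P) {B : ℕ}
    {f : Fin q → ℕ → ℝ} {h : Λ → ℕ → ℝ} (hf : ∀ k x, 0 ≤ f k x) (hh : ∀ z x, 0 ≤ h z x)
    (hfh : ∀ x : Fin q → ℕ, (∀ k, x k < B) →
      (∏ k, f k (x k)) ^ P ≤ ∏ z, h z ((∑ k, x k + lab z) / q)) :
    (∏ k, ∑ x ∈ Finset.range B, f k x) ^ P ≤ ∏ z, ∑ x ∈ Finset.range B, h z x := by
  have hcard : Fintype.card Λ = q * P := by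
    rw [← Finset.card_univ, Finset.card_eq_sum_card_fiberwise (f := lab) (t := Finset.univ)
      (by simp), Finset.sum_congr rfl fun l _ => hlab l]
    simp
  have hlabprod : ∀ g : Fin q → ℝ, ∏ z, g (lab z) = (∏ l, g l) ^ P := by
    intro g
    rw [← Finset.prod_fiberwise Finset.univ lab, ← Finset.prod_pow]
    refine Finset.prod_congr rfl fun l _ => ?_
    rw [Finset.prod_congr rfl fun z hz => by rw [(Finset.mem_filter.1 hz).2], Finset.prod_const,
      hlab]
  refine le_of_forall_pow_le_poly_mul_pow
    (Finset.prod_nonneg fun z _ => Finset.sum_nonneg fun x _ => hh z x) (B * q * P) fun M => ?_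
  have hterm : ∀ n ∈ Fintype.piFinset fun _ : Fin q => Finset.piAntidiag (Finset.range B) M,
      (∏ k, ((Nat.multinomial (Finset.range B) (n k) : ℝ) *
        ∏ x ∈ Finset.range B, f k x ^ n k x)) ^ P ≤ (∏ z, ∑ x ∈ Finset.range B, h z x) ^ M := by
    intro n hn
    rw [Fintype.mem_piFinset] at hn
    choose X hm h1 _ h3 using fun k => exists_monotone_with_counts (n k) B
    have hs : ∀ k, ∑ x ∈ Finset.range B, n k x = M := fun k => (Finset.mem_piAntidiag.1 (hn k)).1
    simp only [hs] at h1 h3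
    have hkt : ∀ k, (Nat.multinomial (Finset.range B) (n k) : ℝ) *
        ∏ x ∈ Finset.range B, f k x ^ n k x = M.factorial /
        (∏ t ∈ Finset.range M, (occurrenceRank (X k) t : ℝ)) *
          ∏ t ∈ Finset.range M, f k (X k t) := by
      intro k
      rw [← multinomial_counts (h1 k), prod_comp_eq_prod_pow_card (h1 k),
        Nat.multinomial_congr (fun x hx => h3 k x (Finset.mem_range.1 hx))]
      congr 1
      exact Finset.prod_congr rfl fun x hx => by rw [h3 k x (Finset.mem_range.1 hx)]
    set Y : Λ → ℕ → ℕ := fun z t => (∑ k, X k t + lab z) / q with hY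
    have hYB : ∀ z, ∀ t < M, Y z t < B := by
      intro z t ht
      rw [hY, Nat.div_lt_iff_lt_mul hq]
      have : ∑ k, (X k t + 1) ≤ ∑ _k : Fin q, B := Finset.sum_le_sum fun k _ => h1 k t ht
      rw [Finset.sum_add_distrib] at this
      simp only [Finset.sum_const, Finset.card_univ, Fintype.card_fin, smul_eq_mul, mul_one] at this
      have := (lab z).2
      rw [mul_comm B q]
      omega
    have hrank : ∏ z, ∏ t ∈ Finset.range M, (occurrenceRank (Y z) t : ℝ) ≤
        (∏ k, ∏ t ∈ Finset.range M, (occurrenceRank (X k) t : ℝ)) ^ P := by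
      rw [Finset.prod_comm, Finset.prod_comm (s := Finset.univ), ← Finset.prod_pow]
      refine Finset.prod_le_prod (fun t _ => Finset.prod_nonneg fun _ _ => Nat.cast_nonneg _)
        fun t _ => ?_
      rw [hlabprod fun l => (occurrenceRank (fun u => (∑ k, X k u + l) / q) t : ℝ)]
      exact pow_le_pow_left₀ (Finset.prod_nonneg fun _ _ => Nat.cast_nonneg _)
        (prod_occurrenceRank_add_div_le hq hm t) _
    have hval : (∏ k, ∏ t ∈ Finset.range M, f k (X k t)) ^ P ≤
        ∏ z, ∏ t ∈ Finset.range M, h z (Y z t) := by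
      rw [Finset.prod_comm, Finset.prod_comm (s := Finset.univ), ← Finset.prod_pow]
      refine Finset.prod_le_prod (fun t _ => pow_nonneg (Finset.prod_nonneg fun _ _ => hf _ _) _)
        fun t ht => ?_
      exact hfh (fun k => X k t) fun k => h1 k t (Finset.mem_range.1 ht)
    have hrpos : 0 < ∏ z, ∏ t ∈ Finset.range M, (occurrenceRank (Y z) t : ℝ) :=
      Finset.prod_pos fun z _ => Finset.prod_pos fun t _ => by
        exact_mod_cast occurrenceRank_pos (Y z) t
    calc _ = ((M.factorial : ℝ) ^ (q * P) /
          (∏ k, ∏ t ∈ Finset.range M, (occurrenceRank (X k) t : ℝ)) ^ P) *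
          (∏ k, ∏ t ∈ Finset.range M, f k (X k t)) ^ P := by
          rw [Finset.prod_congr rfl fun k _ => hkt k, Finset.prod_mul_distrib, mul_pow,
            Finset.prod_div_distrib, div_pow, Finset.prod_const, Finset.card_univ,
            Fintype.card_fin, ← pow_mul]
      _ ≤ ((M.factorial : ℝ) ^ (q * P) / ∏ z, ∏ t ∈ Finset.range M, (occurrenceRank (Y z) t : ℝ)) *
          ∏ z, ∏ t ∈ Finset.range M, h z (Y z t) := by
          refine mul_le_mul ?_ hval
            (pow_nonneg (Finset.prod_nonneg fun k _ => Finset.prod_nonneg fun t _ => hf _ _) _)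
            (by positivity)
          exact div_le_div_of_nonneg_left (by positivity) hrpos hrank
      _ = ∏ z, (M.factorial / (∏ t ∈ Finset.range M, (occurrenceRank (Y z) t : ℝ)) *
          ∏ t ∈ Finset.range M, h z (Y z t)) := by
          rw [Finset.prod_mul_distrib, Finset.prod_div_distrib, Finset.prod_const,
            Finset.card_univ, hcard]
      _ ≤ ∏ z, (∑ x ∈ Finset.range B, h z x) ^ M := by
          refine Finset.prod_le_prod (fun z _ => mul_nonneg
            (div_nonneg (Nat.cast_nonneg _) (Finset.prod_nonneg fun _ _ => Nat.cast_nonneg _))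
            (Finset.prod_nonneg fun t _ => hh _ _)) fun z _ => ?_
          exact factorial_div_mul_prod_le (hYB z) (hh z)
      _ = _ := Finset.prod_pow _ _ _
  set A := ∏ z, ∑ x ∈ Finset.range B, h z x with hA
  have hA0 : 0 ≤ A := Finset.prod_nonneg fun z _ => Finset.sum_nonneg fun x _ => hh z x
  rcases Nat.eq_zero_or_pos P with rfl | hP
  · have : IsEmpty Λ := Fintype.card_eq_zero_iff.1 (by simpa using hcard)
    simp [hA]
  set N := (Fintype.piFinset fun _ : Fin q => Finset.piAntidiag (Finset.range B) M).card with hN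
  have hNle : (N : ℝ) ≤ ((M : ℝ) + 1) ^ (B * q) := by
    rw [hN, Fintype.card_piFinset, Finset.prod_const, Finset.card_univ, Fintype.card_fin]
    rw [pow_mul]
    exact_mod_cast Nat.pow_le_pow_left (card_piAntidiag_range_le B M) q
  have hAr : ∀ n ∈ Fintype.piFinset fun _ : Fin q => Finset.piAntidiag (Finset.range B) M,
      (∏ k, ((Nat.multinomial (Finset.range B) (n k) : ℝ) *
        ∏ x ∈ Finset.range B, f k x ^ n k x)) ≤ (A ^ M) ^ ((P : ℝ)⁻¹) := by
    intro n hn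
    have h0 : 0 ≤ ∏ k, ((Nat.multinomial (Finset.range B) (n k) : ℝ) *
        ∏ x ∈ Finset.range B, f k x ^ n k x) := Finset.prod_nonneg fun k _ =>
      mul_nonneg (Nat.cast_nonneg _) (Finset.prod_nonneg fun x _ => pow_nonneg (hf _ _) _)
    calc _ = ((∏ k, ((Nat.multinomial (Finset.range B) (n k) : ℝ) *
        ∏ x ∈ Finset.range B, f k x ^ n k x)) ^ P) ^ ((P : ℝ)⁻¹) :=
          (Real.pow_rpow_inv_natCast h0 hP.ne').symm
      _ ≤ _ := Real.rpow_le_rpow (pow_nonneg h0 _) (hterm n hn) (by positivity)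
  calc ((∏ k, ∑ x ∈ Finset.range B, f k x) ^ P) ^ M
      = (∏ k, (∑ x ∈ Finset.range B, f k x) ^ M) ^ P := by
        rw [Finset.prod_pow, ← pow_mul, ← pow_mul, mul_comm]
    _ = (∑ n ∈ Fintype.piFinset fun _ : Fin q => Finset.piAntidiag (Finset.range B) M,
        ∏ k, ((Nat.multinomial (Finset.range B) (n k) : ℝ) *
          ∏ x ∈ Finset.range B, f k x ^ n k x)) ^ P := by
        congr 1
        rw [Finset.prod_congr rfl fun k _ => Finset.sum_pow_eq_sum_piAntidiag _ (f k) M]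
        exact Finset.prod_univ_sum _ _
    _ ≤ (N * (A ^ M) ^ ((P : ℝ)⁻¹)) ^ P := by
        refine pow_le_pow_left₀ (Finset.sum_nonneg fun n _ => Finset.prod_nonneg fun k _ =>
          mul_nonneg (Nat.cast_nonneg _) (Finset.prod_nonneg fun x _ => pow_nonneg (hf _ _) _)) ?_ _
        refine (Finset.sum_le_card_nsmul _ _ _ hAr).trans_eq ?_
        rw [nsmul_eq_mul]
    _ = (N : ℝ) ^ P * A ^ M := by
        rw [mul_pow, Real.rpow_inv_natCast_pow (pow_nonneg hA0 _) hP.ne']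
    _ ≤ _ := by
        refine mul_le_mul_of_nonneg_right ?_ (pow_nonneg hA0 _)
        rw [pow_mul]
        exact pow_le_pow_left₀ (Nat.cast_nonneg _) hNle _

end DiscretePrekopaLeindler

section MultivariatePrekopaLeindler

variable {q : ℕ} {Λ : Type*} [Fintype Λ] {P : ℕ}

lemma prod_sum_pow_le_prod_sum_fin (hq : 0 < q) (B d : ℕ)
    (lab : Fin d → Λ → Fin q) (hlab : ∀ c l, (Finset.univ.filter fun z => lab c z = l).card = P)
    {f : Fin q → (Fin d → ℕ) → ℝ} {h : Λ → (Fin d → ℕ) → ℝ} (hf : ∀ k x, 0 ≤ f k x)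
    (hh : ∀ z x, 0 ≤ h z x)
    (hfh : ∀ x : Fin q → Fin d → ℕ, (∀ k c, x k c < B) →
      (∏ k, f k (x k)) ^ P ≤ ∏ z, h z fun c => (∑ k, x k c + lab c z) / q) :
    (∏ k, ∑ x : Fin d → Fin B, f k fun c => x c) ^ P ≤
      ∏ z, ∑ x : Fin d → Fin B, h z fun c => x c := by
  induction d with
  | zero =>
    have := hfh (fun _ c => c.elim0) fun _ c => c.elim0
    simp only [Fintype.sum_unique]
    convert this using 4
  | succ d ih =>
    have hsplit : ∀ g : (Fin (d + 1) → ℕ) → ℝ, ∑ x : Fin (d + 1) → Fin B, g (fun c => x c) =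
        ∑ a ∈ Finset.range B, ∑ x : Fin d → Fin B, g (Fin.cons a fun c => (x c : ℕ)) := by
      intro g
      rw [Finset.sum_range, ← (Fin.consEquiv fun _ => Fin B).sum_comp, Fintype.sum_prod_type]
      refine Finset.sum_congr rfl fun a _ => Finset.sum_congr rfl fun x _ => ?_
      congr 1
      funext c
      refine Fin.cases ?_ (fun c => ?_) c <;> simp [Fin.consEquiv]
    simp only [hsplit]
    refine prod_sum_pow_le_prod_sum hq (lab 0) (hlab 0)
      (f := fun k a => ∑ x : Fin d → Fin B, f k (Fin.cons a fun c => (x c : ℕ)))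
      (h := fun z a => ∑ x : Fin d → Fin B, h z (Fin.cons a fun c => (x c : ℕ)))
      (fun k a => Finset.sum_nonneg fun x _ => hf _ _)
      (fun z a => Finset.sum_nonneg fun x _ => hh _ _) fun a ha => ?_
    refine ih (fun c => lab c.succ) (fun c => hlab c.succ)
      (f := fun k x => f k (Fin.cons (a k) x))
      (h := fun z x => h z (Fin.cons ((∑ k, a k + lab 0 z) / q) x))
      (fun k x => hf _ _) (fun z x => hh _ _) fun x hx => ?_
    refine (hfh (fun k => Fin.cons (a k) (x k)) fun k c => ?_).trans_eq ?_
    · refine Fin.cases ?_ (fun c => ?_) c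
      · simpa using ha k
      · simpa using hx k c
    · refine Finset.prod_congr rfl fun z _ => ?_
      congr 1
      funext c
      refine Fin.cases ?_ (fun c => ?_) c <;> simp

lemma prod_sum_pow_le_prod_sum_pi {γ : Type*} [Fintype γ] [DecidableEq γ] (hq : 0 < q) (B : ℕ)
    (lab : γ → Λ → Fin q) (hlab : ∀ c l, (Finset.univ.filter fun z => lab c z = l).card = P)
    {f : Fin q → (γ → ℕ) → ℝ} {h : Λ → (γ → ℕ) → ℝ} (hf : ∀ k x, 0 ≤ f k x)
    (hh : ∀ z x, 0 ≤ h z x)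
    (hfh : ∀ x : Fin q → γ → ℕ, (∀ k c, x k c < B) →
      (∏ k, f k (x k)) ^ P ≤ ∏ z, h z fun c => (∑ k, x k c + lab c z) / q) :
    (∏ k, ∑ x : γ → Fin B, f k fun c => x c) ^ P ≤
      ∏ z, ∑ x : γ → Fin B, h z fun c => x c := by
  have e := Fintype.equivFin γ
  have hre : ∀ g : (γ → ℕ) → ℝ, ∑ x : γ → Fin B, g (fun c => x c) =
      ∑ x : Fin (Fintype.card γ) → Fin B, g (fun c => x (e c)) := fun g =>
    ((e.arrowCongr (Equiv.refl (Fin B))).symm.sum_comp fun x : γ → Fin B => g fun c => x c).symm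
  simp only [hre]
  refine prod_sum_pow_le_prod_sum_fin hq B _ (fun c => lab (e.symm c)) (fun c => hlab _)
    (f := fun k x => f k fun c => x (e c)) (h := fun z x => h z fun c => x (e c))
    (fun k x => hf _ _) (fun z x => hh _ _) fun x hx => ?_
  refine (hfh (fun k c => x k (e c)) fun k c => hx k _).trans_eq ?_
  simp

end MultivariatePrekopaLeindler

section RandomRounding

variable {q : ℕ} {κ : Type*} [Fintype κ] [DecidableEq κ]

lemma sum_pi_eval (j : κ) (g : Fin q → ℝ) :
    ∑ z : κ → Fin q, g (z j) = (q : ℝ) ^ (Fintype.card κ - 1) * ∑ l, g l := by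
  have h := Finset.prod_univ_sum (fun _ : κ => (Finset.univ : Finset (Fin q)))
    fun j' l => if j' = j then g l else 1
  rw [Fintype.piFinset_univ] at h
  simp only [Finset.prod_ite_eq', Finset.mem_univ, if_true] at h
  rw [← h, ← Finset.mul_prod_erase _ _ (Finset.mem_univ j), mul_comm]
  congr 1
  · rw [Finset.prod_congr rfl (g := fun _ => (q : ℝ)) fun j' hj' => by
      simp [Finset.ne_of_mem_erase hj']]
    rw [Finset.prod_const, Finset.card_erase_of_mem (Finset.mem_univ j), Finset.card_univ]
  · simp

lemma card_pi_eval_eq (j : κ) (l : Fin q) :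
    (Finset.univ.filter fun z : κ → Fin q => z j = l).card = q ^ (Fintype.card κ - 1) := by
  have h := sum_pi_eval j fun l' => if l' = l then (1 : ℝ) else 0
  rw [← Finset.sum_filter, Finset.sum_const, nsmul_eq_mul, mul_one] at h
  simp only [Finset.sum_ite_eq', Finset.mem_univ, if_true, mul_one] at h
  exact_mod_cast h

lemma sum_pi_eval_mul_eval {j j' : κ} (hj : j ≠ j') {φ : κ → Fin q → ℝ} (hφ : ∑ l, φ j l = 0) :
    ∑ z : κ → Fin q, φ j (z j) * φ j' (z j') = 0 := by
  have h := Finset.prod_univ_sum (fun _ : κ => (Finset.univ : Finset (Fin q)))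
    fun i l => (if i = j then φ i l else 1) * (if i = j' then φ i l else 1)
  rw [Fintype.piFinset_univ] at h
  simp only [Finset.prod_mul_distrib, Finset.prod_ite_eq', Finset.mem_univ, if_true] at h
  rw [← h]
  refine Finset.prod_eq_zero (Finset.mem_univ j) ?_
  simpa [hj] using hφ

lemma sum_pi_sq_sum_eval {φ : κ → Fin q → ℝ} (hφ : ∀ j, ∑ l, φ j l = 0) :
    ∑ z : κ → Fin q, (∑ j, φ j (z j)) ^ 2 =
      (q : ℝ) ^ (Fintype.card κ - 1) * ∑ j, ∑ l, φ j l ^ 2 := by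
  simp only [sq, Finset.sum_mul_sum]
  rw [Finset.sum_comm, Finset.mul_sum]
  refine Finset.sum_congr rfl fun j _ => ?_
  rw [Finset.sum_comm, Finset.sum_eq_single j]
  · exact sum_pi_eval j fun l => φ j l * φ j l
  · exact fun j' _ hj' => sum_pi_eval_mul_eval hj'.symm (hφ j)
  · simp

/-- The increment of `x ↦ ⌊(x + l) / q⌋` over the interval `[a, a + b]`. -/
def roundedIncrement (q a b l : ℕ) : ℕ := (a + b + l) / q - (a + l) / q

lemma cast_roundedIncrement (q a b l : ℕ) :
    (roundedIncrement q a b l : ℝ) = ((a + b + l) / q : ℕ) - ((a + l) / q : ℕ) := by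
  rw [roundedIncrement, Nat.cast_sub (Nat.div_le_div_right (by omega))]

lemma sum_roundedIncrement (hq : 0 < q) (a b : ℕ) :
    ∑ l : Fin q, (roundedIncrement q a b l : ℝ) = b := by
  simp only [cast_roundedIncrement, Finset.sum_sub_distrib]
  rw [← Nat.cast_sum, ← Nat.cast_sum, sum_add_div hq, sum_add_div hq]
  push_cast
  ring

lemma sum_sq_roundedIncrement_sub_le (hq : 0 < q) (a b : ℕ) :
    ∑ l : Fin q, ((roundedIncrement q a b l : ℝ) - b / q) ^ 2 ≤ b := by
  have hq' : (0 : ℝ) < q := by exact_mod_cast hq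
  have h01 : ∀ l, ((roundedIncrement q a b l : ℝ) - (b / q : ℕ)) ^ 2 =
      (roundedIncrement q a b l : ℝ) - (b / q : ℕ) := by
    intro l
    have h1 : (a + b + l) / q = (a + l + b % q) / q + b / q := by
      rw [← Nat.add_mul_div_left _ _ hq]
      congr 1
      have := Nat.mod_add_div b q
      omega
    have h2 : (a + l + b % q) / q ≤ (a + l) / q + 1 := by
      rw [← Nat.add_div_right _ hq]
      exact Nat.div_le_div_right (by have := Nat.mod_lt b hq; omega)
    have h3 : (a + l) / q ≤ (a + l + b % q) / q := Nat.div_le_div_right (by omega)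
    have h4 : roundedIncrement q a b l = b / q ∨ roundedIncrement q a b l = b / q + 1 := by
      rw [roundedIncrement, h1]
      generalize b / q = e at *
      omega
    rcases h4 with h | h <;> rw [h] <;> push_cast <;> ring
  have hs := sum_roundedIncrement hq a b
  set c : ℝ := ((b / q : ℕ) : ℝ)
  calc ∑ l : Fin q, ((roundedIncrement q a b l : ℝ) - b / q) ^ 2
      = ∑ l : Fin q, (((roundedIncrement q a b l : ℝ) - c) ^ 2 +
          (2 * (c - b / q) * roundedIncrement q a b l + ((b / q : ℝ) ^ 2 - c ^ 2))) :=
        Finset.sum_congr rfl fun l _ => by ring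
    _ = ∑ l : Fin q, ((roundedIncrement q a b l : ℝ) - c) - q * (b / q - c) ^ 2 := by
        rw [Finset.sum_add_distrib, Finset.sum_add_distrib, ← Finset.mul_sum, hs]
        simp only [h01, Finset.sum_sub_distrib, hs, Finset.sum_const, Finset.card_univ,
          Fintype.card_fin, nsmul_eq_mul]
        field_simp
        ring
    _ ≤ b := by
        rw [Finset.sum_sub_distrib, hs]
        simp only [Finset.sum_const, Finset.card_univ,
          Fintype.card_fin, nsmul_eq_mul]
        have : 0 ≤ (q : ℝ) * c := by positivity
        have : 0 ≤ (q : ℝ) * (b / q - c) ^ 2 := by positivity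
        linarith

end RandomRounding

section RoundedTables

variable {q m : ℕ} {κ : Type*}

/-- Sum of the entries of column `j` in the first `t` rows. -/
def rowPrefix (E : Fin m → κ → ℕ) (t : ℕ) (j : κ) : ℕ :=
  ∑ i ∈ Finset.univ.filter fun i : Fin m => (i : ℕ) < t, E i j

lemma rowPrefix_zero (E : Fin m → κ → ℕ) (j : κ) : rowPrefix E 0 j = 0 := by simp [rowPrefix]

lemma rowPrefix_succ (E : Fin m → κ → ℕ) (i : Fin m) (j : κ) :
    rowPrefix E (i + 1) j = rowPrefix E i j + E i j := by
  have : (Finset.univ.filter fun i' : Fin m => (i' : ℕ) < i + 1) =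
      insert i (Finset.univ.filter fun i' : Fin m => (i' : ℕ) < i) := by
    ext i'
    simp only [Finset.mem_filter, Finset.mem_univ, true_and, Finset.mem_insert, Fin.ext_iff]
    omega
  rw [rowPrefix, this, Finset.sum_insert (by simp), add_comm, rowPrefix]

lemma rowPrefix_self (E : Fin m → κ → ℕ) (j : κ) : rowPrefix E m j = ∑ i, E i j := by
  simp [rowPrefix]

lemma rowPrefix_sum {ν : Type*} (s : Finset ν) (D : ν → Fin m → κ → ℕ) (t : ℕ) (j : κ) :
    rowPrefix (fun i j => ∑ k ∈ s, D k i j) t j = ∑ k ∈ s, rowPrefix (D k) t j :=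
  Finset.sum_comm

lemma eq_of_rowPrefix_succ_eq {D D' : Fin m → κ → ℕ}
    (h : ∀ (i : Fin m) j, rowPrefix D (i + 1) j = rowPrefix D' (i + 1) j) : D = D' := by
  have hall : ∀ t ≤ m, ∀ j, rowPrefix D t j = rowPrefix D' t j := by
    intro t ht j
    rcases t with _ | t
    · rw [rowPrefix_zero, rowPrefix_zero]
    · exact h ⟨t, ht⟩ j
  funext i j
  have h1 := h i j
  rw [rowPrefix_succ, rowPrefix_succ, hall i i.2.le] at h1
  exact Nat.add_left_cancel h1

/-- The table whose column partial sums are those of `E` divided by `q` and rounded with the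
column labels `z`. -/
def roundedTable (E : Fin m → κ → ℕ) (z : κ → Fin q) : Fin m → κ → ℕ :=
  fun i j => roundedIncrement q (rowPrefix E i j) (E i j) (z j)

lemma rowPrefix_roundedTable (E : Fin m → κ → ℕ) (z : κ → Fin q) {t : ℕ} (ht : t ≤ m) (j : κ) :
    rowPrefix (roundedTable E z) t j = (rowPrefix E t j + z j) / q := by
  induction t with
  | zero => rw [rowPrefix_zero, rowPrefix_zero, zero_add, Nat.div_eq_of_lt (z j).2]
  | succ t ih =>
    have h1 := rowPrefix_succ (roundedTable E z) ⟨t, ht⟩ j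
    have h2 := rowPrefix_succ E ⟨t, ht⟩ j
    simp only at h1 h2
    rw [h1, h2, ih (by omega), roundedTable, roundedIncrement]
    have : (rowPrefix E t j + z j) / q ≤ (rowPrefix E t j + E ⟨t, ht⟩ j + z j) / q :=
      Nat.div_le_div_right (by omega)
    simp only
    omega

variable [Fintype κ] [DecidableEq κ]

lemma sum_roundedTable (hq : 0 < q) (E : Fin m → κ → ℕ) (i : Fin m) (j : κ) :
    ∑ z : κ → Fin q, roundedTable E z i j = q ^ (Fintype.card κ - 1) * E i j := by
  have h := sum_pi_eval j fun l : Fin q =>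
    (roundedIncrement q (rowPrefix E i j) (E i j) l : ℝ)
  rw [sum_roundedIncrement hq] at h
  exact_mod_cast h

lemma prod_tableMonomial_roundedTable (hq : 0 < q) (W : Fin m → κ → ℝ)
    (D : Fin q → Fin m → κ → ℕ) :
    ∏ z : κ → Fin q, tableMonomial W (roundedTable (fun i j => ∑ k, D k i j) z) =
      (∏ k, tableMonomial W (D k)) ^ q ^ (Fintype.card κ - 1) := by
  simp only [tableMonomial]
  rw [Finset.prod_comm, Finset.prod_comm (s := Finset.univ) (t := Finset.univ)
    (f := fun k i => ∏ j, W i j ^ D k i j), ← Finset.prod_pow]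
  refine Finset.prod_congr rfl fun i _ => ?_
  rw [Finset.prod_comm, Finset.prod_comm (s := Finset.univ) (t := Finset.univ)
    (f := fun k j => W i j ^ D k i j), ← Finset.prod_pow]
  refine Finset.prod_congr rfl fun j _ => ?_
  rw [Finset.prod_pow_eq_pow_sum, Finset.prod_pow_eq_pow_sum, sum_roundedTable hq, ← pow_mul,
    mul_comm]

lemma sum_sq_row_roundedTable_sub_le (hq : 0 < q) (E : Fin m → κ → ℕ) (i : Fin m) {r : ℝ}
    (hr : ((∑ j, E i j : ℕ) : ℝ) = q * r) :
    ∑ z : κ → Fin q, (((∑ j, roundedTable E z i j : ℕ) : ℝ) - r) ^ 2 ≤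
      (q : ℝ) ^ (Fintype.card κ - 1) * (q * r) := by
  have hq' : (0 : ℝ) < q := by exact_mod_cast hq
  have h := sum_pi_sq_sum_eval (q := q) (φ := fun (j : κ) l =>
    (roundedIncrement q (rowPrefix E i j) (E i j) l : ℝ) - E i j / q) fun j => by
      rw [Finset.sum_sub_distrib, sum_roundedIncrement hq]
      simp only [Finset.sum_const, Finset.card_univ,
          Fintype.card_fin, nsmul_eq_mul]
      field_simp
      ring
  have he : ∀ z : κ → Fin q, ((∑ j, roundedTable E z i j : ℕ) : ℝ) - r = ∑ j,
      ((roundedIncrement q (rowPrefix E i j) (E i j) (z j) : ℝ) - E i j / q) := by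
    intro z
    rw [Finset.sum_sub_distrib, ← Finset.sum_div, ← Nat.cast_sum, ← Nat.cast_sum, hr,
      mul_div_cancel_left₀ _ hq'.ne']
    rfl
  simp only [he]
  rw [h, ← hr, Nat.cast_sum]
  exact mul_le_mul_of_nonneg_left
    (Finset.sum_le_sum fun j _ => sum_sq_roundedIncrement_sub_le hq _ _) (by positivity)

/-- The product of weighted table counts is dominated by a sum over tables with the average
column margins and Gaussian weights on the rows. -/
theorem prod_sum_tables_le_gaussian [Nonempty κ] (hq : 0 < q) {W : Fin m → κ → ℝ}
    (hW : ∀ i j, 0 ≤ W i j)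
    {Rk : Fin q → Fin m → ℕ} {Ck : Fin q → κ → ℕ} {R : Fin m → ℕ} {C : κ → ℕ}
    (hR : ∀ i, ∑ k, Rk k i = q * R i) (hC : ∀ j, ∑ k, Ck k j = q * C j) (hR0 : ∀ i, 0 < R i)
    (i0 : Fin m) :
    ∏ k, ∑ D ∈ columnTables (Fin m) (Ck k) with ∀ i, ∑ j, D i j = Rk k i, tableMonomial W D ≤
      (Real.exp 1 ^ (m - 1) * ∑ D ∈ columnTables (Fin m) C, tableMonomial W D *
        ∏ i ∈ {i0}ᶜ, Real.exp (-(((∑ j, D i j : ℕ) : ℝ) - R i) ^ 2 / R i)) ^ q := by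
  set P := q ^ (Fintype.card κ - 1) with hP
  have hP0 : 0 < P := pow_pos hq _
  have hPq : q ^ Fintype.card κ = q * P := by
    rw [hP, ← pow_succ', Nat.sub_add_cancel Fintype.card_pos]
  set B := ∑ k, ∑ j, Ck k j + 1 with hB
  set T : Fin q → Finset (Fin m → κ → ℕ) := fun k =>
    (columnTables (Fin m) (Ck k)).filter fun D => ∀ i, ∑ j, D i j = Rk k i with hT
  set g : (Fin m → κ → ℕ) → ℝ := fun D => Real.exp 1 ^ (m - 1) * (tableMonomial W D *
    ∏ i ∈ {i0}ᶜ, Real.exp (-(((∑ j, D i j : ℕ) : ℝ) - R i) ^ 2 / R i)) with hg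
  set code : (Fin m → κ → ℕ) → Fin m × κ → ℕ := fun D c => rowPrefix D (c.1 + 1) c.2 with hcode
  have hinj : ∀ D D', code D = code D' → D = D' := fun D D' h =>
    eq_of_rowPrefix_succ_eq fun i j => congrFun h (i, j)
  have hg0 : ∀ D, 0 ≤ g D := fun D => mul_nonneg (by positivity)
    (mul_nonneg (tableMonomial_nonneg hW D) (Finset.prod_nonneg fun i _ => (Real.exp_pos _).le))
  have hlt : ∀ k, ∀ D ∈ T k, ∀ c, code D c < B := by
    intro k D hD c
    rw [hT, Finset.mem_filter, mem_columnTables] at hD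
    have h1 : code D c ≤ Ck k c.2 := by
      rw [← hD.1 c.2]
      exact Finset.sum_le_sum_of_subset (Finset.filter_subset _ _)
    have h2 : Ck k c.2 ≤ ∑ j, Ck k j :=
      Finset.single_le_sum (fun _ _ => Nat.zero_le _) (Finset.mem_univ _)
    have h3 : ∑ j, Ck k j ≤ ∑ k, ∑ j, Ck k j :=
      Finset.single_le_sum (f := fun k => ∑ j, Ck k j) (fun _ _ => Nat.zero_le _)
        (Finset.mem_univ k)
    omega
  have hmain := prod_sum_pow_le_prod_sum_pi (γ := Fin m × κ) (Λ := κ → Fin q) (P := P) hq B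
    (fun c z => z c.2) (fun c l => card_pi_eval_eq c.2 l)
    (f := fun k x => ∑ D ∈ T k, if code D = x then tableMonomial W D else 0)
    (h := fun _ y => ∑ D ∈ columnTables (Fin m) C, if code D = y then g D else 0)
    (fun k x => Finset.sum_nonneg fun D _ => by
      split_ifs
      · exact tableMonomial_nonneg hW D
      · exact le_rfl)
    (fun _ y => Finset.sum_nonneg fun D _ => by
      split_ifs
      · exact hg0 D
      · exact le_rfl) ?_
  · have hL : ∀ k, ∑ x : Fin m × κ → Fin B,
        ∑ D ∈ T k, (if code D = (fun c => (x c : ℕ)) then tableMonomial W D else 0) =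
        ∑ D ∈ T k, tableMonomial W D := by
      intro k
      rw [Finset.sum_comm]
      refine Finset.sum_congr rfl fun D hD => ?_
      rw [Finset.sum_eq_single (fun c => (⟨code D c, hlt k D hD c⟩ : Fin B))]
      · exact if_pos rfl
      · intro x _ hx
        refine if_neg fun h => hx ?_
        funext c
        exact Fin.ext (congrFun h c).symm
      · simp
    have hH : ∑ x : Fin m × κ → Fin B,
        ∑ D ∈ columnTables (Fin m) C, (if code D = (fun c => (x c : ℕ)) then g D else 0) ≤
        ∑ D ∈ columnTables (Fin m) C, g D := by
      rw [Finset.sum_comm]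
      refine Finset.sum_le_sum fun D _ => ?_
      rw [← Finset.sum_filter, Finset.sum_const, nsmul_eq_mul]
      refine mul_le_of_le_one_left (hg0 D) ?_
      rw [Nat.cast_le_one, Finset.card_le_one]
      intro x hx y hy
      funext c
      have h := (Finset.mem_filter.1 hx).2.symm.trans (Finset.mem_filter.1 hy).2
      exact Fin.ext (congrFun h c)
    simp only [hL] at hmain
    have hH0 : 0 ≤ ∑ D ∈ columnTables (Fin m) C, g D := Finset.sum_nonneg fun D _ => hg0 D
    have h2 := hmain.trans (Finset.prod_le_prod (fun z _ => Finset.sum_nonneg fun x _ =>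
      Finset.sum_nonneg fun D _ => by
        split_ifs
        · exact hg0 D
        · exact le_rfl) fun z _ => hH)
    rw [Finset.prod_const, Finset.card_univ, Fintype.card_fun, Fintype.card_fin] at h2
    rw [Finset.mul_sum]
    rw [hPq, pow_mul] at h2
    exact le_of_pow_le_pow_left₀ hP0.ne' (pow_nonneg hH0 _) h2
  · intro x _
    by_cases hex : ∀ k, ∃ D ∈ T k, code D = x k
    swap
    · push Not at hex
      obtain ⟨k, hk⟩ := hex
      have : ∏ k, ∑ D ∈ T k, (if code D = x k then tableMonomial W D else 0) = 0 :=
        Finset.prod_eq_zero (Finset.mem_univ k) (Finset.sum_eq_zero fun D hD => if_neg (hk D hD))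
      rw [this, zero_pow hP0.ne']
      exact Finset.prod_nonneg fun z _ => Finset.sum_nonneg fun D _ => by
        split_ifs
        · exact hg0 D
        · exact le_rfl
    choose D hD hDx using hex
    have hf : ∀ k, ∑ D' ∈ T k, (if code D' = x k then tableMonomial W D' else 0) =
        tableMonomial W (D k) := by
      intro k
      rw [Finset.sum_eq_single (D k), if_pos (hDx k)]
      · intro D' _ hne
        exact if_neg fun h => hne (hinj _ _ (h.trans (hDx k).symm))
      · exact fun h => absurd (hD k) h
    set E : Fin m → κ → ℕ := fun i j => ∑ k, D k i j with hE
    have hcodeE : ∀ z : κ → Fin q, (fun c : Fin m × κ => (∑ k, x k c + z c.2) / q) =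
        code (roundedTable E z) := by
      intro z
      funext c
      rw [hcode]
      simp only
      rw [rowPrefix_roundedTable E z (Nat.succ_le_of_lt c.1.2), hE, rowPrefix_sum]
      simp only [← hDx]
      rfl
    have hcol : ∀ z : κ → Fin q, roundedTable E z ∈ columnTables (Fin m) C := by
      intro z
      rw [mem_columnTables]
      intro j
      rw [← rowPrefix_self, rowPrefix_roundedTable E z le_rfl, rowPrefix_self]
      have : ∑ i, E i j = q * C j := by
        rw [← hC j, hE, Finset.sum_comm]
        refine Finset.sum_congr rfl fun k _ => ?_
        have := hD k
        rw [hT, Finset.mem_filter, mem_columnTables] at this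
        exact this.1 j
      rw [this, Nat.mul_add_div hq, Nat.div_eq_of_lt (z j).2, add_zero]
    have hrow : ∀ i, ((∑ j, E i j : ℕ) : ℝ) = q * R i := by
      intro i
      have : ∑ j, E i j = q * R i := by
        rw [← hR i, hE, Finset.sum_comm]
        refine Finset.sum_congr rfl fun k _ => ?_
        have := hD k
        rw [hT, Finset.mem_filter] at this
        exact this.2 i
      exact_mod_cast this
    have hh : ∀ z : κ → Fin q, g (roundedTable E z) ≤ ∑ D' ∈ columnTables (Fin m) C,
        if code D' = (fun c : Fin m × κ => (∑ k, x k c + z c.2) / q) then g D' else 0 := by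
      intro z
      refine le_trans (le_of_eq ?_) (Finset.single_le_sum (f := fun D' =>
        if code D' = (fun c : Fin m × κ => (∑ k, x k c + z c.2) / q) then g D' else 0)
        (fun D' _ => ?_) (hcol z))
      · exact (if_pos (hcodeE z).symm).symm
      · split_ifs
        · exact hg0 D'
        · exact le_rfl
    simp only [hf]
    refine le_trans ?_ (Finset.prod_le_prod (fun z _ => hg0 _) fun z _ => hh z)
    rw [hg]
    simp only
    rw [Finset.prod_mul_distrib, Finset.prod_mul_distrib, prod_tableMonomial_roundedTable hq,
      mul_left_comm]
    refine le_mul_of_one_le_right (pow_nonneg (Finset.prod_nonneg fun k _ =>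
      tableMonomial_nonneg hW _) _) ?_
    rw [Finset.prod_comm (t := {i0}ᶜ), Finset.prod_const]
    have hexp : ∀ i ∈ ({i0}ᶜ : Finset (Fin m)),
        (Real.exp 1 ^ (Finset.univ : Finset (κ → Fin q)).card)⁻¹ ≤ ∏ z : κ → Fin q,
          Real.exp (-(((∑ j, roundedTable E z i j : ℕ) : ℝ) - R i) ^ 2 / R i) := by
      intro i _
      have hRi : (0 : ℝ) < R i := by exact_mod_cast hR0 i
      rw [← Real.exp_sum, Real.exp_one_pow, ← Real.exp_neg, Real.exp_le_exp, ← Finset.sum_div,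
        Finset.sum_neg_distrib, neg_div, neg_le_neg_iff, div_le_iff₀ hRi]
      refine (sum_sq_row_roundedTable_sub_le hq E i (hrow i)).trans (le_of_eq ?_)
      rw [Finset.card_univ, Fintype.card_fun, Fintype.card_fin, hPq, hP]
      push_cast
      ring
    have hcardm : ({i0}ᶜ : Finset (Fin m)).card = m - 1 := by
      rw [Finset.card_compl, Finset.card_singleton, Fintype.card_fin]
    calc (1 : ℝ) = (Real.exp 1 ^ (m - 1)) ^ (Finset.univ : Finset (κ → Fin q)).card *
          ∏ i ∈ ({i0}ᶜ : Finset (Fin m)),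
            (Real.exp 1 ^ (Finset.univ : Finset (κ → Fin q)).card)⁻¹ := by
          rw [Finset.prod_const, hcardm, inv_pow, ← pow_mul, ← pow_mul, mul_comm (m - 1),
            mul_inv_cancel₀ (by positivity)]
      _ ≤ _ := mul_le_mul_of_nonneg_left
          (Finset.prod_le_prod (fun i _ => by positivity) hexp) (by positivity)

end RoundedTables

section ExactTables

variable {m : ℕ} {κ : Type*} [Fintype κ] [DecidableEq κ]

/-- The weighted count of tables with margins `R` and `C`, as a finite sum. -/
noncomputable def tableSum (R : Fin m → ℕ) (C : κ → ℕ) (W : Fin m → κ → ℝ) : ℝ :=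
  ∑ D ∈ columnTables (Fin m) C with ∀ i, ∑ j, D i j = R i, tableMonomial W D

lemma tableSum_nonneg {W : Fin m → κ → ℝ} (hW : ∀ i j, 0 ≤ W i j) (R : Fin m → ℕ) (C : κ → ℕ) :
    0 ≤ tableSum R C W :=
  Finset.sum_nonneg fun D _ => tableMonomial_nonneg hW D

lemma tableSum_pos {W : Fin m → κ → ℝ} (hW : ∀ i j, 0 < W i j) {R : Fin m → ℕ} {C : κ → ℕ}
    (h : ∑ i, R i = ∑ j, C j) : 0 < tableSum R C W := by
  obtain ⟨D, hD1, hD2⟩ := exists_table R C h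
  exact Finset.sum_pos (fun D _ => tableMonomial_pos hW D)
    ⟨D, Finset.mem_filter.2 ⟨mem_columnTables.2 hD2, hD1⟩⟩

lemma tableSum_rowScale (R : Fin m → ℕ) (C : κ → ℕ) (W : Fin m → κ → ℝ) (l : Fin m → ℝ) :
    tableSum R C (fun i j => l i * W i j) = (∏ i, l i ^ R i) * tableSum R C W := by
  rw [tableSum, tableSum, Finset.mul_sum]
  refine Finset.sum_congr rfl fun D hD => ?_
  rw [tableMonomial_rowScale]
  simp only [(Finset.mem_filter.1 hD).2]

lemma continuous_tableSum (R : Fin m → ℕ) (C : κ → ℕ) {W : ℝ → Fin m → κ → ℝ}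
    (hW : ∀ i j, Continuous fun x => W x i j) : Continuous fun x => tableSum R C (W x) := by
  unfold tableSum tableMonomial
  exact continuous_finsetSum _ fun D _ => continuous_finsetProd _ fun i _ =>
    continuous_finsetProd _ fun j _ => (hW i j).pow _

lemma prod_tableSum_le_pow [Nonempty κ] {q : ℕ} (hq : 0 < q) {Rk : Fin q → Fin m → ℕ}
    {Ck : Fin q → κ → ℕ} {R : Fin m → ℕ} {C : κ → ℕ}
    (hR : ∀ i, ∑ k, Rk k i = q * R i) (hC : ∀ j, ∑ k, Ck k j = q * C j) (hR0 : ∀ i, 0 < R i)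
    (hRC : ∑ i, R i = ∑ j, C j) {W : Fin m → κ → ℝ} (hW : ∀ i j, 0 < W i j) (hm : 0 < m) {s : ℝ}
    (hs : 0 < s) (hsum : ∑ i, (R i : ℝ) = m * s) :
    ∏ k, tableSum (Rk k) (Ck k) W ≤
      (Real.exp 1 ^ (m - 1) * (Real.exp 1 * √s) ^ (m - 1) * tableSum R C W) ^ q := by
  have : Nonempty (Fin m) := ⟨⟨0, hm⟩⟩
  obtain ⟨i0, hmax⟩ := Finite.exists_max R
  have hprod0 : ∀ W : Fin m → κ → ℝ, (∀ i j, 0 < W i j) → 0 ≤ ∏ k, tableSum (Rk k) (Ck k) W :=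
    fun W hW => Finset.prod_nonneg fun k _ => tableSum_nonneg (fun i j => (hW i j).le) _ _
  have h := le_sum_exact_of_le_gaussian (ι := Fin m) hR0 hRC hmax
    (G := fun W => (∏ k, tableSum (Rk k) (Ck k) W) ^ ((q : ℝ)⁻¹)) (fun W hW l hl => ?_)
    (c := Real.exp 1 ^ (m - 1)) (by positivity) (fun W hW => ?_) hW hs (by simpa using hsum)
  · rw [Fintype.card_fin] at h
    have h2 := pow_le_pow_left₀ (Real.rpow_nonneg (hprod0 W hW) _) h q
    rw [Real.rpow_inv_natCast_pow (hprod0 W hW) hq.ne'] at h2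
    refine h2.trans_eq ?_
    rw [tableSum]
    congr!
  · simp only [tableSum_rowScale]
    have hl0 : 0 ≤ ∏ i, l i ^ R i := Finset.prod_nonneg fun i _ => pow_nonneg (hl i).le _
    rw [Finset.prod_mul_distrib, Finset.prod_comm]
    simp only [Finset.prod_pow_eq_pow_sum, hR]
    simp only [mul_comm q, pow_mul]
    rw [Finset.prod_pow, Real.mul_rpow (pow_nonneg hl0 _) (hprod0 W hW),
      Real.pow_rpow_inv_natCast hl0 hq.ne']
  · have h1 := prod_sum_tables_le_gaussian hq (fun i j => (hW i j).le) hR hC hR0 i0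
    have h2 := Real.rpow_le_rpow (hprod0 W hW) h1 (inv_nonneg.2 (Nat.cast_nonneg q))
    rwa [Real.pow_rpow_inv_natCast _ hq.ne'] at h2
    exact mul_nonneg (by positivity) (Finset.sum_nonneg fun D _ =>
      mul_nonneg (tableMonomial_pos hW D).le (Finset.prod_nonneg fun i _ => (Real.exp_pos _).le))

end ExactTables

section DiophantineApproximation

variable {p : ℕ}

lemma exists_simultaneous_approx {α : Fin p → ℝ} (hα : ∀ k, 0 ≤ α k) {ε : ℝ} (hε : 0 < ε) :
    ∃ q : ℕ, 0 < q ∧ ∃ a : Fin p → ℕ, ∀ k, |(a k : ℝ) - q * α k| ≤ ε := by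
  obtain ⟨M, hM⟩ := exists_nat_gt ε⁻¹
  have hM0 : (0 : ℝ) < M := (inv_pos.2 hε).trans hM
  have hbin : ∀ x : ℝ, ⌊M * Int.fract x⌋₊ < M := fun x => by
    rw [Nat.floor_lt (mul_nonneg hM0.le (Int.fract_nonneg x))]
    exact mul_lt_of_lt_one_right hM0 (Int.fract_lt_one x)
  obtain ⟨t, u, htu, he⟩ := Finite.exists_ne_map_eq_of_infinite
    fun (t : ℕ) (k : Fin p) => (⟨⌊M * Int.fract (t * α k)⌋₊, hbin _⟩ : Fin M)
  wlog hlt : t < u generalizing t u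
  · exact this u t htu.symm he.symm (by omega)
  refine ⟨u - t, by omega, fun k => ⌊(u : ℝ) * α k⌋₊ - ⌊(t : ℝ) * α k⌋₊, fun k => ?_⟩
  have hk : ⌊M * Int.fract (t * α k)⌋₊ = ⌊M * Int.fract (u * α k)⌋₊ :=
    congrArg Fin.val (congrFun he k)
  have hut : (t : ℝ) ≤ u := by exact_mod_cast hlt.le
  have hmono : ⌊(t : ℝ) * α k⌋₊ ≤ ⌊(u : ℝ) * α k⌋₊ :=
    Nat.floor_mono (mul_le_mul_of_nonneg_right hut (hα k))
  have e1 : ∀ v : ℕ, (⌊(v : ℝ) * α k⌋₊ : ℝ) = v * α k - Int.fract (v * α k) := fun v => by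
    rw [natCast_floor_eq_intCast_floor (mul_nonneg (Nat.cast_nonneg v) (hα k)), Int.self_sub_fract]
  rw [Nat.cast_sub hmono, Nat.cast_sub hlt.le, e1, e1]
  have f1 := Nat.floor_le (mul_nonneg hM0.le (Int.fract_nonneg ((t : ℝ) * α k)))
  have f2 := Nat.lt_floor_add_one (M * Int.fract ((t : ℝ) * α k))
  have f3 := Nat.floor_le (mul_nonneg hM0.le (Int.fract_nonneg ((u : ℝ) * α k)))
  have f4 := Nat.lt_floor_add_one (M * Int.fract ((u : ℝ) * α k))
  rw [hk] at f1 f2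
  have hMε : 1 ≤ M * ε := by
    rw [inv_lt_iff_one_lt_mul₀ hε] at hM
    linarith
  rw [abs_le]
  constructor <;> refine le_of_mul_le_mul_left ?_ hM0 <;> linarith

lemma sum_mul_eq_of_approx {α : Fin p → ℝ} {a : Fin p → ℕ} {q : ℕ} {ε : ℝ}
    (ha : ∀ k, |(a k : ℝ) - q * α k| ≤ ε) {v : Fin p → ℕ} {V : ℕ}
    (hv : (V : ℝ) = ∑ k, α k * v k) (hε : ε * ∑ k, (v k : ℝ) < 1) :
    ∑ k, a k * v k = q * V := by
  have h : |((∑ k, a k * v k : ℕ) : ℝ) - (q * V : ℕ)| < 1 := by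
    push_cast
    rw [hv, Finset.mul_sum, ← Finset.sum_sub_distrib]
    refine (Finset.abs_sum_le_sum_abs _ _).trans_lt (lt_of_le_of_lt ?_ hε)
    rw [Finset.mul_sum]
    refine Finset.sum_le_sum fun k _ => ?_
    rw [← mul_assoc, ← sub_mul, abs_mul, Nat.abs_cast]
    exact mul_le_mul_of_nonneg_right (ha k) (Nat.cast_nonneg _)
  have h' : |((∑ k, a k * v k : ℕ) : ℤ) - ((q * V : ℕ) : ℤ)| < 1 := by exact_mod_cast h
  rw [Int.abs_lt_one_iff] at h'
  omega

/-- A power inequality for all rational averages implies the inequality with real exponents. -/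
lemma prod_rpow_le_of_forall_pow {α : Fin p → ℝ} (hα : ∀ k, 0 ≤ α k) {T : Fin p → ℝ}
    (hT : ∀ k, 0 < T k) {K ε₀ : ℝ} (hK : 0 < K) (hε₀ : 0 < ε₀)
    (h : ∀ (q : ℕ) (a : Fin p → ℕ), 0 < q → (∀ k, |(a k : ℝ) - q * α k| ≤ ε₀) →
      ∏ k, T k ^ a k ≤ K ^ q) : ∏ k, T k ^ α k ≤ K := by
  rw [← Real.log_le_log_iff (Finset.prod_pos fun k _ => Real.rpow_pos_of_pos (hT k) _) hK,
    Real.log_prod fun k _ => (Real.rpow_pos_of_pos (hT k) _).ne']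
  simp only [Real.log_rpow (hT _)]
  refine le_of_forall_pos_le_add fun δ hδ => ?_
  set S := ∑ k, |Real.log (T k)| + 1 with hS
  have hS0 : 0 < S := by positivity
  obtain ⟨q, hq, a, ha⟩ := exists_simultaneous_approx hα (lt_min hε₀ (div_pos hδ hS0))
  have h1 := h q a hq fun k => (ha k).trans (min_le_left _ _)
  rw [← Real.log_le_log_iff (Finset.prod_pos fun k _ => pow_pos (hT k) _) (pow_pos hK _),
    Real.log_prod fun k _ => (pow_pos (hT k) _).ne', Real.log_pow] at h1
  simp only [Real.log_pow] at h1
  have h2 : ∑ k, (q * α k - a k) * Real.log (T k) ≤ δ := by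
    calc _ ≤ ∑ k, δ / S * |Real.log (T k)| := by
          refine Finset.sum_le_sum fun k _ => (le_abs_self _).trans ?_
          rw [abs_mul, abs_sub_comm]
          exact mul_le_mul_of_nonneg_right ((ha k).trans (min_le_right _ _)) (abs_nonneg _)
      _ ≤ δ / S * S := by
          rw [← Finset.mul_sum]
          exact mul_le_mul_of_nonneg_left (by rw [hS]; linarith) (by positivity)
      _ = δ := by field_simp
  have hq1 : (1 : ℝ) ≤ q := by exact_mod_cast hq
  have h3 : q * ∑ k, α k * Real.log (T k) ≤ q * (Real.log K + δ) := by
    calc _ = ∑ k, a k * Real.log (T k) + ∑ k, (q * α k - a k) * Real.log (T k) := by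
          rw [← Finset.sum_add_distrib, Finset.mul_sum]
          exact Finset.sum_congr rfl fun k _ => by ring
      _ ≤ q * Real.log K + δ := add_le_add h1 h2
      _ ≤ _ := by nlinarith
  exact le_of_mul_le_mul_left h3 (by linarith)

end DiophantineApproximation

section Assembly

variable {m p : ℕ} {κ : Type*} [Fintype κ] [DecidableEq κ] [Nonempty κ]

lemma prod_tableSum_rpow_le_of_pos (hm : 0 < m) {W : Fin m → κ → ℝ} (hW : ∀ i j, 0 < W i j)
    {N : ℕ} {Rk : Fin p → Fin m → ℕ} {Ck : Fin p → κ → ℕ} (hRN : ∀ k, ∑ i, Rk k i = N)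
    (hCN : ∀ k, ∑ j, Ck k j = N) {α : Fin p → ℝ} (hα : ∀ k, 0 ≤ α k) (hα1 : ∑ k, α k = 1)
    {R : Fin m → ℕ} {C : κ → ℕ} (hR0 : ∀ i, 0 < R i)
    (hR : ∀ i, (R i : ℝ) = ∑ k, α k * Rk k i) (hC : ∀ j, (C j : ℝ) = ∑ k, α k * Ck k j) :
    ∏ k, tableSum (Rk k) (Ck k) W ^ α k ≤
      (Real.exp 4 * (N / m)) ^ (((m : ℝ) - 1) / 2) * tableSum R C W := by
  have hRs : ∑ i, R i = N := by
    have : (∑ i, (R i : ℝ)) = N := by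
      simp only [hR]
      rw [Finset.sum_comm]
      simp only [← Finset.mul_sum, ← Nat.cast_sum, hRN, ← Finset.sum_mul, hα1, one_mul]
    exact_mod_cast this
  have hCs : ∑ j, C j = N := by
    have : (∑ j, (C j : ℝ)) = N := by
      simp only [hC]
      rw [Finset.sum_comm]
      simp only [← Finset.mul_sum, ← Nat.cast_sum, hCN, ← Finset.sum_mul, hα1, one_mul]
    exact_mod_cast this
  have hm' : (0 : ℝ) < m := by exact_mod_cast hm
  have hN : (0 : ℝ) < N := by
    have : 0 < ∑ i, R i := Finset.sum_pos (fun i _ => hR0 i) ⟨⟨0, hm⟩, Finset.mem_univ _⟩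
    rw [hRs] at this
    exact_mod_cast this
  set s : ℝ := N / m with hs
  have hs0 : 0 < s := div_pos hN hm'
  have hconst : Real.exp 1 ^ (m - 1) * (Real.exp 1 * √s) ^ (m - 1) =
      (Real.exp 4 * s) ^ (((m : ℝ) - 1) / 2) := by
    have h4 : Real.exp 4 = (Real.exp 1 ^ 2) ^ 2 := by
      rw [Real.exp_one_pow, ← Real.exp_nat_mul]; norm_num
    have hsqrt : Real.exp 1 * (Real.exp 1 * √s) = √(Real.exp 4 * s) := by
      rw [h4, Real.sqrt_mul (by positivity), Real.sqrt_sq (by positivity)]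
      ring
    rw [← mul_pow, hsqrt, ← Real.rpow_natCast, Nat.cast_sub hm, Nat.cast_one,
      ← Real.rpow_div_two_eq_sqrt _ (by positivity)]
  rw [← hconst]
  have hTpos : ∀ k, 0 < tableSum (Rk k) (Ck k) W := fun k =>
    tableSum_pos hW ((hRN k).trans (hCN k).symm)
  have hT : 0 < tableSum R C W := tableSum_pos hW (hRs.trans hCs.symm)
  set ε₀ : ℝ := (p * (N + 1) + 1 : ℝ)⁻¹ with hε
  have hbound : ∀ v : Fin p → ℕ, (∀ k, v k ≤ N + 1) → ε₀ * ∑ k, (v k : ℝ) < 1 := by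
    intro v hv
    rw [hε, inv_mul_lt_iff₀ (by positivity), mul_one]
    have : ∑ k, (v k : ℝ) ≤ ∑ _k : Fin p, ((N : ℝ) + 1) :=
      Finset.sum_le_sum fun k _ => by exact_mod_cast hv k
    simp only [Finset.sum_const, Finset.card_univ, Fintype.card_fin, nsmul_eq_mul] at this
    linarith
  refine prod_rpow_le_of_forall_pow hα hTpos (mul_pos (by positivity) hT)
    (ε₀ := ε₀) (by positivity) fun q a hq ha => ?_
  have haq : ∑ k, a k = q := by
    have := sum_mul_eq_of_approx ha (v := fun _ => 1) (V := 1) (by simpa using hα1.symm)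
      (hbound _ fun k => by omega)
    simpa using this
  have haR : ∀ i, ∑ k, a k * Rk k i = q * R i := fun i =>
    sum_mul_eq_of_approx ha (hR i) (hbound _ fun k => by
      have := Finset.single_le_sum (f := Rk k) (fun _ _ => Nat.zero_le _) (Finset.mem_univ i)
      have := hRN k
      omega)
  have haC : ∀ j, ∑ k, a k * Ck k j = q * C j := fun j =>
    sum_mul_eq_of_approx ha (hC j) (hbound _ fun k => by
      have := Finset.single_le_sum (f := Ck k) (fun _ _ => Nat.zero_le _) (Finset.mem_univ j)
      have := hCN k
      omega)
  subst haq
  set σ : Fin (∑ k, a k) → Fin p := fun t => (finSigmaFinEquiv.symm t).1 with hσ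
  have hσsum : ∀ v : Fin p → ℕ, ∑ t, v (σ t) = ∑ k, a k * v k := by
    intro v
    rw [hσ, finSigmaFinEquiv.symm.sum_comp fun x : (k : Fin p) × Fin (a k) => v x.1,
      Fintype.sum_sigma]
    simp
  have hσprod : ∏ t, tableSum (Rk (σ t)) (Ck (σ t)) W =
      ∏ k, tableSum (Rk k) (Ck k) W ^ a k := by
    rw [hσ, finSigmaFinEquiv.symm.prod_comp fun x : (k : Fin p) × Fin (a k) =>
      tableSum (Rk x.1) (Ck x.1) W, Fintype.prod_sigma]
    simp
  rw [← hσprod]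
  refine prod_tableSum_le_pow hq (fun i => ?_) (fun j => ?_) hR0 (hRs.trans hCs.symm) hW hm hs0 ?_
  · rw [hσsum fun k => Rk k i, haR]
  · rw [hσsum fun k => Ck k j, haC]
  · rw [← Nat.cast_sum, hRs, hs]
    field_simp

lemma prod_tableSum_rpow_le (hm : 0 < m) {W : Fin m → κ → ℝ} (hW : ∀ i j, 0 ≤ W i j)
    {N : ℕ} {Rk : Fin p → Fin m → ℕ} {Ck : Fin p → κ → ℕ} (hRN : ∀ k, ∑ i, Rk k i = N)
    (hCN : ∀ k, ∑ j, Ck k j = N) {α : Fin p → ℝ} (hα : ∀ k, 0 ≤ α k) (hα1 : ∑ k, α k = 1)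
    {R : Fin m → ℕ} {C : κ → ℕ} (hR0 : ∀ i, 0 < R i)
    (hR : ∀ i, (R i : ℝ) = ∑ k, α k * Rk k i) (hC : ∀ j, (C j : ℝ) = ∑ k, α k * Ck k j) :
    ∏ k, tableSum (Rk k) (Ck k) W ^ α k ≤
      (Real.exp 4 * (N / m)) ^ (((m : ℝ) - 1) / 2) * tableSum R C W := by
  have hc : ∀ (R : Fin m → ℕ) (C : κ → ℕ),
      Continuous fun x : ℝ => tableSum R C fun i j => W i j + x := fun R C =>
    continuous_tableSum R C fun i j => by fun_prop
  have hl : Continuous fun x : ℝ => ∏ k, tableSum (Rk k) (Ck k) (fun i j => W i j + x) ^ α k :=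
    continuous_finsetProd _ fun k _ => (hc _ _).rpow_const fun _ => Or.inr (hα k)
  have hr : Continuous fun x : ℝ => (Real.exp 4 * (N / m)) ^ (((m : ℝ) - 1) / 2) *
      tableSum R C fun i j => W i j + x := continuous_const.mul (hc R C)
  have h := le_of_tendsto_of_tendsto ((hl.tendsto 0).mono_left nhdsWithin_le_nhds)
    ((hr.tendsto 0).mono_left nhdsWithin_le_nhds) (b := nhdsWithin 0 (Set.Ioi 0)) (by
      filter_upwards [self_mem_nhdsWithin] with x hx
      exact prod_tableSum_rpow_le_of_pos hm
        (fun i j => add_pos_of_nonneg_of_pos (hW i j) hx) hRN hCN hα hα1 hR0 hR hC)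
  simpa using h

end Assembly

lemma tableWeight_eq_tableSum {m n : ℕ} (R : Fin m → ℕ) (C : Fin n → ℕ)
    (W : Fin m → Fin n → ℝ) : tableWeight R C W = tableSum R C W := by
  have h : ∀ D : Fin m → Fin n → ℕ, ((∀ i, ∑ j, D i j = R i) ∧ ∀ j, ∑ i, D i j = C j) ↔
      D ∈ (columnTables (Fin m) C).filter fun D => ∀ i, ∑ j, D i j = R i := fun D => by
    rw [Finset.mem_filter, mem_columnTables, and_comm]
  rw [tableSum, ← Finset.tsum_subtype, ← (Equiv.subtypeEquivRight h).tsum_eq]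
  rfl

lemma tableWeight_transpose {m n : ℕ} (R : Fin m → ℕ) (C : Fin n → ℕ)
    (W : Fin m → Fin n → ℝ) : tableWeight C R (fun j i => W i j) = tableWeight R C W := by
  have h : ∀ D : Fin m → Fin n → ℕ, ((∀ i, ∑ j, D i j = R i) ∧ ∀ j, ∑ i, D i j = C j) ↔
      (∀ j, ∑ i, Equiv.piComm (fun _ _ => ℕ) D j i = C j) ∧
        ∀ i, ∑ j, Equiv.piComm (fun _ _ => ℕ) D j i = R i := fun D => and_comm
  rw [tableWeight, tableWeight, ← ((Equiv.piComm fun _ _ => ℕ).subtypeEquiv h).tsum_eq]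
  exact tsum_congr fun D => Finset.prod_comm

theorem brunn_minkowski_contingency_cor3 :
    ∃ κ : ℝ, 0 < κ ∧
      ∀ (m n p N : ℕ), 0 < m → 0 < n →
      ∀ (W : Fin m → Fin n → ℝ), (∀ i j, 0 ≤ W i j) →
      ∀ (Rk : Fin p → Fin m → ℕ) (Ck : Fin p → Fin n → ℕ),
      (∀ k i, 0 < Rk k i) → (∀ k j, 0 < Ck k j) →
      (∀ k, ∑ i, Rk k i = N) → (∀ k, ∑ j, Ck k j = N) →
      ∀ (α : Fin p → ℝ), (∀ k, 0 ≤ α k) → (∑ k, α k = 1) →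
      ∀ (R : Fin m → ℕ) (C : Fin n → ℕ),
      (∀ i, 0 < R i) → (∀ j, 0 < C j) →
      (∀ i, (R i : ℝ) = ∑ k, α k * Rk k i) →
      (∀ j, (C j : ℝ) = ∑ k, α k * Ck k j) →
      ∀ (a : ℕ), a = min m n → ∀ (s : ℝ), s = (N : ℝ) / (a : ℝ) →
      (κ * s) ^ (((a : ℝ) - 1) / 2) * tableWeight R C W ≥
        ∏ k, tableWeight (Rk k) (Ck k) W ^ (α k) := by
  refine ⟨Real.exp 4, Real.exp_pos _, ?_⟩
  intro m n p N hm hn W hW Rk Ck _ _ hRN hCN α hα hα1 R C hR0 hC0 hR hC a ha s hs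
  subst hs
  rcases le_total m n with hmn | hnm
  · rw [min_eq_left hmn] at ha
    subst ha
    have : Nonempty (Fin n) := ⟨⟨0, hn⟩⟩
    simp only [tableWeight_eq_tableSum]
    exact prod_tableSum_rpow_le hm hW hRN hCN hα hα1 hR0 hR hC
  · rw [min_eq_right hnm] at ha
    subst ha
    have : Nonempty (Fin m) := ⟨⟨0, hm⟩⟩
    simp only [← tableWeight_transpose _ _ W, tableWeight_eq_tableSum]
    exact prod_tableSum_rpow_le hn (fun j i => hW i j) hCN hRN hα hα1 hC0 hC hR
end

section
/- Let G=(g_{ij}) be a positive real m×n matrix and let R=(r_1,…,r_m), C=(c_1,…,c_n) be positive integer vectors with |R|=|C|=N. Then there exists an N×N block matrix B with the same block structure as A(G;R,C) (i.e., B is constant on each r_i×c_j block) such that: (1) B is doubly stochastic (B is nonnegative and all its row and column sums equal 1); (2) every entry in the (i,j)-th block of B is at most min{1/r_i, 1/c_j}; (3) per A(G;R,C) = N^{-N} · f(G;R,C)^N · (∏_{i=1}^m r_i^{r_i}) · (∏_{j=1}^n c_j^{c_j}) · per B; and (4) N!/N^N ≤ per B ≤ min{ ∏_{i=1}^m r_i!/r_i^{r_i},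 ∏_{j=1}^n c_j!/c_j^{c_j} }. -/
open scoped BigOperators

/-- The permanent of a (square, `|ι| = |κ|`) matrix, as a sum over bijections. -/
noncomputable def perm {ι κ : Type*} [Fintype ι] [Fintype κ] [DecidableEq ι] [DecidableEq κ]
    (A : Matrix ι κ ℝ) : ℝ :=
  ∑ σ : ι ≃ κ, ∏ i, A i (σ i)

/-- The `N × N` block matrix `A(G;R,C)` whose `(i,j)`-th block, of size `R i × C j`,
is filled with copies of `G i j`. Rows are indexed by `Σ i, Fin (R i)` (so there are
`∑ i, R i = N` rows) and columns by `Σ j, Fin (C j)`. -/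
def blockMat {m n : ℕ} (G : Fin m → Fin n → ℝ) (R : Fin m → ℕ) (C : Fin n → ℕ) :
    Matrix ((i : Fin m) × Fin (R i)) ((j : Fin n) × Fin (C j)) ℝ :=
  fun a b => G a.1 b.1

/-- `f(G;R,C)`: the infimum of `F(G;x,y) = ∑ i j, G i j * x i * y j` over positive
vectors `x, y` satisfying `∏ i, x i ^ R i = 1` and `∏ j, y j ^ C j = 1`. -/
noncomputable def scalingInf {m n : ℕ} (G : Fin m → Fin n → ℝ)
    (R : Fin m → ℝ) (C : Fin n → ℝ) : ℝ :=
  sInf {z : ℝ | ∃ (x : Fin m → ℝ) (y : Fin n → ℝ),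
    (∀ i, 0 < x i) ∧ (∀ j, 0 < y j) ∧
    (∏ i, x i ^ R i) = 1 ∧ (∏ j, y j ^ C j) = 1 ∧
    z = ∑ i, ∑ j, G i j * x i * y j}

section RealRooted
open Polynomial

/-- A product of factors `1 + t y` over nonnegative `y` is at most the power of its mean. -/
theorem prod_one_add_mul_le_pow_mean {ι : Type*} (s : Finset ι) (y : ι → ℝ) (hy : ∀ i ∈ s, 0 ≤ y i)
    {k : ℕ} (hk : 0 < k) (hsk : s.card ≤ k) {t : ℝ} (ht : 0 ≤ t) :
    ∏ i ∈ s, (1 + t * y i) ≤ (1 + t * (∑ i ∈ s, y i) / k) ^ k := by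
  have hk' : (0 : ℝ) < k := by exact_mod_cast hk
  have h0 : ∀ i ∈ s, 0 ≤ 1 + t * y i := fun i hi => by
    have := mul_nonneg ht (hy i hi); linarith
  have hP : 0 ≤ ∏ i ∈ s, (1 + t * y i) := Finset.prod_nonneg h0
  have hsk' : (s.card : ℝ) ≤ k := by exact_mod_cast hsk
  have amgm := Real.geom_mean_le_arith_mean_weighted (Finset.insertNone s)
    (fun o : Option ι => o.elim ((k - s.card : ℝ) / k) (fun _ => 1 / (k : ℝ)))
    (fun o : Option ι => o.elim 1 (fun i => 1 + t * y i))
    (by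
      rintro (_ | i) _
      · exact div_nonneg (by linarith) hk'.le
      · exact (one_div_pos.2 hk').le)
    (by
      simp only [Finset.sum_insertNone, Option.elim]
      rw [Finset.sum_const, nsmul_eq_mul]
      field_simp
      ring)
    (by
      rintro (_ | i) hi
      · exact zero_le_one
      · exact h0 i (by simpa using hi))
  simp only [Finset.sum_insertNone, Finset.prod_insertNone, Option.elim, Real.one_rpow, one_mul]
    at amgm
  rw [Real.finsetProd_rpow _ _ h0] at amgm
  have e : (k - s.card : ℝ) / k * 1 + ∑ i ∈ s, 1 / (k : ℝ) * (1 + t * y i)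
      = 1 + t * (∑ i ∈ s, y i) / k := by
    rw [← Finset.mul_sum, Finset.sum_add_distrib, ← Finset.mul_sum, Finset.sum_const, nsmul_eq_mul]
    field_simp
    ring
  rw [e] at amgm
  calc ∏ i ∈ s, (1 + t * y i) = ((∏ i ∈ s, (1 + t * y i)) ^ (1 / (k : ℝ))) ^ k := by
        rw [one_div, Real.rpow_inv_natCast_pow hP hk.ne']
    _ ≤ _ := pow_le_pow_left₀ (Real.rpow_nonneg hP _) amgm k

/-- A real polynomial of degree at most `k` with only negative real roots is bounded by the `k`-th
power of a linear function with the same first-order expansion at the origin. -/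
theorem eval_le_mul_pow_of_roots_neg (h : ℝ[X]) {k : ℕ} (hk : 0 < k) (hdeg : h.natDegree ≤ k)
    (h0 : 0 < h.eval 0)
    (hroots : ∀ z : ℂ, aeval z h = 0 → z.im = 0 ∧ z.re < 0) :
    0 ≤ h.derivative.eval 0 ∧ ∀ t : ℝ, 0 ≤ t →
      h.eval t ≤ h.eval 0 * (1 + t * (h.derivative.eval 0 / h.eval 0) / k) ^ k := by
  have hs : h.Splits := by
    refine Splits.of_splits_map (algebraMap ℝ ℂ) (IsAlgClosed.splits _) ?_
    intro z hz
    have hz' : aeval z h = 0 := by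
      have := (mem_roots'.1 hz).2
      rwa [IsRoot, eval_map_algebraMap] at this
    exact ⟨z.re, Complex.ext (by simp) (by simp [(hroots z hz').1])⟩
  have hneg : ∀ r ∈ h.roots, r < 0 := by
    intro r hr
    have hr' := (mem_roots'.1 hr).2
    have := (hroots (r : ℂ) (by
      have e : aeval ((algebraMap ℝ ℂ) r) h = algebraMap ℝ ℂ (h.eval r) :=
        aeval_algebraMap_apply_eq_algebraMap_eval r h
      rw [hr', map_zero] at e
      exact e)).2
    simpa using this
  have key : ∀ t : ℝ, h.eval t = h.eval 0 * (h.roots.map (fun r => 1 + t * (-r⁻¹))).prod := by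
    intro t
    rw [hs.eval_eq_prod_roots t, hs.eval_eq_prod_roots 0, mul_assoc, ← Multiset.prod_map_mul]
    congr 2
    refine Multiset.map_congr rfl fun r hr => ?_
    have := (hneg r hr).ne
    field_simp
    ring
  have hder : h.derivative.eval 0 / h.eval 0 = (h.roots.map (fun r => -r⁻¹)).sum := by
    rw [hs.eval_derivative_div_eval_of_ne_zero h0.ne']
    simp
  have conv : ∀ f : ℝ → ℝ, (h.roots.map f) = Finset.univ.val.map (fun r : h.roots => f r) := by
    intro f
    conv_lhs => rw [← Multiset.map_univ_coe h.roots, Multiset.map_map]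
    rfl
  have hpos : ∀ r : h.roots, 0 ≤ -((r : ℝ))⁻¹ := fun r =>
    neg_nonneg.2 (inv_nonpos.2 (hneg r (Multiset.coe_mem)).le)
  have hder' : h.derivative.eval 0 / h.eval 0 = ∑ r : h.roots, -((r : ℝ))⁻¹ := by
    rw [hder, conv]; rfl
  constructor
  · have : 0 ≤ h.derivative.eval 0 / h.eval 0 := by
      rw [hder']; exact Finset.sum_nonneg fun r _ => hpos r
    rwa [le_div_iff₀ h0, zero_mul] at this
  · intro t ht
    rw [key t, hder', conv]
    refine mul_le_mul_of_nonneg_left ?_ h0.le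
    refine prod_one_add_mul_le_pow_mean Finset.univ (fun r : h.roots => -((r : ℝ))⁻¹)
      (fun r _ => hpos r) hk ?_ ht
    rw [Finset.card_univ, Multiset.card_coe]
    exact (card_roots' h).trans hdeg

/-- Gurvits' univariate capacity inequality. -/
theorem mul_pow_le_eval_derivative_zero (h : ℝ[X]) (k : ℕ) (hdeg : h.natDegree ≤ k + 1)
    {γ : ℝ} (hγ : 0 < γ) (hcap : ∀ t : ℝ, 0 < t → γ * t ≤ h.eval t)
    (hroots : 0 < k → ∀ z : ℂ, aeval z h = 0 → z.im = 0 ∧ z.re < 0) :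
    γ * ((k : ℝ) / (k + 1)) ^ k ≤ h.derivative.eval 0 := by
  rcases Nat.eq_zero_or_pos k with rfl | hk
  · have e := eq_X_add_C_of_natDegree_le_one (by simpa using hdeg)
    set b := h.coeff 1
    set a := h.coeff 0
    have hb : h.derivative.eval 0 = b := by rw [e]; simp
    have hc : ∀ t : ℝ, 0 < t → γ * t ≤ b * t + a := by
      intro t ht
      have := hcap t ht
      rw [e] at this
      simpa using this
    rw [hb]
    simp only [pow_zero, mul_one]
    by_contra! hlt
    have hd : 0 < γ - b := by linarith
    have h1 := hc ((|a| + 1) / (γ - b)) (by positivity)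
    have h2 : (γ - b) * ((|a| + 1) / (γ - b)) = |a| + 1 := by field_simp
    have := le_abs_self a
    nlinarith
  · have hr := hroots hk
    have h0 : 0 < h.eval 0 := by
      have hne : h.eval 0 ≠ 0 := by
        intro h0
        have := (hr 0 (by
          have e : aeval ((algebraMap ℝ ℂ) 0) h = algebraMap ℝ ℂ (h.eval 0) :=
            aeval_algebraMap_apply_eq_algebraMap_eval 0 h
          rw [h0, map_zero] at e
          exact e)).2
        simp at this
      refine lt_of_le_of_ne ?_ hne.symm
      have hcont : Filter.Tendsto (fun t : ℝ => h.eval t - γ * t) (nhdsWithin 0 (Set.Ioi 0))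
          (nhds (h.eval 0 - γ * 0)) :=
        ((h.continuous.sub (continuous_const.mul continuous_id)).tendsto 0).mono_left
          nhdsWithin_le_nhds
      have := ge_of_tendsto hcont (b := 0) (by
        filter_upwards [self_mem_nhdsWithin] with t ht
        exact sub_nonneg.2 (hcap t ht))
      simpa using this
    obtain ⟨hd0, hb⟩ := eval_le_mul_pow_of_roots_neg h k.succ_pos hdeg h0 hr
    set a := h.eval 0
    set b := h.derivative.eval 0
    have hk' : (0 : ℝ) < k := by exact_mod_cast hk
    have hbpos : 0 < b := by
      refine lt_of_le_of_ne hd0 fun hb0 => ?_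
      have h1 := hb (2 * a / γ) (by positivity)
      have h2 := hcap (2 * a / γ) (by positivity)
      rw [← hb0] at h1
      have h3 : γ * (2 * a / γ) = 2 * a := by field_simp
      simp at h1
      linarith
    have h1 := hb ((k + 1) * a / (k * b)) (by positivity)
    have h2 := hcap ((k + 1) * a / (k * b)) (by positivity)
    have e1 : 1 + (k + 1) * a / (k * b) * (b / a) / ((k + 1 : ℕ) : ℝ) = (k + 1) / k := by
      push_cast
      field_simp
    rw [e1] at h1
    have h3 := h2.trans h1
    have e2 : a * (((k : ℝ) + 1) / k) ^ (k + 1)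
        = ((k + 1) * a / (k * b)) * (b * (((k : ℝ) + 1) / k) ^ k) := by
      rw [pow_succ]; field_simp
    rw [e2, mul_comm γ] at h3
    have h4 := le_of_mul_le_mul_left h3 (by positivity)
    calc γ * ((k : ℝ) / (k + 1)) ^ k
        ≤ b * (((k : ℝ) + 1) / k) ^ k * ((k : ℝ) / (k + 1)) ^ k := by gcongr
      _ = b := by
        rw [mul_assoc, ← mul_pow]
        have : ((k : ℝ) + 1) / k * (k / (k + 1)) = 1 := by field_simp
        rw [this, one_pow, mul_one]

end RealRooted

section Stable
open MvPolynomial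

variable {σ : Type*}

/-- The restriction of `q` to the line through `z` in the `k`-th coordinate direction. -/
noncomputable def lineRestrict [DecidableEq σ] {A : Type*} [CommRing A] [Algebra ℝ A]
    (q : MvPolynomial σ ℝ) (z : σ → A) (k : σ) : Polynomial A :=
  aeval (fun j => Polynomial.C (z j) + if j = k then Polynomial.X else 0) q

section lineRestrict
variable [DecidableEq σ] {A : Type*} [CommRing A] [Algebra ℝ A]

theorem eval_lineRestrict (q : MvPolynomial σ ℝ) (z : σ → A) (k : σ) (t : A) :
    (lineRestrict q z k).eval t = aeval (fun j => z j + if j = k then t else 0) q := by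
  have e : ((Polynomial.aeval t).restrictScalars ℝ).comp
      (aeval (fun j => Polynomial.C (z j) + if j = k then (Polynomial.X : Polynomial A) else 0))
      = (aeval (fun j => z j + if j = k then t else 0) : MvPolynomial σ ℝ →ₐ[ℝ] A) := by
    ext j
    by_cases hj : j = k <;> simp [hj]
  have := DFunLike.congr_fun e q
  simpa [lineRestrict, Polynomial.coe_aeval_eq_eval] using this

theorem derivative_lineRestrict (q : MvPolynomial σ ℝ) (z : σ → A) (k : σ) :
    (lineRestrict q z k).derivative = lineRestrict (pderiv k q) z k := by
  unfold lineRestrict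
  induction q using MvPolynomial.induction_on with
  | C a =>
    rw [pderiv_C, map_zero, aeval_C, IsScalarTower.algebraMap_apply ℝ A (Polynomial A)]
    exact Polynomial.derivative_C
  | add p q hp hq => simp only [map_add, hp, hq]
  | mul_X p j hp =>
    rw [map_mul, Polynomial.derivative_mul, hp, pderiv_mul, map_add, map_mul, map_mul, aeval_X,
      pderiv_X]
    congr 2
    by_cases hj : j = k
    · subst hj; simp
    · simp [hj]

theorem natDegree_lineRestrict_le {q : MvPolynomial σ ℝ} {d : ℕ} (hq : q.IsHomogeneous d)
    (z : σ → A) (k : σ) : (lineRestrict q z k).natDegree ≤ d := by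
  nontriviality A
  have e : lineRestrict q z k = aeval (fun j => Polynomial.C (z j) +
      if j = k then (Polynomial.X : Polynomial A) else 0) (map (algebraMap ℝ A) q) := by
    rw [aeval_map_algebraMap, lineRestrict]
  rw [e, ← mul_one d]
  refine aeval_natDegree_le _ ?_ _ fun j => ?_
  · exact (hq.map _).totalDegree_le
  · split_ifs
    · rw [add_comm]; exact (Polynomial.natDegree_X_add_C _).le
    · simp

end lineRestrict

theorem aeval_const_mul_of_isHomogeneous {A : Type*} [CommRing A] [Algebra ℝ A]
    {q : MvPolynomial σ ℝ} {d : ℕ} (hq : q.IsHomogeneous d) (c : A) (z : σ → A) :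
    aeval (fun j => c * z j) q = c ^ d * aeval z q := by
  rw [aeval_def, aeval_def, eval₂_eq, eval₂_eq, Finset.mul_sum]
  refine Finset.sum_congr rfl fun m hm => ?_
  have hd : ∑ i ∈ m.support, m i = d := by
    rw [← hq.degree_eq_sum_deg_support hm]
  rw [← hd, ← Finset.prod_pow_eq_pow_sum]
  simp_rw [mul_pow]
  rw [Finset.prod_mul_distrib]
  ring

/-- Nonvanishing on vectors in the closed right half-plane with at least one coordinate in the
open right half-plane. -/
def HalfPlaneStable (q : MvPolynomial σ ℝ) : Prop :=
  ∀ z : σ → ℂ, (∀ j, 0 ≤ (z j).re) → (∃ j, 0 < (z j).re) → aeval z q ≠ 0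

theorem HalfPlaneStable.pderiv {q : MvPolynomial σ ℝ} {d : ℕ} (hq : q.IsHomogeneous (d + 1))
    (hs : HalfPlaneStable q) (k : σ) : HalfPlaneStable (pderiv k q) := by
  classical
  intro z hz hz' h0
  set f := lineRestrict q z k with hf
  have hroots : ∀ t ∈ f.rootSet ℂ, t.re < 0 := by
    intro t ht
    by_contra! hre
    have := (Polynomial.mem_rootSet.1 ht).2
    rw [Polynomial.coe_aeval_eq_eval, eval_lineRestrict] at this
    refine hs _ (fun j => ?_) ?_ this
    · have := hz j
      split_ifs <;> simp <;> linarith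
    · obtain ⟨j, hj⟩ := hz'
      refine ⟨j, ?_⟩
      split_ifs <;> simp <;> linarith
  have hder : f.derivative.eval 0 = 0 := by
    rw [hf, derivative_lineRestrict, eval_lineRestrict]
    simpa using h0
  have hek : aeval (fun j => if j = k then (1 : ℂ) else 0) q ≠ 0 :=
    hs _ (fun j => by split_ifs <;> simp) ⟨k, by simp⟩
  by_cases hdeg : 0 < f.degree
  · have hd0 : f.derivative ≠ 0 := fun h => by
      have := Polynomial.derivative_eq_zero.1 h
      exact absurd (Polynomial.natDegree_pos_iff_degree_pos.2 hdeg) (by omega)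
    have hmem : (0 : ℂ) ∈ f.derivative.rootSet ℂ :=
      Polynomial.mem_rootSet.2 ⟨hd0, by simpa using hder⟩
    have hc := Polynomial.rootSet_derivative_subset_convexHull_rootSet hdeg hmem
    have hconv : Convex ℝ {t : ℂ | t.re < 0} := convex_halfSpace_re_lt 0
    have := convexHull_min (fun t ht => hroots t ht) hconv hc
    exact absurd (show (0 : ℂ).re < 0 from this) (by simp)
  · have hfc := Polynomial.eq_C_of_degree_le_zero (not_lt.1 hdeg)
    set c := f.coeff 0
    let g : Polynomial ℂ := aeval (fun j => Polynomial.C (z j) * Polynomial.X +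
      if j = k then (1 : Polynomial ℂ) else 0) q
    have hg : ∀ s : ℂ, g.eval s = aeval (fun j => z j * s + if j = k then 1 else 0) q := by
      intro s
      have e : ((Polynomial.aeval s).restrictScalars ℝ).comp
          (aeval (fun j => Polynomial.C (z j) * Polynomial.X +
            if j = k then (1 : Polynomial ℂ) else 0))
          = (aeval (fun j => z j * s + if j = k then 1 else 0) : MvPolynomial σ ℝ →ₐ[ℝ] ℂ) := by
        ext j
        by_cases hj : j = k <;> simp [hj]
      have := DFunLike.congr_fun e q
      simpa [g, Polynomial.coe_aeval_eq_eval] using this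
    have hgc : g = Polynomial.C c * Polynomial.X ^ (d + 1) := by
      refine Polynomial.eq_of_infinite_eval_eq _ _ (Set.Infinite.mono (s := {0}ᶜ) ?_
        (Set.finite_singleton (0 : ℂ)).infinite_compl)
      intro s hs0
      have hs0 : s ≠ 0 := hs0
      have h1 : f.eval s⁻¹ = c := by rw [hfc]; simp
      rw [hf, eval_lineRestrict] at h1
      change g.eval s = _
      simp only [hg, Polynomial.eval_mul, Polynomial.eval_C,
        Polynomial.eval_pow, Polynomial.eval_X]
      rw [← h1, mul_comm, ← aeval_const_mul_of_isHomogeneous hq]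
      congr 2
      funext j
      split_ifs
      · field_simp
      · ring
    apply hek
    have := hg 0
    rw [hgc] at this
    simpa using this.symm

/-- On nonnegative nonzero real vectors, a stable homogeneous polynomial has only negative real
roots along coordinate directions. -/
theorem HalfPlaneStable.roots_lineRestrict [DecidableEq σ] {q : MvPolynomial σ ℝ} {d : ℕ}
    (hq : q.IsHomogeneous d) (hs : HalfPlaneStable q) (k : σ) {x : σ → ℝ} (hx : ∀ j, 0 ≤ x j)
    (hx' : ∃ j, 0 < x j) (t : ℂ) (ht : Polynomial.aeval t (lineRestrict q x k) = 0) :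
    t.im = 0 ∧ t.re < 0 := by
  have e : ((Polynomial.aeval t).restrictScalars ℝ).comp
      (aeval (fun j => Polynomial.C (x j) + if j = k then (Polynomial.X : Polynomial ℝ) else 0))
      = (aeval (fun j => (x j : ℂ) + if j = k then t else 0) : MvPolynomial σ ℝ →ₐ[ℝ] ℂ) := by
    ext j
    by_cases hj : j = k <;> simp [hj]
  have e' : aeval (fun j => (x j : ℂ) + if j = k then t else 0) q = 0 := by
    have := DFunLike.congr_fun e q
    rw [← this]
    simpa [lineRestrict] using ht
  by_contra hcon
  by_cases ht0 : t = 0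
  · refine hs (fun j => (x j : ℂ)) (fun j => by simpa using hx j) (by simpa using hx') ?_
    simpa [ht0] using e'
  have hslit : t ∈ Complex.slitPlane := by
    rw [Complex.mem_slitPlane_iff]
    by_contra! h
    refine hcon ⟨h.2, lt_of_le_of_ne h.1 fun h3 => ht0 (Complex.ext h3 h.2)⟩
  set u : ℂ := Complex.exp (Complex.log t / 2) with hu
  have hu2 : u * u = t := by
    rw [hu, ← Complex.exp_add, add_halves, Complex.exp_log ht0]
  have hure : 0 < u.re := by
    rw [hu, Complex.exp_re]
    refine mul_pos (Real.exp_pos _) (Real.cos_pos_of_mem_Ioo ?_)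
    have h1 := Complex.neg_pi_lt_log_im t
    have h2 : (Complex.log t).im < Real.pi := by
      rw [Complex.log_im]
      exact lt_of_le_of_ne (Complex.arg_le_pi t) (Complex.mem_slitPlane_iff_arg.1 hslit).1
    have h3 : (Complex.log t / 2).im = (Complex.log t).im / 2 := by
      simp
    rw [h3]
    constructor <;> linarith
  have hu0 : u ≠ 0 := fun h => by rw [h] at hure; simp at hure
  have hiure : 0 < (u⁻¹).re := by
    rw [Complex.inv_re]
    exact div_pos hure (Complex.normSq_pos.2 hu0)
  have e1 : ∀ j, u⁻¹ * ((x j : ℂ) + if j = k then t else 0)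
      = u⁻¹ * (x j : ℂ) + if j = k then u else 0 := by
    intro j
    split_ifs
    · rw [← hu2]; field_simp
    · ring
  refine hs (fun j => u⁻¹ * ((x j : ℂ) + if j = k then t else 0)) (fun j => ?_) ?_ ?_
  · rw [e1]
    have : 0 ≤ (u⁻¹ * (x j : ℂ)).re := by
      rw [Complex.re_mul_ofReal]; exact mul_nonneg hiure.le (hx j)
    split_ifs
    · rw [Complex.add_re]; linarith
    · simpa using this
  · obtain ⟨j, hj⟩ := hx'
    refine ⟨j, ?_⟩
    rw [e1]
    have : 0 < (u⁻¹ * (x j : ℂ)).re := by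
      rw [Complex.re_mul_ofReal]; exact mul_pos hiure hj
    split_ifs
    · rw [Complex.add_re]; linarith
    · simpa using this
  · rw [aeval_const_mul_of_isHomogeneous hq, e', mul_zero]

end Stable

section Capacity
open MvPolynomial

/-- Gurvits' capacity bound for the square-free coefficient of a stable homogeneous polynomial. -/
theorem HalfPlaneStable.capacity_le_coeff {σ : Type*} [DecidableEq σ] (S : Finset σ) :
    ∀ (q : MvPolynomial σ ℝ) (γ : ℝ), q.IsHomogeneous S.card → HalfPlaneStable q → 0 < γ →
      (∀ x : σ → ℝ, (∀ j ∈ S, 0 < x j) → (∀ j ∉ S, x j = 0) → γ * ∏ j ∈ S, x j ≤ eval x q) →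
      γ * ((S.card.factorial : ℝ) / (S.card : ℝ) ^ S.card)
        ≤ coeff (∑ j ∈ S, Finsupp.single j 1) q := by
  induction S using Finset.induction_on with
  | empty =>
    intro q γ hq _ _ hcap
    have h1 := hcap (fun _ => 0) (by simp) (by simp)
    have h2 : eval (fun _ : σ => (0 : ℝ)) q = constantCoeff q :=
      congrArg (fun f : MvPolynomial σ ℝ →+* ℝ => f q) eval_zero'
    rw [h2] at h1
    simpa [constantCoeff_eq] using h1
  | insert k S hk ih =>
    intro q γ hq hs hγ hcap
    have hcard : (insert k S).card = S.card + 1 := Finset.card_insert_of_notMem hk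
    rw [hcard] at hq ⊢
    have hq' : (MvPolynomial.pderiv k q).IsHomogeneous S.card := by simpa using hq.pderiv (i := k)
    have hfac : (0 : ℝ) < ((S.card : ℝ) / (S.card + 1)) ^ S.card := by
      rcases Nat.eq_zero_or_pos S.card with h | h
      · simp [h]
      · positivity
    have hstep := ih (MvPolynomial.pderiv k q) (γ * ((S.card : ℝ) / (S.card + 1)) ^ S.card) hq'
      (hs.pderiv hq k) (mul_pos hγ hfac) ?_
    · rw [coeff_pderiv] at hstep
      have h0 : (∑ j ∈ S, Finsupp.single j 1 : σ →₀ ℕ) k = 0 := by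
        rw [Finsupp.finsetSum_apply]
        refine Finset.sum_eq_zero fun j hj => ?_
        rw [Finsupp.single_apply, if_neg]
        rintro rfl
        exact hk hj
      rw [h0, Nat.cast_zero, zero_add, mul_one] at hstep
      rw [Finset.sum_insert hk, add_comm (Finsupp.single k 1)]
      refine le_trans (le_of_eq ?_) hstep
      rw [mul_assoc, Nat.factorial_succ, div_pow, pow_succ]
      push_cast
      rcases Nat.eq_zero_or_pos S.card with h | h
      · simp [h]
      · field_simp
    · intro x hx hx0
      have hpos : 0 < ∏ j ∈ S, x j := Finset.prod_pos hx
      have hxk := hx0 k hk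
      have hxn : ∀ j, 0 ≤ x j := fun j => by
        by_cases hj : j ∈ S
        · exact (hx j hj).le
        · exact (hx0 j hj).ge
      have key := mul_pow_le_eval_derivative_zero (lineRestrict q x k) S.card
        (natDegree_lineRestrict_le hq x k) (mul_pos hγ hpos) ?_ ?_
      · rw [derivative_lineRestrict, eval_lineRestrict] at key
        simp only [ite_self, add_zero] at key
        rw [aeval_eq_eval] at key
        refine le_trans (le_of_eq ?_) key
        ring
      · intro t ht
        rw [eval_lineRestrict, aeval_eq_eval]
        have := hcap (fun j => x j + if j = k then t else 0) ?_ ?_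
        · rw [Finset.prod_insert hk, if_pos rfl, hxk, zero_add] at this
          rw [Finset.prod_congr rfl (g := x)] at this
          · refine le_trans (le_of_eq ?_) this
            ring
          · intro j hj
            rw [if_neg, add_zero]
            rintro rfl
            exact hk hj
        · intro j hj
          rcases Finset.mem_insert.1 hj with rfl | hj
          · simp [hxk, ht]
          · have := hx j hj
            split_ifs <;> linarith
        · intro j hj
          rw [Finset.mem_insert, not_or] at hj
          simp [hj.1, hx0 j hj.2]
      · intro hS z hz
        obtain ⟨j, hj⟩ := Finset.card_pos.1 hS
        exact hs.roots_lineRestrict hq k hxn ⟨j, hx j hj⟩ z hz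

variable {ι κ : Type*} [Fintype ι] [Fintype κ]

/-- The product of the linear forms given by the rows of `B`. -/
noncomputable def rowProduct (B : Matrix ι κ ℝ) : MvPolynomial κ ℝ :=
  ∏ i, ∑ j, C (B i j) * X j

theorem isHomogeneous_rowProduct (B : Matrix ι κ ℝ) :
    (rowProduct B).IsHomogeneous (Fintype.card ι) := by
  have := IsHomogeneous.prod Finset.univ (fun i => ∑ j, C (B i j) * X j) (fun _ : ι => 1)
    (fun i _ => IsHomogeneous.sum Finset.univ _ 1 fun j _ => isHomogeneous_C_mul_X (B i j) j)
  simpa [rowProduct] using this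

theorem halfPlaneStable_rowProduct {B : Matrix ι κ ℝ} (hB : ∀ i j, 0 < B i j) :
    HalfPlaneStable (rowProduct B) := by
  rintro z hz ⟨k, hk⟩
  rw [rowProduct, map_prod, Finset.prod_ne_zero_iff]
  intro i _ h
  have hre : 0 < (aeval z (∑ j, C (B i j) * X j : MvPolynomial κ ℝ)).re := by
    simp only [map_sum, map_mul, aeval_C, aeval_X, Complex.coe_algebraMap, Complex.re_sum,
      Complex.re_ofReal_mul]
    exact Finset.sum_pos' (fun j _ => mul_nonneg (hB i j).le (hz j))
      ⟨k, Finset.mem_univ k, mul_pos (hB i k) hk⟩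
  rw [h] at hre
  simp at hre

theorem coeff_rowProduct [DecidableEq ι] [DecidableEq κ] (B : Matrix ι κ ℝ)
    (hcard : Fintype.card ι = Fintype.card κ) :
    coeff (∑ j, Finsupp.single j 1) (rowProduct B) = perm B := by
  rw [rowProduct, Finset.prod_univ_sum, coeff_sum]
  have hterm : ∀ f : ι → κ, coeff (∑ j, Finsupp.single j 1)
      (∏ i, C (B i (f i)) * X (f i) : MvPolynomial κ ℝ)
      = if Function.Bijective f then ∏ i, B i (f i) else 0 := by
    intro f
    have e : (∏ i, C (B i (f i)) * X (f i) : MvPolynomial κ ℝ)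
        = monomial (∑ i, Finsupp.single (f i) 1) (∏ i, B i (f i)) := by
      rw [monomial_sum_index]
      simp only [Finset.prod_mul_distrib, map_prod]
      rfl
    rw [e, coeff_monomial]
    congr 1
    rw [eq_iff_iff]
    constructor
    · intro h
      rw [Fintype.bijective_iff_surjective_and_card]
      refine ⟨fun k => ?_, hcard⟩
      by_contra! hk
      have h1 := DFunLike.congr_fun h k
      rw [Finsupp.finsetSum_apply, Finsupp.finsetSum_apply] at h1
      simp [Finsupp.single_apply, hk] at h1
    · intro h
      exact (Equiv.ofBijective f h).sum_comp (fun j => Finsupp.single j 1)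
  rw [Finset.sum_congr rfl fun f _ => hterm f, Fintype.piFinset_univ, ← Finset.sum_filter, perm]
  refine Finset.sum_bij' (fun f hf => Equiv.ofBijective f (Finset.mem_filter.1 hf).2)
    (fun σ _ => σ) ?_ ?_ ?_ ?_ ?_
  · simp
  · intro σ _; simp
  · intros; rfl
  · intros; ext; rfl
  · intros; rfl

theorem prod_le_eval_rowProduct {B : Matrix ι κ ℝ} (hB : ∀ i j, 0 ≤ B i j)
    (hrow : ∀ i, ∑ j, B i j = 1) (hcol : ∀ j, ∑ i, B i j = 1) {x : κ → ℝ} (hx : ∀ j, 0 < x j) :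
    ∏ j, x j ≤ eval x (rowProduct B) := by
  calc ∏ j, x j = ∏ i, ∏ j, x j ^ B i j := by
        rw [Finset.prod_comm]
        refine Finset.prod_congr rfl fun j _ => ?_
        rw [← Real.rpow_sum_of_pos (hx j), hcol, Real.rpow_one]
    _ ≤ ∏ i, ∑ j, B i j * x j := by
        refine Finset.prod_le_prod
          (fun i _ => Finset.prod_nonneg fun j _ => Real.rpow_nonneg (hx j).le _) fun i _ => ?_
        exact Real.geom_mean_le_arith_mean_weighted _ _ _ (fun j _ => hB i j) (hrow i)
          fun j _ => (hx j).le
    _ = eval x (rowProduct B) := by simp [rowProduct, map_prod]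

/-- The van der Waerden bound for positive doubly stochastic matrices. -/
theorem factorial_div_pow_le_perm [DecidableEq ι] [DecidableEq κ] {B : Matrix ι κ ℝ}
    (hB : ∀ i j, 0 < B i j) (hrow : ∀ i, ∑ j, B i j = 1) (hcol : ∀ j, ∑ i, B i j = 1)
    (hcard : Fintype.card ι = Fintype.card κ) :
    ((Fintype.card κ).factorial : ℝ) / (Fintype.card κ : ℝ) ^ Fintype.card κ ≤ perm B := by
  have := HalfPlaneStable.capacity_le_coeff (Finset.univ : Finset κ) (rowProduct B) 1
    (by rw [Finset.card_univ, ← hcard]; exact isHomogeneous_rowProduct B)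
    (halfPlaneStable_rowProduct hB) one_pos (fun x hx _ => by
      rw [one_mul]
      exact prod_le_eval_rowProduct (fun i j => (hB i j).le) hrow hcol
        fun j => hx j (Finset.mem_univ j))
  rwa [coeff_rowProduct B hcard, one_mul, Finset.card_univ] at this

end Capacity

section UpperBound

theorem card_perm_preserving_fst {n : ℕ} (c : Fin n → ℕ) :
    Fintype.card {g : Equiv.Perm ((j : Fin n) × Fin (c j)) // Sigma.fst ∘ g = Sigma.fst}
      = ∏ j, (c j).factorial := by
  classical
  rw [DomMulAct.stabilizer_card]
  refine Finset.prod_congr rfl fun j _ => ?_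
  rw [Fintype.card_congr (Equiv.sigmaSubtype j), Fintype.card_fin]

/-- The permanent of a row-stochastic matrix that is constant on column blocks of sizes `c j` is at
most `∏ j, (c j)! / (c j) ^ (c j)`. -/
theorem perm_le_prod_factorial_div_pow {ι : Type*} [Fintype ι] [DecidableEq ι] {n : ℕ}
    {c : Fin n → ℕ} (b : ι → Fin n → ℝ) (hb : ∀ i j, 0 ≤ b i j)
    (hrow : ∀ i, ∑ k : (j : Fin n) × Fin (c j), b i k.1 = 1) :
    perm (fun i (k : (j : Fin n) × Fin (c j)) => b i k.1)
      ≤ ∏ j, ((c j).factorial : ℝ) / (c j : ℝ) ^ (c j) := by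
  classical
  let κ := (j : Fin n) × Fin (c j)
  let H := ∀ j, Fin (c j) → Fin (c j)
  let F : (ι ≃ κ) × H → (ι → κ) := fun p i => ⟨(p.1 i).1, p.2 _ (p.1 i).2⟩
  let w : (ι → κ) → ℝ := fun f => ∏ i, b i (f i).1
  have hw : ∀ f, 0 ≤ w f := fun f => Finset.prod_nonneg fun i _ => hb _ _
  have hcardH : (Fintype.card H : ℝ) = ∏ j, (c j : ℝ) ^ (c j) := by
    simp [H, Fintype.card_pi]
  have htotal : ∑ f, w f = 1 := by
    have := Finset.prod_univ_sum (fun _ : ι => (Finset.univ : Finset κ)) (fun i k => b i k.1)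
    rw [Fintype.piFinset_univ] at this
    simp only [w]
    rw [← this]
    exact Finset.prod_eq_one fun i _ => hrow i
  have hfiber : ∀ f, (Finset.univ.filter fun p => F p = f).card ≤ ∏ j, (c j).factorial := by
    intro f
    rcases (Finset.univ.filter fun p => F p = f).eq_empty_or_nonempty with h | ⟨p₀, hp₀⟩
    · simp [h]
    have hp₀ := (Finset.mem_filter.1 hp₀).2
    rw [← card_perm_preserving_fst, ← Fintype.card_coe]
    refine Fintype.card_le_of_injective
      (fun p => ⟨p₀.1.symm.trans p.1.1, ?_⟩) ?_
    · funext k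
      have h1 := congrFun (Finset.mem_filter.1 p.2).2 (p₀.1.symm k)
      have h2 := congrFun hp₀ (p₀.1.symm k)
      have h3 := congrArg Sigma.fst (h1.trans h2.symm)
      simpa [F] using h3
    · rintro ⟨⟨s, h⟩, hp⟩ ⟨⟨s', h'⟩, hp'⟩ e
      have hp := (Finset.mem_filter.1 hp).2
      have hp' := (Finset.mem_filter.1 hp').2
      have e1 : s = s' := by
        ext1 i
        have := DFunLike.congr_fun (Subtype.ext_iff.1 e) (p₀.1 i)
        simpa using this
      subst e1
      have e2 : h = h' := by
        funext j a
        have := congrFun (hp.trans hp'.symm) (s.symm ⟨j, a⟩)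
        simp only [F] at this
        rw [Equiv.apply_symm_apply] at this
        exact eq_of_heq (Sigma.mk.inj_iff.1 this).2
      subst e2
      rfl
  have hsum : perm (fun i (k : κ) => b i k.1) * ∏ j, (c j : ℝ) ^ (c j)
      ≤ ∏ j, ((c j).factorial : ℝ) := by
    calc perm (fun i (k : κ) => b i k.1) * ∏ j, (c j : ℝ) ^ (c j)
        = ∑ p : (ι ≃ κ) × H, w (F p) := by
          unfold perm
          rw [Fintype.sum_prod_type, Finset.sum_mul]
          refine Finset.sum_congr rfl fun s _ => ?_
          simp only [w, F]
          rw [Finset.sum_const, Finset.card_univ, nsmul_eq_mul, hcardH, mul_comm]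
      _ = ∑ f, (Finset.univ.filter fun p => F p = f).card * w f := by
          rw [← Finset.sum_fiberwise (g := F)]
          refine Finset.sum_congr rfl fun f _ => ?_
          rw [Finset.sum_congr rfl (g := fun _ => w f)
            (fun p hp => by rw [(Finset.mem_filter.1 hp).2]), Finset.sum_const, nsmul_eq_mul]
      _ ≤ ∑ f, (∏ j, ((c j).factorial : ℝ)) * w f := by
          refine Finset.sum_le_sum fun f _ => mul_le_mul_of_nonneg_right ?_ (hw f)
          exact_mod_cast hfiber f
      _ = _ := by rw [← Finset.mul_sum, htotal, mul_one]
  rw [Finset.prod_div_distrib, le_div_iff₀]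
  · exact hsum
  · refine Finset.prod_pos fun j _ => ?_
    rcases Nat.eq_zero_or_pos (c j) with h | h
    · simp [h]
    · positivity

theorem perm_transpose {ι κ : Type*} [Fintype ι] [Fintype κ] [DecidableEq ι] [DecidableEq κ]
    (A : Matrix ι κ ℝ) : perm A.transpose = perm A := by
  refine Finset.sum_equiv (Equiv.symmEquiv _ _) (by simp) fun s _ => ?_
  rw [← Equiv.prod_comp s]
  simp [Matrix.transpose, Equiv.symmEquiv]

end UpperBound

section Scaling

/-- Fermat's condition for `a * exp (p * t) + b * exp (-q * t)` at the origin. -/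
theorem mul_eq_mul_of_forall_le_exp {a b p q : ℝ}
    (h : ∀ t : ℝ, a + b ≤ a * Real.exp (p * t) + b * Real.exp (-q * t)) : a * p = b * q := by
  have hd : HasDerivAt (fun t : ℝ => a * Real.exp (p * t) + b * Real.exp (-q * t))
      (a * p - b * q) 0 := by
    have h1 : HasDerivAt (fun t : ℝ => p * t) p 0 := by
      simpa using (hasDerivAt_id (0 : ℝ)).const_mul p
    have h2 : HasDerivAt (fun t : ℝ => -q * t) (-q) 0 := by
      simpa using (hasDerivAt_id (0 : ℝ)).const_mul (-q)
    refine ((h1.exp.const_mul a).add (h2.exp.const_mul b)).congr_deriv ?_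
    simp
    ring
  have hmin : IsLocalMin (fun t : ℝ => a * Real.exp (p * t) + b * Real.exp (-q * t)) 0 :=
    Filter.Eventually.of_forall fun t => by simpa using h t
  linarith [hmin.hasDerivAt_eq_zero hd]

/-- At a minimum of `∑ i, a i * exp (d i)` over the hyperplane `∑ i, r i * d i = 0`, the
coefficients are proportional to the weights. -/
theorem eq_mul_of_forall_sum_le_sum_exp {ι : Type*} [Fintype ι] {a r : ι → ℝ}
    (h : ∀ d : ι → ℝ, ∑ i, r i * d i = 0 → ∑ i, a i ≤ ∑ i, a i * Real.exp (d i))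
    (i : ι) : a i * ∑ k, r k = (∑ k, a k) * r i := by
  classical
  have key : ∀ k, a i * r k = a k * r i := by
    intro k
    rcases eq_or_ne i k with rfl | hik
    · rfl
    refine mul_eq_mul_of_forall_le_exp fun t => ?_
    let d : ι → ℝ := fun l => if l = i then r k * t else if l = k then -r i * t else 0
    have hd : ∑ l, r l * d l = 0 := by
      rw [Finset.sum_eq_add i k hik]
      · simp [d, hik.symm]; ring
      · rintro l - ⟨h1, h2⟩
        simp [d, h1, h2]
      · simp
      · simp
    have h1 := h d hd
    have h2 : ∑ l, (a l * Real.exp (d l) - a l)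
        = (a i * Real.exp (r k * t) - a i) + (a k * Real.exp (-r i * t) - a k) := by
      rw [Finset.sum_eq_add i k hik]
      · simp [d, hik.symm]
      · rintro l - ⟨h1, h2⟩
        simp [d, h1, h2]
      · simp
      · simp
    rw [Finset.sum_sub_distrib] at h2
    linarith
  rw [Finset.mul_sum, Finset.sum_mul]
  exact Finset.sum_congr rfl fun k _ => key k

theorem le_of_forall_add_le_of_sum_mul_eq_zero {κ : Type*} [Fintype κ] [Nonempty κ] {c v : κ → ℝ}
    (hc : ∀ j, 0 < c j) (hv : ∑ j, c j * v j = 0) {t K : ℝ} (h : ∀ j, t + v j ≤ K) : t ≤ K := by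
  by_contra! hlt
  have h1 : ∑ j, c j * v j < 0 :=
    Finset.sum_neg (fun j _ => mul_neg_of_pos_of_neg (hc j) (by linarith [h j]))
      Finset.univ_nonempty
  linarith

theorem le_of_forall_le_of_sum_mul_eq_zero {ι : Type*} [Fintype ι] {r u : ι → ℝ}
    (hr : ∀ i, 0 < r i) (hu : ∑ i, r i * u i = 0) {K : ℝ} (h : ∀ i, u i ≤ K) (i : ι) :
    -((∑ k, r k) * K) / r i + K ≤ u i := by
  have h1 : r i * (K - u i) ≤ ∑ k, r k * (K - u k) :=
    Finset.single_le_sum (f := fun k => r k * (K - u k))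
      (fun k _ => mul_nonneg (hr k).le (sub_nonneg.2 (h k))) (Finset.mem_univ i)
  have h2 : ∑ k, r k * (K - u k) = (∑ k, r k) * K := by
    simp only [mul_sub, Finset.sum_sub_distrib, hu, sub_zero, Finset.sum_mul]
  have h3 : K - u i ≤ ((∑ k, r k) * K) / r i := by
    rw [le_div_iff₀ (hr i), mul_comm]
    linarith
  rw [neg_div]
  linarith

/-- A positive biadditive exponential sum attains its minimum on the product of two weighted
hyperplanes. -/
theorem exists_forall_sum_mul_exp_le {ι κ : Type*} [Fintype ι] [Fintype κ] [Nonempty ι] [Nonempty κ]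
    {G : ι → κ → ℝ} (hG : ∀ i j, 0 < G i j) {r : ι → ℝ} {c : κ → ℝ}
    (hr : ∀ i, 0 < r i) (hc : ∀ j, 0 < c j) :
    ∃ (u : ι → ℝ) (v : κ → ℝ), ∑ i, r i * u i = 0 ∧ ∑ j, c j * v j = 0 ∧
      ∀ (u' : ι → ℝ) (v' : κ → ℝ), ∑ i, r i * u' i = 0 → ∑ j, c j * v' j = 0 →
        ∑ i, ∑ j, G i j * Real.exp (u i + v j) ≤ ∑ i, ∑ j, G i j * Real.exp (u' i + v' j) := by
  classical
  let F : (ι → ℝ) × (κ → ℝ) → ℝ := fun p => ∑ i, ∑ j, G i j * Real.exp (p.1 i + p.2 j)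
  have hF : Continuous F := by fun_prop
  let S : Set ((ι → ℝ) × (κ → ℝ)) :=
    {p | ∑ i, r i * p.1 i = 0} ∩ {p | ∑ j, c j * p.2 j = 0} ∩ {p | F p ≤ F 0}
  have hSclosed : IsClosed S := by
    refine (IsClosed.inter ?_ ?_).inter ?_
    · exact isClosed_eq (by fun_prop) continuous_const
    · exact isClosed_eq (by fun_prop) continuous_const
    · exact isClosed_le hF continuous_const
  let K : ℝ := ∑ i, ∑ j, |Real.log (F 0 / G i j)|
  have hK : ∀ p ∈ S, ∀ i j, p.1 i + p.2 j ≤ K := by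
    rintro p ⟨-, hp⟩ i j
    have h1 : G i j * Real.exp (p.1 i + p.2 j) ≤ F 0 := by
      refine le_trans ?_ hp
      have hpos : ∀ i j, 0 ≤ G i j * Real.exp (p.1 i + p.2 j) := fun i j =>
        mul_nonneg (hG i j).le (Real.exp_pos _).le
      calc _ ≤ ∑ j, G i j * Real.exp (p.1 i + p.2 j) :=
            Finset.single_le_sum (f := fun j => G i j * Real.exp (p.1 i + p.2 j))
              (fun j _ => hpos i j) (Finset.mem_univ j)
        _ ≤ _ := Finset.single_le_sum (f := fun i => ∑ j, G i j * Real.exp (p.1 i + p.2 j))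
              (fun i _ => Finset.sum_nonneg fun j _ => hpos i j) (Finset.mem_univ i)
    have h2 : Real.exp (p.1 i + p.2 j) ≤ F 0 / G i j := by
      rw [le_div_iff₀ (hG i j), mul_comm]
      exact h1
    calc p.1 i + p.2 j ≤ Real.log (F 0 / G i j) :=
          (Real.le_log_iff_exp_le ((Real.exp_pos _).trans_le h2)).2 h2
      _ ≤ |Real.log (F 0 / G i j)| := le_abs_self _
      _ ≤ ∑ j, |Real.log (F 0 / G i j)| :=
            Finset.single_le_sum (f := fun j => |Real.log (F 0 / G i j)|)
              (fun j _ => abs_nonneg _) (Finset.mem_univ j)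
      _ ≤ K := Finset.single_le_sum (f := fun i => ∑ j, |Real.log (F 0 / G i j)|)
              (fun i _ => Finset.sum_nonneg fun j _ => abs_nonneg _) (Finset.mem_univ i)
  have hKu : ∀ p ∈ S, ∀ i, p.1 i ≤ K := fun p hp i =>
    le_of_forall_add_le_of_sum_mul_eq_zero hc hp.1.2 (hK p hp i)
  have hKv : ∀ p ∈ S, ∀ j, p.2 j ≤ K := fun p hp j =>
    le_of_forall_add_le_of_sum_mul_eq_zero hr hp.1.1 fun i => by
      rw [add_comm]
      exact hK p hp i j
  have hScompact : IsCompact S := by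
    refine (isCompact_Icc (a := ((fun i => -((∑ k, r k) * K) / r i + K,
      fun j => -((∑ k, c k) * K) / c j + K) : (ι → ℝ) × (κ → ℝ)))
      (b := (fun _ => K, fun _ => K))).of_isClosed_subset hSclosed fun p hp => ⟨⟨?_, ?_⟩, ?_, ?_⟩
    · exact fun i => le_of_forall_le_of_sum_mul_eq_zero hr hp.1.1 (hKu p hp) i
    · exact fun j => le_of_forall_le_of_sum_mul_eq_zero hc hp.1.2 (hKv p hp) j
    · exact hKu p hp
    · exact hKv p hp
  have h0 : (0 : (ι → ℝ) × (κ → ℝ)) ∈ S := ⟨⟨by simp, by simp⟩, le_refl (F 0)⟩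
  obtain ⟨p, hp, hmin⟩ := hScompact.exists_isMinOn ⟨0, h0⟩ hF.continuousOn
  refine ⟨p.1, p.2, hp.1.1, hp.1.2, fun u' v' hu' hv' => ?_⟩
  by_cases h : F (u', v') ≤ F 0
  · exact hmin (show (u', v') ∈ S from ⟨⟨hu', hv'⟩, h⟩)
  · exact (hmin h0).trans (not_le.1 h).le

theorem prod_exp_rpow {ι : Type*} [Fintype ι] (r u : ι → ℝ) :
    ∏ i, Real.exp (u i) ^ r i = Real.exp (∑ i, r i * u i) := by
  rw [Real.exp_sum]
  exact Finset.prod_congr rfl fun i _ => by rw [← Real.exp_mul, mul_comm]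

/-- Sinkhorn scaling: a positive matrix can be scaled to prescribed positive row and column sums,
and the scaling factors, suitably normalised, attain `scalingInf`. -/
theorem exists_scaling {m n : ℕ} {G : Fin m → Fin n → ℝ} (hG : ∀ i j, 0 < G i j)
    {R : Fin m → ℝ} {C : Fin n → ℝ} (hR : ∀ i, 0 < R i) (hC : ∀ j, 0 < C j)
    (hRC : ∑ i, R i = ∑ j, C j) :
    ∃ (l : ℝ) (x : Fin m → ℝ) (y : Fin n → ℝ), 0 < l ∧ (∀ i, 0 < x i) ∧ (∀ j, 0 < y j) ∧
      ∏ i, x i ^ R i = 1 ∧ ∏ j, y j ^ C j = 1 ∧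
      (∀ i, ∑ j, G i j * x i * y j = l * R i) ∧ (∀ j, ∑ i, G i j * x i * y j = l * C j) ∧
      scalingInf G R C = l * ∑ i, R i := by
  rcases isEmpty_or_nonempty (Fin m) with hm | hm
  · have hn : IsEmpty (Fin n) := by
      by_contra hn
      rw [not_isEmpty_iff] at hn
      have := Finset.sum_pos (fun j _ => hC j) Finset.univ_nonempty
      simp [← hRC] at this
    refine ⟨1, fun _ => 1, fun _ => 1, one_pos, by simp, by simp, by simp, by simp,
      fun i => hm.elim i, fun j => hn.elim j, ?_⟩
    simp [scalingInf]
  have hN : 0 < ∑ i, R i := Finset.sum_pos (fun i _ => hR i) Finset.univ_nonempty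
  have hn : Nonempty (Fin n) := by
    by_contra hn
    rw [not_nonempty_iff] at hn
    simp [hRC] at hN
  obtain ⟨u, v, hu, hv, hmin⟩ := exists_forall_sum_mul_exp_le hG hR hC
  let T : ℝ := ∑ i, ∑ j, G i j * Real.exp (u i) * Real.exp (v j)
  have hT : 0 < T := Finset.sum_pos (fun i _ => Finset.sum_pos (fun j _ =>
    mul_pos (mul_pos (hG i j) (Real.exp_pos _)) (Real.exp_pos _)) Finset.univ_nonempty)
    Finset.univ_nonempty
  have hTexp : ∑ i, ∑ j, G i j * Real.exp (u i + v j) = T := by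
    simp only [T, Real.exp_add, mul_assoc]
  refine ⟨T / ∑ i, R i, fun i => Real.exp (u i), fun j => Real.exp (v j), div_pos hT hN,
    fun i => Real.exp_pos _, fun j => Real.exp_pos _, ?_, ?_, fun i => ?_, fun j => ?_, ?_⟩
  · rw [prod_exp_rpow, hu, Real.exp_zero]
  · rw [prod_exp_rpow, hv, Real.exp_zero]
  · rw [div_mul_eq_mul_div, eq_div_iff hN.ne']
    refine eq_mul_of_forall_sum_le_sum_exp
      (a := fun i => ∑ j, G i j * Real.exp (u i) * Real.exp (v j)) (fun d hd => ?_) i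
    have := hmin (u + d) v (by simp [mul_add, Finset.sum_add_distrib, hu, hd]) hv
    rw [hTexp] at this
    refine this.trans_eq (Finset.sum_congr rfl fun i _ => ?_)
    rw [Finset.sum_mul]
    refine Finset.sum_congr rfl fun j _ => ?_
    rw [Pi.add_apply, Real.exp_add, Real.exp_add]
    ring
  · have hTcomm : ∑ j, ∑ i, G i j * Real.exp (u i) * Real.exp (v j) = T := Finset.sum_comm
    rw [div_mul_eq_mul_div, eq_div_iff hN.ne', hRC, ← hTcomm]
    refine eq_mul_of_forall_sum_le_sum_exp
      (a := fun j => ∑ i, G i j * Real.exp (u i) * Real.exp (v j)) (fun d hd => ?_) j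
    have := hmin u (v + d) hu (by simp [mul_add, Finset.sum_add_distrib, hv, hd])
    rw [hTexp, Finset.sum_comm] at this
    rw [hTcomm]
    refine this.trans_eq (Finset.sum_congr rfl fun j _ => ?_)
    rw [Finset.sum_mul]
    refine Finset.sum_congr rfl fun i _ => ?_
    rw [Pi.add_apply, Real.exp_add, Real.exp_add]
    ring
  · rw [div_mul_cancel₀ _ hN.ne']
    refine IsLeast.csInf_eq ⟨⟨fun i => Real.exp (u i), fun j => Real.exp (v j),
      fun i => Real.exp_pos _, fun j => Real.exp_pos _, ?_, ?_, rfl⟩, ?_⟩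
    · rw [prod_exp_rpow, hu, Real.exp_zero]
    · rw [prod_exp_rpow, hv, Real.exp_zero]
    · rintro z ⟨x, y, hx, hy, hxR, hyC, rfl⟩
      have h1 : ∑ i, R i * Real.log (x i) = 0 := by
        rw [← Real.exp_eq_one_iff, ← prod_exp_rpow, ← hxR]
        exact Finset.prod_congr rfl fun i _ => by rw [Real.exp_log (hx i)]
      have h2 : ∑ j, C j * Real.log (y j) = 0 := by
        rw [← Real.exp_eq_one_iff, ← prod_exp_rpow, ← hyC]
        exact Finset.prod_congr rfl fun j _ => by rw [Real.exp_log (hy j)]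
      have := hmin _ _ h1 h2
      rw [hTexp] at this
      refine this.trans_eq (Finset.sum_congr rfl fun i _ => Finset.sum_congr rfl fun j _ => ?_)
      rw [Real.exp_add, Real.exp_log (hx i), Real.exp_log (hy j), mul_assoc]

end Scaling

section Factorization

theorem perm_scale {ι κ : Type*} [Fintype ι] [Fintype κ] [DecidableEq ι] [DecidableEq κ]
    (M : Matrix ι κ ℝ) (p : ι → ℝ) (q : κ → ℝ) :
    perm (fun i k => M i k * p i * q k) = perm M * (∏ i, p i) * ∏ k, q k := by
  unfold perm
  rw [Finset.sum_mul, Finset.sum_mul]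
  refine Finset.sum_congr rfl fun s _ => ?_
  rw [Finset.prod_mul_distrib, Finset.prod_mul_distrib, Equiv.prod_comp s q]

theorem prod_block {n : ℕ} (c : Fin n → ℕ) (q : Fin n → ℝ) :
    ∏ k : (j : Fin n) × Fin (c j), q k.1 = ∏ j, q j ^ c j := by
  simp [Fintype.prod_sigma]

theorem sum_block {n : ℕ} (c : Fin n → ℕ) (q : Fin n → ℝ) :
    ∑ k : (j : Fin n) × Fin (c j), q k.1 = ∑ j, (c j : ℝ) * q j := by
  simp [Fintype.sum_sigma]

theorem le_one_div_of_sum_mul_eq_one {n : ℕ} {c : Fin n → ℕ} {q : Fin n → ℝ}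
    (hc : ∀ j, 0 < c j) (hq : ∀ j, 0 ≤ q j) (h : ∑ j, (c j : ℝ) * q j = 1) (j : Fin n) :
    q j ≤ 1 / (c j : ℝ) := by
  rw [le_div_iff₀ (Nat.cast_pos.2 (hc j)), ← h, mul_comm]
  exact Finset.single_le_sum (f := fun j => (c j : ℝ) * q j)
    (fun j _ => mul_nonneg (Nat.cast_nonneg _) (hq j)) (Finset.mem_univ j)

end Factorization

theorem block_doubly_stochastic_factorization {m n N : ℕ}
    (G : Fin m → Fin n → ℝ) (hG : ∀ i j, 0 < G i j)
    (R : Fin m → ℕ) (C : Fin n → ℕ)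
    (hRpos : ∀ i, 0 < R i) (hCpos : ∀ j, 0 < C j)
    (hRN : ∑ i, R i = N) (hCN : ∑ j, C j = N) :
    ∃ B : Matrix ((i : Fin m) × Fin (R i)) ((j : Fin n) × Fin (C j)) ℝ,
      -- B has the same block structure as A(G;R,C): constant on each block
      (∀ (i : Fin m) (j : Fin n) (a a' : Fin (R i)) (b b' : Fin (C j)),
          B ⟨i, a⟩ ⟨j, b⟩ = B ⟨i, a'⟩ ⟨j, b'⟩) ∧
      -- (1) B is doubly stochastic
      (∀ r c, 0 ≤ B r c) ∧
      (∀ r, ∑ c, B r c = 1) ∧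
      (∀ c, ∑ r, B r c = 1) ∧
      -- (2) entries of the (i,j)-th block do not exceed min {1/r_i, 1/c_j}
      (∀ (i : Fin m) (j : Fin n) (a : Fin (R i)) (b : Fin (C j)),
          B ⟨i, a⟩ ⟨j, b⟩ ≤ min (1 / (R i : ℝ)) (1 / (C j : ℝ))) ∧
      -- (3) per A = N⁻ᴺ f(G;R,C)ᴺ (∏ r_i^{r_i}) (∏ c_j^{c_j}) per B
      perm (blockMat G R C) =
        ((N : ℝ) ^ N)⁻¹ *
          scalingInf G (fun i => (R i : ℝ)) (fun j => (C j : ℝ)) ^ N *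
          (∏ i, (R i : ℝ) ^ (R i)) * (∏ j, (C j : ℝ) ^ (C j)) * perm B ∧
      -- (4) N!/Nᴺ ≤ per B ≤ min {∏ r_i!/r_i^{r_i}, ∏ c_j!/c_j^{c_j}}
      (Nat.factorial N : ℝ) / (N : ℝ) ^ N ≤ perm B ∧
      perm B ≤ min (∏ i, (Nat.factorial (R i) : ℝ) / (R i : ℝ) ^ (R i))
                   (∏ j, (Nat.factorial (C j) : ℝ) / (C j : ℝ) ^ (C j)) := by
  obtain ⟨l, x, y, hl, hx, hy, hxR, hyC, hrow, hcol, hinf⟩ := exists_scaling hG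
    (R := fun i => (R i : ℝ)) (C := fun j => (C j : ℝ)) (fun i => Nat.cast_pos.2 (hRpos i))
    (fun j => Nat.cast_pos.2 (hCpos j)) (by exact_mod_cast hRN.trans hCN.symm)
  simp only [Real.rpow_natCast] at hxR hyC
  have hR : ∀ i, (0 : ℝ) < R i := fun i => Nat.cast_pos.2 (hRpos i)
  have hC : ∀ j, (0 : ℝ) < C j := fun j => Nat.cast_pos.2 (hCpos j)
  have hinfN : scalingInf G (fun i => (R i : ℝ)) (fun j => (C j : ℝ)) = l * N := by
    rw [hinf, ← hRN, Nat.cast_sum]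
  let b : Fin m → Fin n → ℝ := fun i j => G i j * x i * y j / (l * R i * C j)
  have hb : ∀ i j, 0 < b i j := fun i j =>
    div_pos (mul_pos (mul_pos (hG i j) (hx i)) (hy j)) (mul_pos (mul_pos hl (hR i)) (hC j))
  have hbrow : ∀ i, ∑ j, (C j : ℝ) * b i j = 1 := by
    intro i
    rw [← div_self (mul_pos hl (hR i)).ne']
    nth_rw 1 [← hrow i]
    rw [Finset.sum_div]
    refine Finset.sum_congr rfl fun j _ => ?_
    have := (hR i).ne'
    have := (hC j).ne'
    simp only [b]
    field_simp
  have hbcol : ∀ j, ∑ i, (R i : ℝ) * b i j = 1 := by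
    intro j
    rw [← div_self (mul_pos hl (hC j)).ne']
    nth_rw 1 [← hcol j]
    rw [Finset.sum_div]
    refine Finset.sum_congr rfl fun i _ => ?_
    have := (hR i).ne'
    have := (hC j).ne'
    simp only [b]
    field_simp
  have hBrow : ∀ i, ∑ k : (j : Fin n) × Fin (C j), b i k.1 = 1 := fun i =>
    (sum_block C (b i)).trans (hbrow i)
  have hBcol : ∀ j, ∑ k : (i : Fin m) × Fin (R i), b k.1 j = 1 := fun j =>
    (sum_block R fun i => b i j).trans (hbcol j)
  refine ⟨fun r k => b r.1 k.1, fun _ _ _ _ _ _ => rfl, fun _ _ => (hb _ _).le,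
    fun r => hBrow r.1, fun k => hBcol k.1, fun i j _ _ => le_min ?_ ?_, ?_, ?_, le_min ?_ ?_⟩
  · exact le_one_div_of_sum_mul_eq_one hRpos (fun i => (hb i j).le) (hbcol j) i
  · exact le_one_div_of_sum_mul_eq_one hCpos (fun j => (hb i j).le) (hbrow i) j
  · have hA : blockMat G R C = fun r k => b r.1 k.1 * (l * R r.1 / x r.1) * (C k.1 / y k.1) := by
      funext r k
      have := (hR r.1).ne'
      have := (hC k.1).ne'
      have := (hx r.1).ne'
      have := (hy k.1).ne'
      simp only [b, blockMat]
      field_simp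
    rw [hA, perm_scale (fun (r : (i : Fin m) × Fin (R i)) (k : (j : Fin n) × Fin (C j)) =>
        b r.1 k.1) (fun r => l * R r.1 / x r.1) (fun k => C k.1 / y k.1),
      prod_block R (fun i => l * R i / x i), prod_block C (fun j => C j / y j)]
    simp only [div_pow, mul_pow, Finset.prod_div_distrib, Finset.prod_mul_distrib, hxR, hyC,
      Finset.prod_pow_eq_pow_sum, hRN, div_one, hinfN]
    have hN : ((N : ℝ) ^ N) ≠ 0 := by
      rcases Nat.eq_zero_or_pos N with h | h
      · simp [h]
      · positivity
    field_simp
  · have := factorial_div_pow_le_perm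
      (B := fun (r : (i : Fin m) × Fin (R i)) (k : (j : Fin n) × Fin (C j)) => b r.1 k.1)
      (fun _ _ => hb _ _) (fun r => hBrow r.1) (fun k => hBcol k.1) (by simp [hRN, hCN])
    simpa [hCN] using this
  · refine (perm_transpose _).symm.trans_le ?_
    exact perm_le_prod_factorial_div_pow
      (fun (k : (j : Fin n) × Fin (C j)) i => b i k.1) (fun _ _ => (hb _ _).le)
      fun k => hBcol k.1
  · exact perm_le_prod_factorial_div_pow
      (fun (r : (i : Fin m) × Fin (R i)) j => b r.1 j) (fun _ _ => (hb _ _).le)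
      fun r => hBrow r.1
end
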